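/- Let n ≥ 2 and let F ⊆ S^{2n−1} be nonempty. If the direction set F' ⊆ ℂ^{n−1} is an F_σ set that is pluripolar (equivalently, c_{n−1}(F') = 0), then the suspension S₀(F) is not normal: there exists a formal power series S ∈ ℂ[[z₁,…,zₙ]] such that for each v ∈ F the one-variable series S(tv) ∈ ℂ[[t]] has a positive radius of convergence, but S does not converge uniformly on any open neighborhood of the origin. -/

import Mathlib

open MeasureTheory Filter Metric Set
open scoped ENNReal

noncomputable section

/-- The nonnegative part of an extended real, as an element of `ℝ≥0∞`. -/
def erealToENNReal (x : EReal) : ℝ≥0∞ :=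
  if x = ⊤ then ⊤ else ENNReal.ofReal x.toReal

/-- Integral of an `EReal`-valued function: the integral of the positive part minus
the integral of the negative part (both computed as lower integrals). -/
def erealIntegral {α : Type*} [MeasurableSpace α] (μ : Measure α) (g : α → EReal) : EReal :=
  ((∫⁻ x, erealToENNReal (g x) ∂μ : ℝ≥0∞) : EReal)
    - ((∫⁻ x, erealToENNReal (-(g x)) ∂μ : ℝ≥0∞) : EReal)

/-- The mean of an `EReal`-valued function over the circle of radius `r` centered at `a`
along the complex line through `a` with direction `b`. -/
def circleLineMean {E : Type*} [AddCommGroup E] [Module ℂ E]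
    (u : E → EReal) (a b : E) (r : ℝ) : EReal :=
  (((2 * Real.pi)⁻¹ : ℝ) : EReal) *
    erealIntegral (volume.restrict (Set.Ioc (0:ℝ) (2 * Real.pi)))
      (fun θ : ℝ => u (a + (r * Complex.exp (θ * Complex.I)) • b))

/-- `u : ℂᵐ → [-∞,∞)` is plurisubharmonic: upper semicontinuous, not identically `-∞`,
never `+∞`, and satisfying the sub-mean value inequality over circles on every complex line. -/
def IsPSH {m : ℕ} (u : EuclideanSpace ℂ (Fin m) → EReal) : Prop :=
  UpperSemicontinuous u ∧ (∃ z, u z ≠ ⊥) ∧ (∀ z, u z ≠ ⊤) ∧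
    ∀ (a b : EuclideanSpace ℂ (Fin m)) (r : ℝ), 0 < r → u a ≤ circleLineMean u a b r

/-- A set `E ⊆ ℂᵐ` is pluripolar if it is contained in the `-∞` set of some
plurisubharmonic function. -/
def Pluripolar {m : ℕ} (E : Set (EuclideanSpace ℂ (Fin m))) : Prop :=
  ∃ u, IsPSH u ∧ ∀ z ∈ E, u z = ⊥

/-- The Lelong class `L_m` of plurisubharmonic functions of logarithmic growth. -/
def LelongClass (m : ℕ) : Set (EuclideanSpace ℂ (Fin m) → EReal) :=
  {u | IsPSH u ∧ ∃ C : ℝ, ∀ z, u z ≤ ((C + Real.log (1 + ‖z‖) : ℝ) : EReal)}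

/-- The Siciak extremal function `V_E`. -/
def extremalFn {m : ℕ} (E : Set (EuclideanSpace ℂ (Fin m))) (z : EuclideanSpace ℂ (Fin m)) :
    EReal :=
  sSup {x : EReal | ∃ u ∈ LelongClass m, (∀ w ∈ E, u w ≤ 0) ∧ x = u z}

/-- The upper regularization `V*_E(a) = limsup_{w → a} V_E(w)`. -/
def extremalFnStar {m : ℕ} (E : Set (EuclideanSpace ℂ (Fin m)))
    (a : EuclideanSpace ℂ (Fin m)) : EReal :=
  Filter.limsup (extremalFn E) (nhds a)

/-- `E` is L-regular at `a`. -/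
def LRegularAt {m : ℕ} (E : Set (EuclideanSpace ℂ (Fin m)))
    (a : EuclideanSpace ℂ (Fin m)) : Prop :=
  extremalFnStar E a = 0

/-- `E` is locally L-regular at `a`. -/
def LocallyLRegularAt {m : ℕ} (E : Set (EuclideanSpace ℂ (Fin m)))
    (a : EuclideanSpace ℂ (Fin m)) : Prop :=
  ∀ r : ℝ, 0 < r → LRegularAt (E ∩ Metric.ball a r) a

/-- The `i`-th direction set `F'_i ⊆ ℂ^{n-1}`. -/
def dirSetI {m : ℕ} (F : Set (EuclideanSpace ℂ (Fin (m + 1)))) (i : Fin (m + 1)) :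
    Set (EuclideanSpace ℂ (Fin m)) :=
  {w | ∃ z ∈ F, z i ≠ 0 ∧ ∀ j : Fin m, w j = z (i.succAbove j) / z i}

/-- The direction set `F' = ∪ᵢ F'_i`. -/
def dirSet {m : ℕ} (F : Set (EuclideanSpace ℂ (Fin (m + 1)))) :
    Set (EuclideanSpace ℂ (Fin m)) :=
  ⋃ i, dirSetI F i

/-- `v ∈ F̄` generates a regular leaf of `S₀(F)`. -/
def GeneratesRegularLeaf {m : ℕ} (F : Set (EuclideanSpace ℂ (Fin (m + 1))))
    (v : EuclideanSpace ℂ (Fin (m + 1))) : Prop :=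
  v ∈ closure F ∧ ∃ i : Fin (m + 1), v i ≠ 0 ∧
    LocallyLRegularAt (dirSetI F i)
      (WithLp.toLp 2 (fun j : Fin m => v (i.succAbove j) / v i : Fin m → ℂ) :
        EuclideanSpace ℂ (Fin m))

/-- The coefficients of the one-variable restriction `t ↦ S(tv)` of a formal power series. -/
def lineCoeff {n : ℕ} (S : MvPowerSeries (Fin n) ℂ) (v : EuclideanSpace ℂ (Fin n)) (k : ℕ) :
    ℂ :=
  ∑ I ∈ Finset.Nat.antidiagonalTuple n k,
    MvPowerSeries.coeff (Finsupp.equivFunOnFinite.symm I) S * ∏ i, v i ^ I i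

/-- A one-variable power series (given by its coefficients) has a positive radius of
convergence. -/
def HasPosRadius (c : ℕ → ℂ) : Prop :=
  ∃ r : ℝ, 0 < r ∧ Summable fun k => ‖c k‖ * r ^ k

/-- The degree-wise partial sums of a formal power series in `n` variables. -/
def partialSum {n : ℕ} (S : MvPowerSeries (Fin n) ℂ) (N : ℕ) (z : EuclideanSpace ℂ (Fin n)) :
    ℂ :=
  ∑ k ∈ Finset.range N, ∑ I ∈ Finset.Nat.antidiagonalTuple n k,
    MvPowerSeries.coeff (Finsupp.equivFunOnFinite.symm I) S * ∏ i, z i ^ I i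

/-- `S` converges uniformly on some neighborhood of the origin. -/
def ConvUnifNearZero {n : ℕ} (S : MvPowerSeries (Fin n) ℂ) : Prop :=
  ∃ r : ℝ, 0 < r ∧ ∃ g : EuclideanSpace ℂ (Fin n) → ℂ,
    TendstoUniformlyOn (partialSum S) g Filter.atTop
      (Metric.ball (0 : EuclideanSpace ℂ (Fin n)) r)

section

open Complex ComplexConjugate
open scoped ContDiff

section
abbrev EC (m : ℕ) := EuclideanSpace ℂ (Fin m)

def ee {m : ℕ} (j : Fin m) : EC m := EuclideanSpace.single j 1

/-- directional derivative -/
def dv {m : ℕ} (h : EC m) (f : EC m → ℂ) (x : EC m) : ℂ := fderiv ℝ f x h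

def dz {m : ℕ} (j : Fin m) (f : EC m → ℂ) (x : EC m) : ℂ :=
  (dv (ee j) f x - I * dv (I • ee j) f x) / 2

def dzb {m : ℕ} (j : Fin m) (f : EC m → ℂ) (x : EC m) : ℂ :=
  (dv (ee j) f x + I * dv (I • ee j) f x) / 2

structure IsTest {m : ℕ} (f : EC m → ℂ) : Prop where
  smooth : ContDiff ℝ ∞ f
  supp : HasCompactSupport f

section calcul
variable {m : ℕ}

lemma smooth_dv {f : EC m → ℂ} (hf : ContDiff ℝ ∞ f) (h : EC m) : ContDiff ℝ ∞ (dv h f) := by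
  unfold dv
  exact (hf.fderiv_right (m := ∞) (by simp)).clm_apply contDiff_const

lemma smooth_diff {f : EC m → ℂ} (hf : ContDiff ℝ ∞ f) : Differentiable ℝ f :=
  hf.differentiable (by simp)

lemma smooth_dz {f : EC m → ℂ} (hf : ContDiff ℝ ∞ f) (j : Fin m) : ContDiff ℝ ∞ (dz j f) := by
  unfold dz
  exact ((smooth_dv hf _).sub (contDiff_const.mul (smooth_dv hf _))).div_const _

lemma smooth_dzb {f : EC m → ℂ} (hf : ContDiff ℝ ∞ f) (j : Fin m) : ContDiff ℝ ∞ (dzb j f) := by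
  unfold dzb
  exact ((smooth_dv hf _).add (contDiff_const.mul (smooth_dv hf _))).div_const _

lemma dv_add {f g : EC m → ℂ} (hf : ContDiff ℝ ∞ f) (hg : ContDiff ℝ ∞ g) (h x : EC m) :
    dv h (fun y => f y + g y) x = dv h f x + dv h g x := by
  unfold dv
  rw [fderiv_fun_add (smooth_diff hf x) (smooth_diff hg x)]; rfl

lemma dv_mul {f g : EC m → ℂ} (hf : ContDiff ℝ ∞ f) (hg : ContDiff ℝ ∞ g) (h x : EC m) :
    dv h (fun y => f y * g y) x = dv h f x * g x + f x * dv h g x := by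
  unfold dv
  rw [fderiv_fun_mul (smooth_diff hf x) (smooth_diff hg x)]
  simp; ring

lemma dv_neg {f : EC m → ℂ} (h x : EC m) :
    dv h (fun y => - f y) x = - dv h f x := by
  unfold dv
  rw [fderiv_fun_neg]; rfl

lemma dv_cmul {f : EC m → ℂ} (hf : ContDiff ℝ ∞ f) (c : ℂ) (h x : EC m) :
    dv h (fun y => c * f y) x = c * dv h f x := by
  unfold dv
  rw [fderiv_const_mul (smooth_diff hf x)]; rfl

lemma dv_conj {f : EC m → ℂ} (hf : ContDiff ℝ ∞ f) (h x : EC m) :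
    dv h (fun y => conj (f y)) x = conj (dv h f x) := by
  unfold dv
  have := ((Complex.conjCLE.toContinuousLinearMap).hasFDerivAt (x := f x)).comp x
    (smooth_diff hf x).hasFDerivAt
  have h2 := this.fderiv
  have h3 : (fun y => conj (f y)) = (Complex.conjCLE.toContinuousLinearMap : ℂ → ℂ) ∘ f := by
    ext y; simp
  rw [h3, h2]; simp

lemma dv_comm {f : EC m → ℂ} (hf : ContDiff ℝ ∞ f) (h k x : EC m) :
    dv h (dv k f) x = dv k (dv h f) x := by
  have hs : IsSymmSndFDerivAt ℝ f x :=
    (hf.contDiffAt).isSymmSndFDerivAt (by simp only [minSmoothness_of_isRCLikeNormedField]; exact WithTop.coe_le_coe.2 (le_top : (2:ℕ∞) ≤ ⊤))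
  have hd : DifferentiableAt ℝ (fderiv ℝ f) x :=
    ((hf.fderiv_right (m := ∞) (by simp)).differentiable (by simp)) x
  have key : ∀ h k : EC m, dv h (dv k f) x = fderiv ℝ (fderiv ℝ f) x h k := by
    intro h k
    unfold dv
    rw [fderiv_clm_apply hd (differentiableAt_const _)]
    simp
  rw [key, key]; exact hs h k

lemma dz_add {f g : EC m → ℂ} (hf : ContDiff ℝ ∞ f) (hg : ContDiff ℝ ∞ g) (j : Fin m) (x : EC m) :
    dz j (fun y => f y + g y) x = dz j f x + dz j g x := by
  simp only [dz, dv_add hf hg]; ring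
lemma dzb_add {f g : EC m → ℂ} (hf : ContDiff ℝ ∞ f) (hg : ContDiff ℝ ∞ g) (j : Fin m) (x : EC m) :
    dzb j (fun y => f y + g y) x = dzb j f x + dzb j g x := by
  simp only [dzb, dv_add hf hg]; ring
lemma dz_mul {f g : EC m → ℂ} (hf : ContDiff ℝ ∞ f) (hg : ContDiff ℝ ∞ g) (j : Fin m) (x : EC m) :
    dz j (fun y => f y * g y) x = dz j f x * g x + f x * dz j g x := by
  simp only [dz, dv_mul hf hg]; ring
lemma dzb_mul {f g : EC m → ℂ} (hf : ContDiff ℝ ∞ f) (hg : ContDiff ℝ ∞ g) (j : Fin m) (x : EC m) :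
    dzb j (fun y => f y * g y) x = dzb j f x * g x + f x * dzb j g x := by
  simp only [dzb, dv_mul hf hg]; ring
lemma dz_neg {f : EC m → ℂ} (j : Fin m) (x : EC m) :
    dz j (fun y => - f y) x = - dz j f x := by
  simp only [dz, dv_neg]; ring
lemma dzb_neg {f : EC m → ℂ} (j : Fin m) (x : EC m) :
    dzb j (fun y => - f y) x = - dzb j f x := by
  simp only [dzb, dv_neg]; ring
lemma dzb_conj {f : EC m → ℂ} (hf : ContDiff ℝ ∞ f) (j : Fin m) (x : EC m) :
    dzb j (fun y => conj (f y)) x = conj (dz j f x) := by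
  simp only [dzb, dz, dv_conj hf]; simp [Complex.conj_ofNat]
lemma dz_conj {f : EC m → ℂ} (hf : ContDiff ℝ ∞ f) (j : Fin m) (x : EC m) :
    dz j (fun y => conj (f y)) x = conj (dzb j f x) := by
  simp only [dzb, dz, dv_conj hf]; simp [Complex.conj_ofNat]; ring

lemma dv_lin {f g : EC m → ℂ} (hf : ContDiff ℝ ∞ f) (hg : ContDiff ℝ ∞ g) (c : ℂ) (h x : EC m) :
    dv h (fun y => (f y + c * g y) / 2) x = (dv h f x + c * dv h g x) / 2 := by
  have : (fun y => (f y + c * g y) / 2) = fun y => (1/2 : ℂ) * (f y + c * g y) := by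
    ext y; ring
  rw [this, dv_cmul (hf.add (contDiff_const.mul hg)), dv_add hf (contDiff_const.mul hg), dv_cmul hg]
  ring

lemma dzb_dz {f : EC m → ℂ} (hf : ContDiff ℝ ∞ f) (j k : Fin m) (x : EC m) :
    dzb k (dz j f) x = dz j (dzb k f) x := by
  have e1 : dz j f = fun y => (dv (ee j) f y + (-I) * dv (I • ee j) f y) / 2 := by
    ext y; simp only [dz]; ring
  have e2 : dzb k f = fun y => (dv (ee k) f y + I * dv (I • ee k) f y) / 2 := by
    ext y; simp only [dzb]
  rw [e1, e2]
  simp only [dzb, dz]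
  simp only [dv_lin (smooth_dv hf _) (smooth_dv hf _)]
  rw [dv_comm hf (ee k) (ee j), dv_comm hf (ee k) (I • ee j), dv_comm hf (I • ee k) (ee j),
    dv_comm hf (I • ee k) (I • ee j)]
  ring

namespace IsTest
lemma cont {f : EC m → ℂ} (hf : IsTest f) : Continuous f := hf.smooth.continuous
lemma integrable {f : EC m → ℂ} (hf : IsTest f) : Integrable f :=
  hf.cont.integrable_of_hasCompactSupport hf.supp
lemma memLp {f : EC m → ℂ} (hf : IsTest f) : MemLp f 2 := hf.cont.memLp_of_hasCompactSupport hf.supp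
lemma mul_smooth {f g : EC m → ℂ} (hf : IsTest f) (hg : ContDiff ℝ ∞ g) :
    IsTest (fun x => f x * g x) := ⟨hf.smooth.mul hg, hf.supp.mul_right⟩
lemma smooth_mul {f g : EC m → ℂ} (hf : IsTest f) (hg : ContDiff ℝ ∞ g) :
    IsTest (fun x => g x * f x) := ⟨hg.mul hf.smooth, hf.supp.mul_left⟩
lemma add {f g : EC m → ℂ} (hf : IsTest f) (hg : IsTest g) :
    IsTest (fun x => f x + g x) := ⟨hf.smooth.add hg.smooth, hf.supp.add hg.supp⟩
lemma neg {f : EC m → ℂ} (hf : IsTest f) :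
    IsTest (fun x => - f x) := ⟨hf.smooth.neg, hf.supp.neg⟩
lemma sub {f g : EC m → ℂ} (hf : IsTest f) (hg : IsTest g) :
    IsTest (fun x => f x - g x) := by
  simpa [sub_eq_add_neg] using hf.add hg.neg
lemma zero : IsTest (fun _ : EC m => (0:ℂ)) := ⟨contDiff_const, HasCompactSupport.zero⟩
lemma sum {ι : Type*} (s : Finset ι) {f : ι → EC m → ℂ} (hf : ∀ i ∈ s, IsTest (f i)) :
    IsTest (fun x => ∑ i ∈ s, f i x) := by
  classical
  induction s using Finset.induction_on with
  | empty => simpa using zero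
  | insert i s hi ih =>
    simp only [Finset.sum_insert hi]
    exact (hf i (by simp)).add (ih fun j hj => hf j (by simp [hj]))
lemma star {f : EC m → ℂ} (hf : IsTest f) : IsTest (fun x => conj (f x)) := by
  refine ⟨?_, hf.supp.comp_left (g := fun z : ℂ => conj z) (by simp)⟩
  exact Complex.conjCLE.contDiff.comp hf.smooth
lemma dv {f : EC m → ℂ} (hf : IsTest f) (h : EC m) : IsTest (dv h f) :=
  ⟨smooth_dv hf.smooth h, hf.supp.fderiv_apply ℝ h⟩
lemma dz {f : EC m → ℂ} (hf : IsTest f) (j : Fin m) : IsTest (dz j f) := by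
  have := ((hf.dv (ee j)).sub ((hf.dv (I • ee j)).smooth_mul (g := fun _ => I) contDiff_const)).mul_smooth
    (g := fun _ => (1/2:ℂ)) contDiff_const
  convert this using 2; simp only [_root_.dz]; ring
lemma dzb {f : EC m → ℂ} (hf : IsTest f) (j : Fin m) : IsTest (dzb j f) := by
  have := ((hf.dv (ee j)).add ((hf.dv (I • ee j)).smooth_mul (g := fun _ => I) contDiff_const)).mul_smooth
    (g := fun _ => (1/2:ℂ)) contDiff_const
  convert this using 2; simp only [_root_.dzb]; ring
end IsTest

lemma smooth_conj {f : EC m → ℂ} (hf : ContDiff ℝ ∞ f) : ContDiff ℝ ∞ (fun x => conj (f x)) :=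
  Complex.conjCLE.contDiff.comp hf

lemma ibp_dv {a b : EC m → ℂ} (ha : IsTest a) (hb : ContDiff ℝ ∞ b) (h : EC m) :
    ∫ x, dv h a x * b x = - ∫ x, a x * dv h b x := by
  have := integral_mul_fderiv_eq_neg_fderiv_mul_of_integrable (μ := (volume : Measure (EC m)))
    (f := a) (g := b) (v := h) ((ha.dv h).mul_smooth hb).integrable
    (ha.mul_smooth (smooth_dv hb h)).integrable (ha.mul_smooth hb).integrable
    (fun x _ => smooth_diff ha.smooth x) (fun x _ => smooth_diff hb x)
  unfold dv
  rw [this, neg_neg]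

lemma ibp_dzb {a b : EC m → ℂ} (ha : IsTest a) (hb : ContDiff ℝ ∞ b) (j : Fin m) :
    ∫ x, dzb j a x * b x = - ∫ x, a x * dzb j b x := by
  have e1 : ∀ x, dzb j a x * b x = (1/2:ℂ) * (dv (ee j) a x * b x) + (I/2) * (dv (I • ee j) a x * b x) := by
    intro x; simp only [dzb]; ring
  have e2 : ∀ x, a x * dzb j b x = (1/2:ℂ) * (a x * dv (ee j) b x) + (I/2) * (a x * dv (I • ee j) b x) := by
    intro x; simp only [dzb]; ring
  simp only [e1, e2]
  rw [integral_add, integral_add]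
  · simp only [integral_const_mul]
    rw [ibp_dv ha hb, ibp_dv ha hb]; ring
  · exact (ha.mul_smooth (smooth_dv hb _)).integrable.const_mul _
  · exact (ha.mul_smooth (smooth_dv hb _)).integrable.const_mul _
  · exact ((ha.dv _).mul_smooth hb).integrable.const_mul _
  · exact ((ha.dv _).mul_smooth hb).integrable.const_mul _

end calcul

/-- twisted operators -/
def Vc {m : ℕ} (V : EC m → ℝ) : EC m → ℂ := fun x => (V x : ℂ)
def Db {m : ℕ} (V : EC m → ℝ) (j : Fin m) (f : EC m → ℂ) (x : EC m) : ℂ :=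
  dzb j f x + dzb j (Vc V) x * f x
def Dd {m : ℕ} (V : EC m → ℝ) (j : Fin m) (f : EC m → ℂ) (x : EC m) : ℂ :=
  - dz j f x + dz j (Vc V) x * f x

section basic
variable {m : ℕ} {V : EC m → ℝ} (hV : ContDiff ℝ ∞ V)
include hV

lemma smooth_Vc : ContDiff ℝ ∞ (Vc V) := Complex.ofRealCLM.contDiff.comp hV

lemma conj_dz_Vc (j : Fin m) (x : EC m) : conj (dz j (Vc V) x) = dzb j (Vc V) x := by
  rw [← dzb_conj (smooth_Vc hV)]
  congr 1; ext y; simp [Vc]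

lemma smooth_Db {f : EC m → ℂ} (hf : ContDiff ℝ ∞ f) (j : Fin m) : ContDiff ℝ ∞ (Db V j f) :=
  (smooth_dzb hf j).add ((smooth_dzb (smooth_Vc hV) j).mul hf)
lemma smooth_Dd {f : EC m → ℂ} (hf : ContDiff ℝ ∞ f) (j : Fin m) : ContDiff ℝ ∞ (Dd V j f) :=
  (smooth_dz hf j).neg.add ((smooth_dz (smooth_Vc hV) j).mul hf)

lemma IsTest.Db {f : EC m → ℂ} (hf : IsTest f) (j : Fin m) : IsTest (Db V j f) :=
  (hf.dzb j).add (hf.smooth_mul (smooth_dzb (smooth_Vc hV) j))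
lemma IsTest.Dd {f : EC m → ℂ} (hf : IsTest f) (j : Fin m) : IsTest (Dd V j f) :=
  (hf.dz j).neg.add (hf.smooth_mul (smooth_dz (smooth_Vc hV) j))

lemma Db_adj {a b : EC m → ℂ} (ha : IsTest a) (hb : IsTest b) (j : Fin m) :
    ∫ x, Db V j a x * conj (b x) = ∫ x, a x * conj (Dd V j b x) := by
  have e1 : ∀ x, Db V j a x * conj (b x) = dzb j a x * conj (b x) +
      dzb j (Vc V) x * a x * conj (b x) := by intro x; simp only [Db]; ring
  have e2 : ∀ x, a x * conj (Dd V j b x) = - (a x * dzb j (fun y => conj (b y)) x) +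
      dzb j (Vc V) x * a x * conj (b x) := by
    intro x; simp only [Dd, dzb_conj hb.smooth, map_add, map_neg, map_mul, conj_dz_Vc hV]; ring
  simp only [e1, e2]
  have i3 : Integrable (fun x => dzb j (Vc V) x * a x * conj (b x)) :=
    ((ha.smooth_mul (smooth_dzb (smooth_Vc hV) j)).mul_smooth hb.star.smooth).integrable
  rw [integral_add ((ha.dzb j).mul_smooth hb.star.smooth).integrable i3,
    integral_add (ha.mul_smooth (smooth_dzb hb.star.smooth j)).neg.integrable i3,
    ibp_dzb ha hb.star.smooth, integral_neg]

lemma Dd_adj {a b : EC m → ℂ} (ha : IsTest a) (hb : IsTest b) (j : Fin m) :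
    ∫ x, Dd V j a x * conj (b x) = ∫ x, a x * conj (Db V j b x) := by
  have := Db_adj hV hb ha j
  have h2 := congrArg conj this
  rw [← integral_conj, ← integral_conj] at h2
  simp only [map_mul, conj_conj] at h2
  calc _ = ∫ x, conj (b x) * Dd V j a x := by congr 1; ext x; ring
    _ = _ := h2.symm
    _ = _ := by congr 1; ext x; ring

lemma comm_Db_Dd {b : EC m → ℂ} (hb : ContDiff ℝ ∞ b) (j k : Fin m) (x : EC m) :
    Db V k (Dd V j b) x = Dd V j (Db V k b) x + 2 * dz j (dzb k (Vc V)) x * b x := by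
  have hc := smooth_Vc hV
  have e1 : Dd V j b = fun x => (- dz j b x) + dz j (Vc V) x * b x := rfl
  have e2 : Db V k b = fun x => dzb k b x + dzb k (Vc V) x * b x := rfl
  rw [e1, e2]
  simp only [Db, Dd]
  rw [dzb_add (smooth_dz hb j).neg ((smooth_dz hc j).mul hb), dzb_neg,
    dzb_mul (smooth_dz hc j) hb, dz_add (smooth_dzb hb k) ((smooth_dzb hc k).mul hb),
    dz_mul (smooth_dzb hc k) hb, dzb_dz hb, dzb_dz hc]
  ring

/-- the Bochner–Kodaira inequality -/
lemma bochner {c : ℝ} (hL : ∀ x, ∀ t : Fin m → ℂ, c * ∑ j, ‖t j‖ ^ 2 ≤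
      (∑ j, ∑ k, dz j (dzb k (Vc V)) x * t j * conj (t k)).re)
    {β : Fin m → EC m → ℂ} (hβ : ∀ j, IsTest (β j)) :
    2 * c * ∑ j, ∫ x, ‖β j x‖ ^ 2 ≤ (∫ x, ‖∑ j, Dd V j (β j) x‖ ^ 2) +
      (1 / 2) * ∑ j, ∑ k, ∫ x, ‖Db V k (β j) x - Db V j (β k) x‖ ^ 2 := by
  have hc := smooth_Vc hV
  -- pairing identity
  have key : ∀ j k, ∫ x, Dd V j (β j) x * conj (Dd V k (β k) x) =
      ∫ x, (Db V k (β j) x * conj (Db V j (β k) x) +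
        2 * (dz j (dzb k (Vc V)) x * β j x * conj (β k x))) := by
    intro j k
    rw [← Db_adj hV ((hβ j).Dd hV j) (hβ k) k]
    simp only [comm_Db_Dd hV (hβ j).smooth]
    have : ∀ x, (Dd V j (Db V k (β j)) x + 2 * dz j (dzb k (Vc V)) x * β j x) * conj (β k x)
      = Dd V j (Db V k (β j)) x * conj (β k x) + 2 * (dz j (dzb k (Vc V)) x * β j x * conj (β k x)) := by
      intro x; ring
    simp only [this]
    have i2 : Integrable (fun x => 2 * (dz j (dzb k (Vc V)) x * β j x * conj (β k x))) :=
      (((hβ j).smooth_mul (smooth_dz (smooth_dzb hc k) j)).mul_smooth (hβ k).star.smooth).integrable.const_mul _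
    rw [integral_add ((((hβ j).Db hV k).Dd hV j).mul_smooth (hβ k).star.smooth).integrable i2,
      integral_add (((hβ j).Db hV k).mul_smooth ((hβ k).Db hV j).star.smooth).integrable i2,
      Dd_adj hV ((hβ j).Db hV k) (hβ k)]
  have hI1 : ∀ j k, Integrable (fun x => Dd V j (β j) x * conj (Dd V k (β k) x)) := fun j k =>
    (((hβ j).Dd hV j).mul_smooth ((hβ k).Dd hV k).star.smooth).integrable
  have hI2 : ∀ j k, Integrable (fun x => (Db V k (β j) x * conj (Db V j (β k) x) +
        2 * (dz j (dzb k (Vc V)) x * β j x * conj (β k x)))) := fun j k =>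
    (((hβ j).Db hV k).mul_smooth ((hβ k).Db hV j).star.smooth).integrable.add
      ((((hβ j).smooth_mul (smooth_dz (smooth_dzb hc k) j)).mul_smooth (hβ k).star.smooth).integrable.const_mul _)
  have sq : ∀ {f : EC m → ℂ}, IsTest f → Integrable (fun x => ‖f x‖ ^ 2) := by
    intro f hf
    exact hf.memLp.integrable_norm_pow (by norm_num)
  have big : ∫ x, (∑ j, ∑ k, Dd V j (β j) x * conj (Dd V k (β k) x)) =
      ∫ x, ∑ j, ∑ k, (Db V k (β j) x * conj (Db V j (β k) x) +
        2 * (dz j (dzb k (Vc V)) x * β j x * conj (β k x))) := by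
    rw [integral_finsetSum _ fun j _ => integrable_finsetSum _ fun k _ => hI1 j k,
      integral_finsetSum _ fun j _ => integrable_finsetSum _ fun k _ => hI2 j k]
    refine Finset.sum_congr rfl fun j _ => ?_
    rw [integral_finsetSum _ fun k _ => hI1 j k, integral_finsetSum _ fun k _ => hI2 j k]
    exact Finset.sum_congr rfl fun k _ => key j k
  have bigre : ∫ x, ‖∑ j, Dd V j (β j) x‖ ^ 2 =
      ∫ x, (∑ j, ∑ k, (Db V k (β j) x * conj (Db V j (β k) x) +
        2 * (dz j (dzb k (Vc V)) x * β j x * conj (β k x)))).re := by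
    have h1 := congrArg Complex.re big
    have r := integral_re (𝕜 := ℂ) (integrable_finsetSum Finset.univ fun j _ =>
      integrable_finsetSum Finset.univ fun k _ => hI2 j k)
    have r1 := integral_re (𝕜 := ℂ) (integrable_finsetSum Finset.univ fun j _ =>
      integrable_finsetSum Finset.univ fun k _ => hI1 j k)
    simp only [RCLike.re_eq_complex_re] at r r1
    rw [r, ← h1, ← r1]
    congr 1; ext x
    rw [← Finset.sum_mul_sum, ← map_sum, Complex.mul_conj, Complex.ofReal_re, Complex.normSq_eq_norm_sq]
  have hS : Integrable (fun x => ∑ j, ‖β j x‖ ^ 2) := integrable_finsetSum _ fun j _ => sq (hβ j)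
  have hT : ∀ j k, Integrable (fun x => ‖Db V k (β j) x - Db V j (β k) x‖ ^ 2) := fun j k =>
    sq (((hβ j).Db hV k).sub ((hβ k).Db hV j))
  have hT' : Integrable (fun x => ∑ j, ∑ k, ‖Db V k (β j) x - Db V j (β k) x‖ ^ 2) :=
    integrable_finsetSum _ fun j _ => integrable_finsetSum _ fun k _ => hT j k
  have hR : Integrable (fun x => (∑ j, ∑ k, (Db V k (β j) x * conj (Db V j (β k) x) +
        2 * (dz j (dzb k (Vc V)) x * β j x * conj (β k x)))).re) :=
    (integrable_finsetSum Finset.univ fun j _ =>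
      integrable_finsetSum Finset.univ fun k _ => hI2 j k).re
  have e1 : ∑ j, ∫ x, ‖β j x‖ ^ 2 = ∫ x, ∑ j, ‖β j x‖ ^ 2 :=
    (integral_finsetSum _ fun j _ => sq (hβ j)).symm
  have e2 : ∑ j, ∑ k, ∫ x, ‖Db V k (β j) x - Db V j (β k) x‖ ^ 2 =
      ∫ x, ∑ j, ∑ k, ‖Db V k (β j) x - Db V j (β k) x‖ ^ 2 := by
    rw [integral_finsetSum _ fun j _ => integrable_finsetSum _ fun k _ => hT j k]
    exact Finset.sum_congr rfl fun j _ => (integral_finsetSum _ fun k _ => hT j k).symm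
  rw [bigre, e1, e2, ← integral_const_mul, ← integral_const_mul,
    ← integral_add hR (hT'.const_mul _)]
  refine integral_mono (hS.const_mul _) (hR.add (hT'.const_mul _)) fun x => ?_
  have hx := hL x (fun j => β j x)
  have alg : ∀ b : Fin m → Fin m → ℂ, 0 ≤ (∑ j, ∑ k, b j k * conj (b k j)).re +
      1 / 2 * ∑ j, ∑ k, ‖b j k - b k j‖ ^ 2 := by
    intro b
    have h1 : ∀ j k, ‖b j k - b k j‖ ^ 2 = ‖b j k‖ ^ 2 + ‖b k j‖ ^ 2 - 2 * (b j k * conj (b k j)).re := by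
      intro j k
      simp only [← Complex.normSq_eq_norm_sq, Complex.normSq_apply]
      simp; ring
    simp only [h1, Finset.sum_sub_distrib, Finset.sum_add_distrib, Complex.re_sum, ← Finset.mul_sum]
    rw [Finset.sum_comm (f := fun j k => ‖b k j‖ ^ 2)]
    have : 0 ≤ ∑ j, ∑ k, ‖b j k‖ ^ 2 := by positivity
    linarith
  have ha := alg (fun j k => Db V k (β j) x)
  simp only [Finset.sum_add_distrib, ← Finset.mul_sum, Complex.add_re]
  have h2 : (2 * ∑ j, ∑ k, dz j (dzb k (Vc V)) x * β j x * conj (β k x)).re =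
    2 * (∑ j, ∑ k, dz j (dzb k (Vc V)) x * β j x * conj (β k x)).re := by
    simp [Complex.mul_re]
  rw [h2]
  linarith
end basic
end

section
def cv {m : ℕ} (f ρ : EC m → ℂ) (x : EC m) : ℂ := ∫ y, f y * ρ (x - y)

section conv
variable {m : ℕ}

lemma cv_eq (f ρ : EC m → ℂ) : cv f ρ = convolution f ρ (ContinuousLinearMap.mul ℝ ℂ) volume := by
  ext x; simp [cv, convolution]

lemma cv_smooth {f ρ : EC m → ℂ} (hf : LocallyIntegrable f) (hρ : IsTest ρ) :
    ContDiff ℝ ∞ (cv f ρ) := by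
  rw [cv_eq]
  exact hρ.supp.contDiff_convolution_right (n := ⊤) _ hf hρ.smooth

lemma dv_cv {f ρ : EC m → ℂ} (hf : LocallyIntegrable f) (hρ : IsTest ρ) (h x : EC m) :
    dv h (cv f ρ) x = cv f (dv h ρ) x := by
  have := hρ.supp.hasFDerivAt_convolution_right (ContinuousLinearMap.mul ℝ ℂ) hf
    (hρ.smooth.of_le (by simp)) x
  rw [← cv_eq] at this
  rw [dv, this.fderiv, convolution_precompR_apply _ hf (hρ.supp.fderiv ℝ) (hρ.smooth.continuous_fderiv (by simp)),
    cv_eq]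
  rfl

lemma IsTest.transl {ρ : EC m → ℂ} (hρ : IsTest ρ) (x : EC m) : IsTest (fun y => ρ (x - y)) := by
  refine ⟨hρ.smooth.comp (contDiff_const.sub contDiff_id), ?_⟩
  exact hρ.supp.comp_homeomorph (Homeomorph.subLeft x)

lemma dv_transl {ρ : EC m → ℂ} (hρ : ContDiff ℝ ∞ ρ) (x h y : EC m) :
    dv h (fun y => ρ (x - y)) y = - dv h ρ (x - y) := by
  unfold dv
  have h1 : HasFDerivAt (fun y : EC m => x - y) (-(ContinuousLinearMap.id ℝ (EC m))) y :=
    (hasFDerivAt_id y).const_sub x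
  have := ((smooth_diff hρ (x - y)).hasFDerivAt).comp y h1
  have h2 := this.fderiv
  have e : (fun y => ρ (x - y)) = ρ ∘ (fun y => x - y) := rfl
  rw [e, h2]; simp

lemma cv_integrable {f ρ : EC m → ℂ} (hf : LocallyIntegrable f) (hρ : IsTest ρ) (x : EC m) :
    Integrable (fun y => f y * ρ (x - y)) := by
  have := hρ.transl x
  have h2 := hf.integrable_smul_left_of_hasCompactSupport this.cont this.supp
  simpa [mul_comm] using h2

lemma dz_cv {f ρ : EC m → ℂ} (hf : LocallyIntegrable f) (hρ : IsTest ρ) (j : Fin m) (x : EC m) :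
    dz j (cv f ρ) x = cv f (dz j ρ) x := by
  have h1 := cv_integrable hf (hρ.dv (ee j)) x
  have h2 := cv_integrable hf (hρ.dv (I • ee j)) x
  simp only [dz, dv_cv hf hρ]
  simp only [cv]
  rw [← integral_const_mul, ← integral_sub h1 (h2.const_mul I), ← integral_div]
  congr 1; ext y; simp only [dz]; ring

lemma dzb_cv {f ρ : EC m → ℂ} (hf : LocallyIntegrable f) (hρ : IsTest ρ) (j : Fin m) (x : EC m) :
    dzb j (cv f ρ) x = cv f (dzb j ρ) x := by
  have h1 := cv_integrable hf (hρ.dv (ee j)) x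
  have h2 := cv_integrable hf (hρ.dv (I • ee j)) x
  simp only [dzb, dv_cv hf hρ]
  simp only [cv]
  rw [← integral_const_mul, ← integral_add h1 (h2.const_mul I), ← integral_div]
  congr 1; ext y; simp only [dzb]; ring

lemma dz_transl {ρ : EC m → ℂ} (hρ : ContDiff ℝ ∞ ρ) (x y : EC m) (j : Fin m) :
    dz j (fun y => ρ (x - y)) y = - dz j ρ (x - y) := by
  simp only [dz, dv_transl hρ]; ring
lemma dzb_transl {ρ : EC m → ℂ} (hρ : ContDiff ℝ ∞ ρ) (x y : EC m) (j : Fin m) :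
    dzb j (fun y => ρ (x - y)) y = - dzb j ρ (x - y) := by
  simp only [dzb, dv_transl hρ]; ring

lemma young {f : EC m → ℝ} {r : EC m → ℝ} (hf : MemLp f 2) (hr : Continuous r)
    (hrc : HasCompactSupport r) (hr0 : ∀ x, 0 ≤ r x) (hr1 : ∫ x, r x = 1) :
    Integrable (fun x => (∫ y, f y * r (x - y)) ^ 2) ∧
    ∫ x, (∫ y, f y * r (x - y)) ^ 2 ≤ ∫ x, f x ^ 2 := by
  have hfl : LocallyIntegrable f := hf.locallyIntegrable (by norm_num)
  have hf2 : Integrable (fun x => f x ^ 2) := hf.integrable_sq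
  have hri : Integrable r := hr.integrable_of_hasCompactSupport hrc
  have hcont : Continuous (fun x => ∫ y, f y * r (x - y)) := by
    have := hrc.continuous_convolution_right (ContinuousLinearMap.mul ℝ ℝ) hfl hr (μ := volume)
    have e : (fun x => ∫ y, f y * r (x - y)) = convolution f r (ContinuousLinearMap.mul ℝ ℝ) volume := by
      ext x; simp [convolution]
    rw [e]; exact this
  have hsub : ∀ x : EC m, Continuous (fun y => r (x - y)) := fun x => hr.comp (by fun_prop)
  have hsubc : ∀ x : EC m, HasCompactSupport (fun y => r (x - y)) := fun x =>
    hrc.comp_homeomorph (Homeomorph.subLeft x)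
  have i1 : ∀ x, Integrable (fun y => f y * r (x - y)) := fun x => by
    have h2 := hfl.integrable_smul_left_of_hasCompactSupport (hsub x) (hsubc x)
    simpa [mul_comm] using h2
  have i2 : ∀ x, Integrable (fun y => f y ^ 2 * r (x - y)) := fun x => by
    have h2 := hf2.locallyIntegrable.integrable_smul_left_of_hasCompactSupport (hsub x) (hsubc x)
    simpa [mul_comm] using h2
  have i3 : ∀ x, Integrable (fun y => r (x - y)) := fun x =>
    (hsub x).integrable_of_hasCompactSupport (hsubc x)
  have e3 : ∀ x, ∫ y, r (x - y) = 1 := fun x => by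
    rw [integral_sub_left_eq_self (fun y => r y) volume x, hr1]
  have jen : ∀ x, (∫ y, f y * r (x - y)) ^ 2 ≤ ∫ y, f y ^ 2 * r (x - y) := by
    intro x
    set M := ∫ y, f y * r (x - y) with hM
    have h0 : 0 ≤ ∫ y, (f y - M) ^ 2 * r (x - y) :=
      integral_nonneg fun y => mul_nonneg (sq_nonneg _) (hr0 _)
    have e : ∀ y, (f y - M) ^ 2 * r (x - y) = f y ^ 2 * r (x - y) - (2 * M) * (f y * r (x - y)) +
      M ^ 2 * r (x - y) := by intro y; ring
    simp only [e] at h0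
    have i4 : Integrable (fun y => f y ^ 2 * r (x - y) - (2 * M) * (f y * r (x - y))) :=
      (i2 x).sub ((i1 x).const_mul _)
    rw [integral_add i4 ((i3 x).const_mul _),
      integral_sub (i2 x) ((i1 x).const_mul _), integral_const_mul, integral_const_mul, e3, ← hM] at h0
    nlinarith
  have ec : (fun x => ∫ y, f y ^ 2 * r (x - y)) = convolution (fun x => f x ^ 2) r (ContinuousLinearMap.mul ℝ ℝ) volume := by
    ext x; simp [convolution]
  have hconv : Integrable (fun x => ∫ y, f y ^ 2 * r (x - y)) := by
    have := hf2.integrable_convolution (ContinuousLinearMap.mul ℝ ℝ) hri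
    rw [ec]; exact this
  have hint : ∫ x, (∫ y, f y ^ 2 * r (x - y)) = ∫ x, f x ^ 2 := by
    have := integral_convolution (μ := (volume : Measure (EC m))) (ν := volume)
      (ContinuousLinearMap.mul ℝ ℝ) hf2 hri
    rw [ec, this]; simp [hr1]
  have hI : Integrable (fun x => (∫ y, f y * r (x - y)) ^ 2) := by
    refine hconv.mono' (hcont.pow 2).aestronglyMeasurable (Eventually.of_forall fun x => ?_)
    rw [Real.norm_eq_abs, abs_of_nonneg (sq_nonneg _)]
    exact jen x
  exact ⟨hI, hint ▸ integral_mono hI hconv jen⟩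
end conv
end

section
section step
variable {m : ℕ} {V : EC m → ℝ} (hV : ContDiff ℝ ∞ V)

lemma norm_cv_le {f : EC m → ℂ} {g : EC m → ℂ} {ρ : EC m → ℝ} (hρ0 : ∀ x, 0 ≤ ρ x) (x : EC m) {τ : ℝ}
    (hi : Integrable (fun y => ‖f y‖ * ρ (x - y)))
    (hg : ∀ y, ρ (x - y) ≠ 0 → ‖g y‖ ≤ τ) :
    ‖∫ y, f y * g y * (ρ (x - y) : ℂ)‖ ≤ τ * ∫ y, ‖f y‖ * ρ (x - y) := by
  rw [← integral_const_mul]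
  refine norm_integral_le_of_norm_le (hi.const_mul τ) (Eventually.of_forall fun y => ?_)
  rw [norm_mul, norm_mul, Complex.norm_real, Real.norm_eq_abs, abs_of_nonneg (hρ0 _)]
  by_cases h : ρ (x - y) = 0
  · simp [h]
  · have := hg y h
    have h2 := mul_le_mul_of_nonneg_right this (mul_nonneg (norm_nonneg (f y)) (hρ0 (x - y)))
    nlinarith

include hV in
lemma step {c : ℝ} (hL : ∀ x, ∀ t : Fin m → ℂ, c * ∑ j, ‖t j‖ ^ 2 ≤
      (∑ j, ∑ k, dz j (dzb k (Vc V)) x * t j * conj (t k)).re)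
    {α : Fin m → EC m → ℂ} {w : EC m → ℂ} (hα : ∀ j, MemLp (α j) 2) (hw2 : MemLp w 2)
    (hZ : ∀ j k ψ, IsTest ψ → ∫ x, α j x * conj (Dd V k ψ x) = ∫ x, α k x * conj (Dd V j ψ x))
    (hw : ∀ ψ, IsTest ψ → ∑ j, ∫ x, α j x * conj (Db V j ψ x) = ∫ x, w x * conj (ψ x))
    {ρ χ : EC m → ℝ} (hρ : IsTest (Vc ρ)) (hχ : IsTest (Vc χ)) (hρ0 : ∀ x, 0 ≤ ρ x)
    (hρ1 : ∫ x, ρ x = 1) (hρc : Continuous ρ) (hρs : HasCompactSupport ρ)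
    (hχ0 : ∀ x, 0 ≤ χ x) (hχ1 : ∀ x, χ x ≤ 1) {τ : ℝ} (hτ : 0 ≤ τ)
    (h1 : ∀ j x, ‖dz j (Vc χ) x‖ ≤ τ) (h2 : ∀ j x, ‖dzb j (Vc χ) x‖ ≤ τ)
    (h3 : ∀ j x y, χ x ≠ 0 → ρ (x - y) ≠ 0 → ‖dz j (Vc V) x - dz j (Vc V) y‖ ≤ τ) :
    2 * c * ∑ j, ∫ x, ‖(χ x : ℂ) * cv (α j) (Vc ρ) x‖ ^ 2 ≤
      2 * (∫ x, ‖w x‖ ^ 2) + (8 + 8 * m ^ 2) * τ ^ 2 * ∫ x, (∑ j, ‖α j x‖) ^ 2 := by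
  have hαl : ∀ j, LocallyIntegrable (α j) := fun j => (hα j).locallyIntegrable (by norm_num)
  have hwl : LocallyIntegrable w := hw2.locallyIntegrable (by norm_num)
  have hc := smooth_Vc hV
  set R := Vc ρ with hR
  have hsc : ∀ j, ContDiff ℝ ∞ (cv (α j) R) := fun j => cv_smooth (hαl j) hρ
  have hβ : ∀ j, IsTest (fun x => Vc χ x * cv (α j) R x) := fun j => hχ.mul_smooth (hsc j)
  have key := bochner hV hL hβ
  have dzbR : ∀ j x, conj (dz j R x) = dzb j R x := by
    intro j x
    rw [← dzb_conj hρ.smooth]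
    congr 1; ext y; simp [hR, Vc]
  have dzR : ∀ j x, conj (dzb j R x) = dz j R x := by
    intro j x
    rw [← dzbR, conj_conj]
  have dzV : ∀ j x, conj (dzb j (Vc V) x) = dz j (Vc V) x := by
    intro j x
    rw [← conj_dz_Vc hV, conj_conj]
  -- error terms
  set E : Fin m → Fin m → EC m → ℂ := fun j k x =>
    ∫ y, α j y * (dzb k (Vc V) x - dzb k (Vc V) y) * (ρ (x - y) : ℂ) with hE
  set E' : Fin m → EC m → ℂ := fun j x =>
    ∫ y, α j y * (dz j (Vc V) x - dz j (Vc V) y) * (ρ (x - y) : ℂ) with hE'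
  set Aj : Fin m → EC m → ℝ := fun j x => ∫ y, ‖α j y‖ * ρ (x - y) with hAj
  have inorm : ∀ {f : EC m → ℂ}, LocallyIntegrable f → ∀ x, Integrable (fun y => ‖f y‖ * ρ (x - y)) := by
    intro f hf x
    have := (cv_integrable hf hρ x).norm
    refine this.congr (Eventually.of_forall fun y => ?_)
    simp [hR, Vc, abs_of_nonneg (hρ0 _)]
  have Aj0 : ∀ j x, 0 ≤ Aj j x := fun j x => integral_nonneg fun y => mul_nonneg (norm_nonneg _) (hρ0 _)
  have cvle : ∀ {f : EC m → ℂ}, LocallyIntegrable f → ∀ x, ‖cv f R x‖ ≤ ∫ y, ‖f y‖ * ρ (x - y) := by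
    intro f hf x
    have := norm_cv_le (f := f) (g := fun _ => 1) hρ0 x (τ := 1) (inorm hf x) (by simp)
    simpa [cv, hR, Vc] using this
  have El : ∀ j k x, χ x ≠ 0 → ‖E j k x‖ ≤ τ * Aj j x := by
    intro j k x hx
    refine norm_cv_le hρ0 x (inorm (hαl j) x) fun y hy => ?_
    rw [← conj_dz_Vc hV, ← conj_dz_Vc hV, ← map_sub, RCLike.norm_conj]
    exact h3 k x y hx hy
  have E'l : ∀ j x, χ x ≠ 0 → ‖E' j x‖ ≤ τ * Aj j x := by
    intro j x hx
    exact norm_cv_le hρ0 x (inorm (hαl j) x) fun y hy => h3 j x y hx hy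
  have imul : ∀ {f g : EC m → ℂ}, LocallyIntegrable f → ContDiff ℝ ∞ g → ∀ x,
      Integrable (fun y => f y * (g y * R (x - y))) := by
    intro f g hf hg x
    have t := (hρ.transl x).smooth_mul hg
    have h2 := hf.integrable_smul_left_of_hasCompactSupport t.cont t.supp
    simpa [mul_comm] using h2
  have id1 : ∀ j k x, cv (α j) (dzb k R) x + dzb k (Vc V) x * cv (α j) R x =
      (∫ y, α j y * conj (Dd V k (fun y => R (x - y)) y)) + E j k x := by
    intro j k x
    have e1 : ∀ y, α j y * conj (Dd V k (fun y => R (x - y)) y) =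
      α j y * dzb k R (x - y) + α j y * (dzb k (Vc V) y * R (x - y)) := by
      intro y
      simp only [Dd, dz_transl hρ.smooth, map_add, map_neg, map_mul, dzbR, conj_dz_Vc hV]
      simp [hR, Vc]; ring
    have e2 : ∀ y, α j y * (dzb k (Vc V) x - dzb k (Vc V) y) * (ρ (x - y) : ℂ) =
      dzb k (Vc V) x * (α j y * R (x - y)) - α j y * (dzb k (Vc V) y * R (x - y)) := by
      intro y; simp only [hR, Vc]; ring
    have j1 := cv_integrable (hαl j) (hρ.dzb k) x
    have j2 := cv_integrable (hαl j) hρ x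
    have j3 := imul (hαl j) (smooth_dzb hc k) x
    simp only [hE, e1, e2]
    rw [integral_add j1 j3, integral_sub (j2.const_mul _) j3, integral_const_mul]
    simp only [cv]; ring
  have id2 : ∀ j x, -cv (α j) (dz j R) x + dz j (Vc V) x * cv (α j) R x =
      (∫ y, α j y * conj (Db V j (fun y => R (x - y)) y)) + E' j x := by
    intro j x
    have e1 : ∀ y, α j y * conj (Db V j (fun y => R (x - y)) y) =
      α j y * (dz j (Vc V) y * R (x - y)) - α j y * dz j R (x - y) := by
      intro y
      simp only [Db, dzb_transl hρ.smooth, map_add, map_neg, map_mul, dzR, dzV]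
      simp [hR, Vc]; ring
    have e2 : ∀ y, α j y * (dz j (Vc V) x - dz j (Vc V) y) * (ρ (x - y) : ℂ) =
      dz j (Vc V) x * (α j y * R (x - y)) - α j y * (dz j (Vc V) y * R (x - y)) := by
      intro y; simp only [hR, Vc]; ring
    have j1 := cv_integrable (hαl j) (hρ.dz j) x
    have j2 := cv_integrable (hαl j) hρ x
    have j3 := imul (hαl j) (smooth_dz hc j) x
    simp only [hE', e1, e2]
    rw [integral_sub j3 j1, integral_sub (j2.const_mul _) j3, integral_const_mul]
    simp only [cv]; ring
  set A : EC m → ℝ := fun x => ∑ j, Aj j x with hA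
  set Aw : EC m → ℝ := fun x => ∫ y, ‖w y‖ * ρ (x - y) with hAw
  have AjA : ∀ j x, Aj j x ≤ A x := fun j x =>
    Finset.single_le_sum (f := fun j => Aj j x) (fun i _ => Aj0 i x) (Finset.mem_univ j)
  have A0 : ∀ x, 0 ≤ A x := fun x => Finset.sum_nonneg fun j _ => Aj0 j x
  have Aw0 : ∀ x, 0 ≤ Aw x := fun x => integral_nonneg fun y => mul_nonneg (norm_nonneg _) (hρ0 _)
  have nχ : ∀ x, ‖Vc χ x‖ ≤ 1 := fun x => by
    simp only [Vc, Complex.norm_real, Real.norm_eq_abs, abs_of_nonneg (hχ0 x)]; exact hχ1 x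
  have χE : ∀ x (z : ℂ) (M : ℝ), 0 ≤ M → (χ x ≠ 0 → ‖z‖ ≤ M) → ‖Vc χ x * z‖ ≤ M := by
    intro x z M hM h
    by_cases hx : χ x = 0
    · simp [Vc, hx, hM]
    · rw [norm_mul]
      calc _ ≤ 1 * M := mul_le_mul (nχ x) (h hx) (norm_nonneg _) zero_le_one
        _ = M := one_mul M
  have bd1 : ∀ j k x, ‖Db V k (fun x => Vc χ x * cv (α j) R x) x -
      Db V j (fun x => Vc χ x * cv (α k) R x) x‖ ≤ 4 * τ * A x := by
    intro j k x
    have e : Db V k (fun x => Vc χ x * cv (α j) R x) x -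
        Db V j (fun x => Vc χ x * cv (α k) R x) x =
        dzb k (Vc χ) x * cv (α j) R x - dzb j (Vc χ) x * cv (α k) R x +
        (Vc χ x * E j k x - Vc χ x * E k j x) := by
      have i1 := id1 j k x
      have i2 := id1 k j x
      have i3 := hZ j k _ (hρ.transl x)
      simp only [Db, dzb_mul hχ.smooth (hsc _), dzb_cv (hαl _) hρ]
      linear_combination Vc χ x * i1 - Vc χ x * i2 + Vc χ x * i3
    rw [e]
    have b1 : ‖dzb k (Vc χ) x * cv (α j) R x‖ ≤ τ * A x := by
      rw [norm_mul]
      exact mul_le_mul (h2 k x) ((cvle (hαl j) x).trans (AjA j x)) (norm_nonneg _) hτ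
    have b2 : ‖dzb j (Vc χ) x * cv (α k) R x‖ ≤ τ * A x := by
      rw [norm_mul]
      exact mul_le_mul (h2 j x) ((cvle (hαl k) x).trans (AjA k x)) (norm_nonneg _) hτ
    have b3 := χE x (E j k x) (τ * A x) (mul_nonneg hτ (A0 x))
      (fun hx => (El j k x hx).trans (mul_le_mul_of_nonneg_left (AjA j x) hτ))
    have b4 := χE x (E k j x) (τ * A x) (mul_nonneg hτ (A0 x))
      (fun hx => (El k j x hx).trans (mul_le_mul_of_nonneg_left (AjA k x) hτ))
    have c1 := norm_add_le (dzb k (Vc χ) x * cv (α j) R x - dzb j (Vc χ) x * cv (α k) R x)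
      (Vc χ x * E j k x - Vc χ x * E k j x)
    have c2 := norm_sub_le (dzb k (Vc χ) x * cv (α j) R x) (dzb j (Vc χ) x * cv (α k) R x)
    have c3 := norm_sub_le (Vc χ x * E j k x) (Vc χ x * E k j x)
    linarith
  have bd2 : ∀ x, ‖∑ j, Dd V j (fun x => Vc χ x * cv (α j) R x) x‖ ≤ Aw x + 2 * τ * A x := by
    intro x
    have e : ∑ j, Dd V j (fun x => Vc χ x * cv (α j) R x) x =
        Vc χ x * cv w R x + ∑ j, (-(dz j (Vc χ) x * cv (α j) R x) + Vc χ x * E' j x) := by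
      have i3 := hw _ (hρ.transl x)
      have i4 : ∫ y, w y * conj (R (x - y)) = cv w R x := by
        simp [cv, hR, Vc]
      rw [i4] at i3
      rw [← i3, Finset.mul_sum, ← Finset.sum_add_distrib]
      refine Finset.sum_congr rfl fun j _ => ?_
      have i1 := id2 j x
      simp only [Dd, dz_mul hχ.smooth (hsc _), dz_cv (hαl _) hρ]
      linear_combination Vc χ x * i1
    rw [e]
    have b1 := χE x (cv w R x) (Aw x) (Aw0 x) (fun _ => cvle hwl x)
    have b2 : ‖∑ j, (-(dz j (Vc χ) x * cv (α j) R x) + Vc χ x * E' j x)‖ ≤ ∑ j, 2 * τ * Aj j x := by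
      refine norm_sum_le_of_le _ fun j _ => ?_
      have c1 : ‖dz j (Vc χ) x * cv (α j) R x‖ ≤ τ * Aj j x := by
        rw [norm_mul]
        exact mul_le_mul (h1 j x) (cvle (hαl j) x) (norm_nonneg _) hτ
      have c2 := χE x (E' j x) (τ * Aj j x) (mul_nonneg hτ (Aj0 j x)) (fun hx => E'l j x hx)
      have c3 := norm_add_le (-(dz j (Vc χ) x * cv (α j) R x)) (Vc χ x * E' j x)
      rw [norm_neg] at c3
      linarith
    rw [← Finset.mul_sum] at b2
    exact (norm_add_le _ _).trans (add_le_add b1 b2)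
  -- Young
  have ha2 : MemLp (fun x => ∑ j, ‖α j x‖) 2 := by
    have := memLp_finsetSum (μ := volume) Finset.univ (f := fun j x => ‖α j x‖) (p := 2)
      (fun j _ => (hα j).norm)
    exact this
  have Ae : A = fun x => ∫ y, (∑ j, ‖α j y‖) * ρ (x - y) := by
    ext x
    simp only [hA, hAj, Finset.sum_mul]
    rw [integral_finsetSum _ fun j _ => inorm (hαl j) x]
  obtain ⟨yA1, yA2⟩ := young ha2 hρc hρs hρ0 hρ1
  obtain ⟨yw1, yw2⟩ := young hw2.norm hρc hρs hρ0 hρ1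
  have IA : Integrable (fun x => A x ^ 2) := by rw [Ae]; exact yA1
  have IA2 : ∫ x, A x ^ 2 ≤ ∫ x, (∑ j, ‖α j x‖) ^ 2 := by rw [Ae]; exact yA2
  have Iw : Integrable (fun x => Aw x ^ 2) := yw1
  have Iw2 : ∫ x, Aw x ^ 2 ≤ ∫ x, ‖w x‖ ^ 2 := yw2
  have sqI : ∀ {f : EC m → ℂ}, IsTest f → Integrable (fun x => ‖f x‖ ^ 2) := by
    intro f hf
    exact hf.memLp.norm.integrable_sq
  have fin1 : ∫ x, ‖∑ j, Dd V j (fun x => Vc χ x * cv (α j) R x) x‖ ^ 2 ≤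
      2 * (∫ x, Aw x ^ 2) + 8 * τ ^ 2 * ∫ x, A x ^ 2 := by
    rw [← integral_const_mul, ← integral_const_mul, ← integral_add (Iw.const_mul _) (IA.const_mul _)]
    refine integral_mono (sqI (IsTest.sum _ fun j _ => IsTest.Dd hV (hβ j) j))
      ((Iw.const_mul _).add (IA.const_mul _)) fun x => ?_
    have hb := bd2 x
    have := pow_le_pow_left₀ (norm_nonneg _) hb 2
    simp only
    nlinarith [sq_nonneg (Aw x - 2 * τ * A x)]
  have fin2 : ∀ j k, ∫ x, ‖Db V k (fun x => Vc χ x * cv (α j) R x) x -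
      Db V j (fun x => Vc χ x * cv (α k) R x) x‖ ^ 2 ≤ 16 * τ ^ 2 * ∫ x, A x ^ 2 := by
    intro j k
    rw [← integral_const_mul]
    refine integral_mono (sqI ((IsTest.Db hV (hβ j) k).sub (IsTest.Db hV (hβ k) j)))
      (IA.const_mul _) fun x => ?_
    have := pow_le_pow_left₀ (norm_nonneg _) (bd1 j k x) 2
    simp only
    nlinarith
  have fin3 : ∑ j, ∑ k, ∫ x, ‖Db V k (fun x => Vc χ x * cv (α j) R x) x -
      Db V j (fun x => Vc χ x * cv (α k) R x) x‖ ^ 2 ≤ (m * (m * (16 * τ ^ 2 * ∫ x, A x ^ 2)) : ℝ) := by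
    have := Finset.sum_le_sum fun (j : Fin m) (_ : j ∈ Finset.univ) => Finset.sum_le_sum
      fun (k : Fin m) (_ : k ∈ Finset.univ) => fin2 j k
    refine this.trans (le_of_eq ?_)
    simp
  have : 2 * c * ∑ j, ∫ x, ‖(χ x : ℂ) * cv (α j) R x‖ ^ 2 ≤ 2 * (∫ x, Aw x ^ 2) + 8 * τ ^ 2 * (∫ x, A x ^ 2)
     + (1/2) * (m * (m * (16 * τ ^ 2 * ∫ x, A x ^ 2))) := by
    refine key.trans ?_
    gcongr
  have g : (8 + 8 * m ^ 2) * τ ^ 2 * (∫ x, A x ^ 2) ≤ (8 + 8 * m ^ 2) * τ ^ 2 * ∫ x, (∑ j, ‖α j x‖) ^ 2 :=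
    mul_le_mul_of_nonneg_left IA2 (by positivity)
  nlinarith
end step
end

section
section fatou
variable {m : ℕ}

lemma fatou_real {fn : ℕ → EC m → ℝ} {f : EC m → ℝ} {bn : ℕ → ℝ} {b : ℝ}
    (hfn : ∀ n, Integrable (fn n)) (h0 : ∀ n x, 0 ≤ fn n x) (hf : Integrable f) (hf0 : ∀ x, 0 ≤ f x)
    (hb : Tendsto bn atTop (nhds b)) (hle : ∀ n, ∫ x, fn n x ≤ bn n)
    (hlim : ∀ᵐ x, Tendsto (fun n => fn n x) atTop (nhds (f x))) : ∫ x, f x ≤ b := by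
  have hb0 : 0 ≤ b := ge_of_tendsto' hb fun n => (integral_nonneg (h0 n)).trans (hle n)
  have h1 : ∫⁻ x, ‖f x‖ₑ ≤ liminf (fun n => ∫⁻ x, ‖fn n x‖ₑ) atTop := by
    refine le_trans (le_of_eq (lintegral_congr_ae ?_))
      (lintegral_liminf_le' (fun n => (hfn n).aestronglyMeasurable.enorm))
    filter_upwards [hlim] with x hx using hx.enorm.liminf_eq.symm
  have e : ∀ {g : EC m → ℝ}, Integrable g → (∀ x, 0 ≤ g x) → ∫⁻ x, ‖g x‖ₑ = ENNReal.ofReal (∫ x, g x) := by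
    intro g hg hg0
    rw [ofReal_integral_eq_lintegral_ofReal hg (Eventually.of_forall hg0)]
    refine lintegral_congr fun x => ?_
    rw [Real.enorm_eq_ofReal (hg0 x)]
  rw [e hf hf0] at h1
  have h2 : liminf (fun n => ∫⁻ x, ‖fn n x‖ₑ) atTop ≤ ENNReal.ofReal b := by
    have h3 : Tendsto (fun n => ENNReal.ofReal (bn n)) atTop (nhds (ENNReal.ofReal b)) :=
      ENNReal.tendsto_ofReal hb
    rw [← h3.liminf_eq]
    refine liminf_le_liminf (Eventually.of_forall fun n => ?_)
    rw [e (hfn n) (h0 n)]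
    exact ENNReal.ofReal_le_ofReal (hle n)
  exact (ENNReal.ofReal_le_ofReal_iff hb0).1 (h1.trans h2)

lemma exists_cutoff (m : ℕ) : ∃ C : ℝ, 0 ≤ C ∧ ∀ R : ℝ, 0 < R → ∃ χ : EC m → ℝ, IsTest (Vc χ) ∧ (∀ x, 0 ≤ χ x) ∧
    (∀ x, χ x ≤ 1) ∧ (∀ x, ‖x‖ ≤ R → χ x = 1) ∧ (∀ x, χ x ≠ 0 → ‖x‖ ≤ 2 * R) ∧
    (∀ j x, ‖dz j (Vc χ) x‖ ≤ C / R) ∧ (∀ j x, ‖dzb j (Vc χ) x‖ ≤ C / R) := by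
  let φ : ContDiffBump (0 : EC m) := ⟨1, 2, one_pos, one_lt_two⟩
  have hφ : IsTest (Vc φ) := by
    refine ⟨Complex.ofRealCLM.contDiff.comp φ.contDiff, ?_⟩
    exact φ.hasCompactSupport.comp_left (g := fun r : ℝ => (r : ℂ)) (by simp)
  obtain ⟨C0, hC0⟩ : ∃ C, ∀ x, ‖fderiv ℝ (Vc φ) x‖ ≤ C :=
    (hφ.smooth.continuous_fderiv (by simp)).bounded_above_of_compact_support (hφ.supp.fderiv ℝ)
  have hC : 0 ≤ C0 := (norm_nonneg _).trans (hC0 0)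
  refine ⟨C0, hC, fun R hR => ⟨fun x => φ (R⁻¹ • x), ?_, ?_, ?_, ?_, ?_, ?_⟩⟩
  · refine ⟨hφ.smooth.comp (contDiff_id.const_smul R⁻¹), ?_⟩
    exact hφ.supp.comp_homeomorph (Homeomorph.smulOfNeZero R⁻¹ (inv_ne_zero hR.ne'))
  · exact fun x => φ.nonneg
  · exact fun x => φ.le_one
  · intro x hx
    apply φ.one_of_mem_closedBall
    simp only [mem_closedBall, dist_zero_right, norm_smul, norm_inv, Real.norm_eq_abs, abs_of_pos hR]
    show R⁻¹ * ‖x‖ ≤ 1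
    rw [inv_mul_le_iff₀ hR]; linarith
  · intro x hx
    have : R⁻¹ • x ∈ Function.support φ := hx
    rw [φ.support_eq] at this
    simp only [mem_ball, dist_zero_right, norm_smul, norm_inv, Real.norm_eq_abs, abs_of_pos hR] at this
    have h : R⁻¹ * ‖x‖ < 2 := this
    rw [inv_mul_lt_iff₀ hR] at h; linarith
  · have hd : ∀ h x, ‖h‖ = 1 → ‖dv h (Vc fun x => φ (R⁻¹ • x)) x‖ ≤ C0 / R := by
      intro h x hh
      have e : (Vc fun x => φ (R⁻¹ • x)) = fun x => (Vc φ) (R⁻¹ • x) := rfl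
      rw [dv, e, fderiv_comp_smul]
      rw [smul_apply, norm_smul, norm_inv, Real.norm_eq_abs, abs_of_pos hR]
      rw [div_eq_inv_mul]
      gcongr
      have := (fderiv ℝ (Vc φ) (R⁻¹ • x)).le_opNorm h
      rw [hh, mul_one] at this
      exact this.trans (hC0 _)
    have n1 : ∀ j : Fin m, ‖(ee j : EC m)‖ = 1 := fun j => by simp [ee]
    have n2 : ∀ j : Fin m, ‖(I • ee j : EC m)‖ = 1 := fun j => by simp [norm_smul, n1]
    constructor
    · intro j x
      have h1 := hd (ee j) x (n1 j)
      have h2 := hd (I • ee j) x (n2 j)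
      rw [dz, norm_div]
      have := norm_sub_le (dv (ee j) (Vc fun x => φ (R⁻¹ • x)) x) (I * dv (I • ee j) (Vc fun x => φ (R⁻¹ • x)) x)
      rw [norm_mul, Complex.norm_I, one_mul] at this
      rw [div_le_iff₀ (by simp)]; simp; linarith
    · intro j x
      have h1 := hd (ee j) x (n1 j)
      have h2 := hd (I • ee j) x (n2 j)
      rw [dzb, norm_div]
      have := norm_add_le (dv (ee j) (Vc fun x => φ (R⁻¹ • x)) x) (I * dv (I • ee j) (Vc fun x => φ (R⁻¹ • x)) x)
      rw [norm_mul, Complex.norm_I, one_mul] at this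
      rw [div_le_iff₀ (by simp)]; simp; linarith

lemma unif_small {G : Fin m → EC m → ℂ} (hG : ∀ j, Continuous (G j)) (R τ : ℝ) (hτ : 0 < τ) :
    ∃ δ > 0, ∀ j x y, ‖x‖ ≤ R → ‖y‖ ≤ R → ‖x - y‖ < δ → ‖G j x - G j y‖ ≤ τ := by
  have : ∀ j, ∃ δ > 0, ∀ x y, ‖x‖ ≤ R → ‖y‖ ≤ R → ‖x - y‖ < δ → ‖G j x - G j y‖ ≤ τ := by
    intro j
    have := (isCompact_closedBall (0 : EC m) R).uniformContinuousOn_of_continuous (hG j).continuousOn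
    rw [Metric.uniformContinuousOn_iff] at this
    obtain ⟨δ, hδ, h⟩ := this τ hτ
    refine ⟨δ, hδ, fun x y hx hy hxy => ?_⟩
    have := h x (by simpa using hx) y (by simpa using hy) (by rwa [dist_eq_norm])
    rw [dist_eq_norm] at this; exact this.le
  choose δ hδ h using this
  obtain ⟨d, hd, hd2⟩ : ∃ d > 0, ∀ j, d ≤ δ j := by
    by_cases hm : Nonempty (Fin m)
    · obtain ⟨j, hj⟩ := Finite.exists_min δ
      exact ⟨δ j, hδ j, hj⟩
    · exact ⟨1, one_pos, fun j => (hm ⟨j⟩).elim⟩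
  exact ⟨d, hd, fun j x y hx hy hxy => h j x y hx hy (hxy.trans_le (hd2 j))⟩

lemma closed_estimate {V : EC m → ℝ} (hV : ContDiff ℝ ∞ V) {c : ℝ} (hc : 0 < c)
    (hL : ∀ x, ∀ t : Fin m → ℂ, c * ∑ j, ‖t j‖ ^ 2 ≤
      (∑ j, ∑ k, dz j (dzb k (Vc V)) x * t j * conj (t k)).re)
    {α : Fin m → EC m → ℂ} {w : EC m → ℂ} (hα : ∀ j, MemLp (α j) 2) (hw2 : MemLp w 2)
    (hZ : ∀ j k ψ, IsTest ψ → ∫ x, α j x * conj (Dd V k ψ x) = ∫ x, α k x * conj (Dd V j ψ x))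
    (hw : ∀ ψ, IsTest ψ → ∑ j, ∫ x, α j x * conj (Db V j ψ x) = ∫ x, w x * conj (ψ x)) :
    c * ∑ j, ∫ x, ‖α j x‖ ^ 2 ≤ ∫ x, ‖w x‖ ^ 2 := by
  obtain ⟨C, hC, hcut⟩ := exists_cutoff m
  choose! χ hχ hχ0 hχ1 hχe hχs hχd hχb using hcut
  have hcon : ∀ j, Continuous (dz j (Vc V)) := fun j => (smooth_dz (smooth_Vc hV) j).continuous
  have hδ : ∀ n : ℕ, ∃ δ > 0, ∀ j x y, ‖x‖ ≤ 2 * ((n:ℝ) + 1) + 1 → ‖y‖ ≤ 2 * ((n:ℝ) + 1) + 1 → ‖x - y‖ < δ →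
    ‖dz j (Vc V) x - dz j (Vc V) y‖ ≤ 1 / ((n:ℝ) + 1) := fun n =>
    unif_small hcon (2 * ((n:ℝ) + 1) + 1) _ (by positivity)
  choose δ hδ0 hδ using hδ
  have hmin : ∀ n : ℕ, 0 < min (δ n) (1 / ((n:ℝ) + 1)) := fun n => lt_min (hδ0 n) (by positivity)
  let φ : ℕ → ContDiffBump (0 : EC m) := fun n =>
    ⟨min (δ n) (1 / ((n:ℝ) + 1)) / 2, min (δ n) (1 / ((n:ℝ) + 1)), half_pos (hmin n), half_lt_self (hmin n)⟩
  have hout : ∀ n, (φ n).rOut = min (δ n) (1 / ((n:ℝ) + 1)) := fun n => rfl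
  have hin : ∀ n, (φ n).rIn = min (δ n) (1 / ((n:ℝ) + 1)) / 2 := fun n => rfl
  let ρ : ℕ → EC m → ℝ := fun n => (φ n).normed volume
  have hρc : ∀ n, Continuous (ρ n) := fun n => (φ n).continuous_normed
  have hρs : ∀ n, HasCompactSupport (ρ n) := fun n => (φ n).hasCompactSupport_normed
  have hρ : ∀ n, IsTest (Vc (ρ n)) := fun n =>
    ⟨Complex.ofRealCLM.contDiff.comp (φ n).contDiff_normed,
      (hρs n).comp_left (g := fun r : ℝ => (r : ℂ)) (by simp)⟩
  let R : ℕ → ℝ := fun n => (n : ℝ) + 1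
  have hR : ∀ n, 0 < R n := fun n => by positivity
  let τ : ℕ → ℝ := fun n => (C + 1) / R n
  have hτ0 : ∀ n, 0 ≤ τ n := fun n => div_nonneg (by linarith) (hR n).le
  have lim1 : Tendsto (fun n : ℕ => 1 / ((n:ℝ) + 1)) atTop (nhds 0) := tendsto_one_div_add_atTop_nhds_zero_nat
  have limτ : Tendsto τ atTop (nhds 0) := by
    have := lim1.const_mul (C + 1)
    simpa [τ, R, div_eq_mul_inv] using this
  have hα2 : ∀ j, Integrable (fun x => ‖α j x‖ ^ 2) := fun j => (hα j).norm.integrable_sq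
  have hαl : ∀ j, LocallyIntegrable (α j) := fun j => (hα j).locallyIntegrable (by norm_num)
  have hst := fun n => step hV hL hα hw2 hZ hw (hρ n) (hχ (R n) (hR n)) (fun x => (φ n).nonneg_normed x)
    (φ n).integral_normed (hρc n) (hρs n) (hχ0 _ (hR n)) (hχ1 _ (hR n)) (hτ0 n)
    (fun j x => (hχd _ (hR n) j x).trans (by simp only [τ]; have := hR n; gcongr; linarith))
    (fun j x => (hχb _ (hR n) j x).trans (by simp only [τ]; have := hR n; gcongr; linarith))
    (fun j x y hx hy => by
      have h1 := hχs _ (hR n) x hx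
      have h2 : x - y ∈ Function.support ((φ n).normed volume) := hy
      rw [(φ n).support_normed_eq, mem_ball, dist_zero_right, hout] at h2
      have h3 : ‖x - y‖ < δ n := h2.trans_le (min_le_left _ _)
      have h4 : ‖x - y‖ < 1 / ((n:ℝ) + 1) := h2.trans_le (min_le_right _ _)
      have h5 : 1 / ((n:ℝ) + 1) ≤ 1 := by
        rw [div_le_one (by positivity)]; linarith [(Nat.cast_nonneg n : (0:ℝ) ≤ n)]
      have h6 : ‖y‖ ≤ ‖x‖ + ‖x - y‖ := by
        have := norm_sub_le x (x - y); simpa using this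
      refine (hδ n j x y ?_ ?_ h3).trans ?_
      · simp only [R] at h1; linarith
      · simp only [R] at h1; linarith
      · simp only [τ, R]; gcongr; linarith)
  have hβ : ∀ n j, IsTest (fun x => (χ (R n) x : ℂ) * cv (α j) (Vc (ρ n)) x) := fun n j =>
    (hχ (R n) (hR n)).mul_smooth (cv_smooth (hαl j) (hρ n))
  have sqI : ∀ {f : EC m → ℂ}, IsTest f → Integrable (fun x => ‖f x‖ ^ 2) := by
    intro f hf
    exact hf.memLp.norm.integrable_sq
  have hcv : ∀ j, ∀ᵐ x, Tendsto (fun n => cv (α j) (Vc (ρ n)) x) atTop (nhds (α j x)) := by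
    intro j
    have ho : Tendsto (fun n => (φ n).rOut) atTop (nhds 0) :=
      squeeze_zero (fun n => (hmin n).le) (fun n => min_le_right _ _) lim1
    have := ContDiffBump.ae_convolution_tendsto_right_of_locallyIntegrable (μ := volume) (K := 2) ho
      (Eventually.of_forall fun n => by rw [hout, hin]; linarith) (hαl j)
    filter_upwards [this] with x hx
    refine hx.congr fun n => ?_
    rw [convolution_eq_swap]
    simp [cv, Vc, ρ, mul_comm]
  have hχt : ∀ x, Tendsto (fun n => (χ (R n) x : ℂ)) atTop (nhds 1) := by
    intro x
    refine tendsto_const_nhds.congr' ?_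
    filter_upwards [eventually_ge_atTop ⌈‖x‖⌉₊] with n hn
    rw [hχe _ (hR n) x ?_]; · simp
    have : ‖x‖ ≤ n := (Nat.le_ceil _).trans (by exact_mod_cast hn)
    simp only [R]; linarith
  have fin := fatou_real (fn := fun n x => 2 * c * ∑ j, ‖(χ (R n) x : ℂ) * cv (α j) (Vc (ρ n)) x‖ ^ 2)
    (f := fun x => 2 * c * ∑ j, ‖α j x‖ ^ 2)
    (bn := fun n => 2 * (∫ x, ‖w x‖ ^ 2) + (8 + 8 * m ^ 2) * τ n ^ 2 * ∫ x, (∑ j, ‖α j x‖) ^ 2)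
    (b := 2 * (∫ x, ‖w x‖ ^ 2) + (8 + 8 * m ^ 2) * 0 ^ 2 * ∫ x, (∑ j, ‖α j x‖) ^ 2)
    (fun n => (integrable_finsetSum _ fun j _ => sqI (hβ n j)).const_mul _)
    (fun n x => by positivity)
    ((integrable_finsetSum _ fun j _ => hα2 j).const_mul _)
    (fun x => by positivity)
    (((limτ.pow 2).const_mul _).mul_const _ |>.const_add _)
    (fun n => by
      rw [integral_const_mul, integral_finsetSum _ fun j _ => sqI (hβ n j)]
      exact hst n)
    (by
      have := ae_all_iff.2 hcv
      filter_upwards [this] with x hx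
      refine Tendsto.const_mul _ (tendsto_finsetSum _ fun j _ => ?_)
      have := ((hχt x).mul (hx j)).norm.pow 2
      simpa using this)
  rw [integral_const_mul, integral_finsetSum _ fun j _ => hα2 j] at fin
  simp only [ne_eq, OfNat.ofNat_ne_zero, not_false_eq_true, zero_pow, mul_zero, zero_mul, add_zero] at fin
  linarith
end fatou
end

section
section hilbert

lemma riesz_solve {T H0 : Type*} [AddCommGroup T] [Module ℂ T] [NormedAddCommGroup H0]
    [InnerProductSpace ℂ H0] [CompleteSpace H0] (δ : T →ₗ[ℂ] H0) (f : T →ₗ[ℂ] ℂ) (M : ℝ) (hM : 0 ≤ M)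
    (h : ∀ β, ‖f β‖ ≤ M * ‖δ β‖) : ∃ U : H0, ‖U‖ ≤ M ∧ ∀ β, inner ℂ U (δ β) = f β := by
  have hk : f ∈ (LinearMap.ker δ).dualAnnihilator := by
    rw [Submodule.mem_dualAnnihilator]
    intro β hβ
    have h1 := h β
    rw [LinearMap.mem_ker.1 hβ, norm_zero, mul_zero] at h1
    exact norm_le_zero_iff.1 h1
  rw [← LinearMap.range_dualMap_eq_dualAnnihilator_ker] at hk
  obtain ⟨g, hg⟩ := hk
  have hg' : ∀ β, g (δ β) = f β := fun β => by rw [← hg]; rfl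
  let g1 : LinearMap.range δ →ₗ[ℂ] ℂ := g.domRestrict _
  let g2 : StrongDual ℂ (LinearMap.range δ) := g1.mkContinuous M (by
    rintro ⟨_, β, rfl⟩
    show ‖g (δ β)‖ ≤ M * ‖δ β‖
    rw [hg']; exact h β)
  have hn : ‖g2‖ ≤ M := LinearMap.mkContinuous_norm_le _ hM _
  obtain ⟨G, hG1, hG2⟩ := exists_extension_norm_eq _ g2
  refine ⟨(InnerProductSpace.toDual ℂ H0).symm G, ?_, fun β => ?_⟩
  · rw [LinearIsometryEquiv.norm_map, hG2]; exact hn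
  · rw [InnerProductSpace.toDual_symm_apply]
    have := hG1 ⟨δ β, β, rfl⟩
    simp only at this
    rw [this]; exact hg' β

variable {m : ℕ}

lemma dzb_comm {f : EC m → ℂ} (hf : ContDiff ℝ ∞ f) (j k : Fin m) (x : EC m) :
    dzb k (dzb j f) x = dzb j (dzb k f) x := by
  have e1 : ∀ j, dzb j f = fun y => (dv (ee j) f y + I * dv (I • ee j) f y) / 2 := by
    intro j; ext y; simp only [dzb]
  rw [e1, e1]
  simp only [dzb]
  rw [dv_lin (smooth_dv hf _) (smooth_dv hf _), dv_lin (smooth_dv hf _) (smooth_dv hf _),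
    dv_lin (smooth_dv hf _) (smooth_dv hf _), dv_lin (smooth_dv hf _) (smooth_dv hf _),
    dv_comm hf (ee k) (ee j), dv_comm hf (ee k) (I • ee j), dv_comm hf (I • ee k) (ee j),
    dv_comm hf (I • ee k) (I • ee j)]
  ring

lemma Db_comm {V : EC m → ℝ} (hV : ContDiff ℝ ∞ V) {f : EC m → ℂ} (hf : ContDiff ℝ ∞ f) (j k : Fin m) (x : EC m) :
    Db V k (Db V j f) x = Db V j (Db V k f) x := by
  have hc := smooth_Vc hV
  have e2 : ∀ k, Db V k f = fun x => dzb k f x + dzb k (Vc V) x * f x := fun k => rfl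
  rw [e2, e2]
  simp only [Db]
  rw [dzb_add (smooth_dzb hf _) ((smooth_dzb hc _).mul hf), dzb_add (smooth_dzb hf _) ((smooth_dzb hc _).mul hf),
    dzb_mul (smooth_dzb hc _) hf, dzb_mul (smooth_dzb hc _) hf, dzb_comm hf, dzb_comm hc]
  ring

lemma dzb_cmul {f : EC m → ℂ} (hf : ContDiff ℝ ∞ f) (c : ℂ) (j : Fin m) (x : EC m) :
    dzb j (fun y => c * f y) x = c * dzb j f x := by
  simp only [dzb, dv_cmul hf]; ring
lemma dz_cmul {f : EC m → ℂ} (hf : ContDiff ℝ ∞ f) (c : ℂ) (j : Fin m) (x : EC m) :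
    dz j (fun y => c * f y) x = c * dz j f x := by
  simp only [dz, dv_cmul hf]; ring

lemma dz_zero' (j : Fin m) (x : EC m) : dz j (fun _ => (0:ℂ)) x = 0 := by
  simp [dz, dv]

/-- test forms -/
def TestForms (m : ℕ) : Submodule ℂ (Fin m → EC m → ℂ) where
  carrier := {β | ∀ j, IsTest (β j)}
  add_mem' := fun ha hb j => (ha j).add (hb j)
  zero_mem' := fun _ => IsTest.zero
  smul_mem' := fun c _ ha j => (ha j).smooth_mul (g := fun _ => c) contDiff_const

lemma inner_toLp {f g : EC m → ℂ} (hf : MemLp f 2 (volume : Measure (EC m))) (hg : MemLp g 2 volume) :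
    inner ℂ (hf.toLp f) (hg.toLp g) = ∫ x, g x * conj (f x) := by
  rw [L2.inner_def]
  refine integral_congr_ae ?_
  filter_upwards [hf.coeFn_toLp, hg.coeFn_toLp] with x h1 h2
  rw [h1, h2, RCLike.inner_apply]

lemma inner_toLp_left {f : EC m → ℂ} (hf : MemLp f 2 (volume : Measure (EC m))) (g : Lp ℂ 2 (volume : Measure (EC m))) :
    inner ℂ (hf.toLp f) g = ∫ x, g x * conj (f x) := by
  rw [L2.inner_def]
  refine integral_congr_ae ?_
  filter_upwards [hf.coeFn_toLp] with x h1
  rw [h1, RCLike.inner_apply]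

lemma norm_sq_Lp (g : Lp ℂ 2 (volume : Measure (EC m))) : ‖g‖ ^ 2 = ∫ x, ‖g x‖ ^ 2 := by
  have h := inner_self_eq_norm_sq_to_K (𝕜 := ℂ) g
  rw [L2.inner_def] at h
  have e : ∀ x, inner ℂ (g x) (g x) = ((‖g x‖ ^ 2 : ℝ) : ℂ) := fun x => by
    rw [inner_self_eq_norm_sq_to_K]; simp
  simp only [e] at h
  rw [integral_complex_ofReal] at h
  have h2 : ((‖g‖ ^ 2 : ℝ) : ℂ) = ((∫ x, ‖g x‖ ^ 2 : ℝ) : ℂ) := by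
    rw [h]; simp
  exact_mod_cast h2

lemma norm_sq_toLp {f : EC m → ℂ} (hf : MemLp f 2 (volume : Measure (EC m))) :
    ‖hf.toLp f‖ ^ 2 = ∫ x, ‖f x‖ ^ 2 := by
  rw [norm_sq_Lp]
  refine integral_congr_ae ?_
  filter_upwards [hf.coeFn_toLp] with x h1
  rw [h1]

abbrev H1 (m : ℕ) := PiLp 2 (fun _ : Fin m => Lp ℂ 2 (volume : Measure (EC m)))

def bm (m : ℕ) : TestForms m →ₗ[ℂ] H1 m where
  toFun β := WithLp.toLp 2 (fun j => (β.2 j).memLp.toLp (β.1 j))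
  map_add' := fun a b => by
    ext1 j
    exact MemLp.toLp_add (a.2 j).memLp (b.2 j).memLp
  map_smul' := fun c a => by
    ext1 j
    exact MemLp.toLp_const_smul c (a.2 j).memLp

def dm {V : EC m → ℝ} (hV : ContDiff ℝ ∞ V) : TestForms m →ₗ[ℂ] Lp ℂ 2 (volume : Measure (EC m)) where
  toFun β := (IsTest.sum Finset.univ fun j _ => IsTest.Dd hV (β.2 j) j).memLp.toLp (fun x => ∑ j, Dd V j (β.1 j) x)
  map_add' := fun a b => by
    rw [← MemLp.toLp_add]
    congr 1
    ext x
    simp only [Pi.add_apply]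
    rw [← Finset.sum_add_distrib]
    refine Finset.sum_congr rfl fun j _ => ?_
    have : ((a + b : TestForms m).1 j) = fun x => a.1 j x + b.1 j x := rfl
    rw [this]
    simp only [Dd, dz_add (a.2 j).smooth (b.2 j).smooth]; ring
  map_smul' := fun c a => by
    simp only [RingHom.id_apply]
    rw [← MemLp.toLp_const_smul]
    congr 1
    ext x
    simp only [Pi.smul_apply, smul_eq_mul]
    rw [Finset.mul_sum]
    refine Finset.sum_congr rfl fun j _ => ?_
    have : ((c • a : TestForms m).1 j) = fun x => c * a.1 j x := rfl
    rw [this]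
    simp only [Dd, dz_cmul (a.2 j).smooth]; ring

theorem solve {V : EC m → ℝ} (hV : ContDiff ℝ ∞ V) {c : ℝ} (hc : 0 < c)
    (hL : ∀ x, ∀ t : Fin m → ℂ, c * ∑ j, ‖t j‖ ^ 2 ≤
      (∑ j, ∑ k, dz j (dzb k (Vc V)) x * t j * conj (t k)).re)
    {g : EC m → ℂ} (hg : IsTest g) :
    ∃ U : EC m → ℂ, MemLp U 2 ∧ (∀ j ψ, IsTest ψ →
      ∫ x, U x * conj (Dd V j ψ x) = ∫ x, Db V j g x * conj (ψ x)) ∧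
      c * ∫ x, ‖U x‖ ^ 2 ≤ ∑ j, ∫ x, ‖Db V j g x‖ ^ 2 := by
  classical
  -- the family Db ψ as test form
  let D : ∀ ψ : EC m → ℂ, IsTest ψ → TestForms m := fun ψ hψ => ⟨fun j => Db V j ψ, fun j => IsTest.Db hV hψ j⟩
  let s : ∀ (j : Fin m) (ψ : EC m → ℂ), IsTest ψ → TestForms m := fun j ψ hψ =>
    ⟨fun i => if i = j then ψ else fun _ => 0, fun i => by
      by_cases h : i = j
      · simp only [h, if_true]; exact hψ
      · simp only [h, if_false]; exact IsTest.zero⟩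
  have hbs : ∀ j ψ (hψ : IsTest ψ) (v : H1 m), inner ℂ (bm m (s j ψ hψ)) v = ∫ x, v j x * conj (ψ x) := by
    intro j ψ hψ v
    rw [PiLp.inner_apply]
    rw [Finset.sum_eq_single j]
    · show inner ℂ (MemLp.toLp _ ((s j ψ hψ).2 j).memLp) _ = _
      rw [inner_toLp_left]
      simp [s]
    · intro i _ hi
      show inner ℂ (MemLp.toLp _ ((s j ψ hψ).2 i).memLp) _ = _
      rw [inner_toLp_left]
      simp [s, hi]
    · simp
  have hbb : ∀ (β : TestForms m) (v : H1 m), inner ℂ (bm m β) v = ∑ j, ∫ x, v j x * conj (β.1 j x) := by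
    intro β v
    rw [PiLp.inner_apply]
    refine Finset.sum_congr rfl fun j _ => ?_
    show inner ℂ (MemLp.toLp _ (β.2 j).memLp) _ = _
    rw [inner_toLp_left]
  have hco : ∀ (β : TestForms m) (j : Fin m), (fun x => (bm m β) j x) =ᵐ[volume] β.1 j := fun β j =>
    MemLp.coeFn_toLp (β.2 j).memLp
  let S : Set (H1 m) := {v | ∃ j k ψ, ∃ hψ : IsTest ψ,
    v = bm m (s j _ (IsTest.Dd hV hψ k)) - bm m (s k _ (IsTest.Dd hV hψ j))}
  let Z : Submodule ℂ (H1 m) := (Submodule.span ℂ S)ᗮ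
  have : CompleteSpace (H1 m) := inferInstance
  have : CompleteSpace Z := (Submodule.isClosed_orthogonal _).completeSpace_coe
  have : Z.HasOrthogonalProjection := Submodule.HasOrthogonalProjection.ofCompleteSpace Z
  have hZiff : ∀ v : H1 m, v ∈ Z ↔ ∀ j k ψ, IsTest ψ →
      ∫ x, v j x * conj (Dd V k ψ x) = ∫ x, v k x * conj (Dd V j ψ x) := by
    intro v
    constructor
    · intro hv j k ψ hψ
      have := hv _ (Submodule.subset_span ⟨j, k, ψ, hψ, rfl⟩)
      rw [inner_sub_left, hbs j _ (IsTest.Dd hV hψ k), hbs k _ (IsTest.Dd hV hψ j), sub_eq_zero] at this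
      exact this
    · intro hv
      have : Submodule.span ℂ S ≤ (ℂ ∙ v)ᗮ := by
        rw [Submodule.span_le]
        rintro _ ⟨j, k, ψ, hψ, rfl⟩
        rw [SetLike.mem_coe, Submodule.mem_orthogonal_singleton_iff_inner_left, inner_sub_left,
          hbs j _ (IsTest.Dd hV hψ k), hbs k _ (IsTest.Dd hV hψ j), sub_eq_zero]
        exact hv j k ψ hψ
      intro u hu
      exact Submodule.mem_orthogonal_singleton_iff_inner_left.1 (this hu)
  have hDZ : ∀ ψ (hψ : IsTest ψ), bm m (D ψ hψ) ∈ Z := by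
    intro ψ hψ
    rw [hZiff]
    intro j k φ hφ
    have e : ∀ j k, ∫ x, bm m (D ψ hψ) j x * conj (Dd V k φ x) = ∫ x, Db V k (Db V j ψ) x * conj (φ x) := by
      intro j k
      rw [Db_adj hV (IsTest.Db hV hψ j) hφ]
      refine integral_congr_ae ?_
      filter_upwards [hco (D ψ hψ) j] with x hx
      rw [hx]
    rw [e, e]
    congr 1; ext x; rw [Db_comm hV hψ.smooth]
  have hbn : ∀ ψ (hψ : IsTest ψ), ‖bm m (D ψ hψ)‖ ^ 2 = ∑ j, ∫ x, ‖Db V j ψ x‖ ^ 2 := by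
    intro ψ hψ
    rw [PiLp.norm_sq_eq_of_L2]
    exact Finset.sum_congr rfl fun j _ => norm_sq_toLp ((D ψ hψ).2 j).memLp
  set γ := bm m (D g hg) with hγ
  have hest : ∀ β : TestForms m, ‖inner ℂ γ (bm m β)‖ ≤ (‖γ‖ / √c) * ‖dm hV β‖ := by
    intro β
    set α := Z.starProjection (bm m β) with hα
    have hαZ : α ∈ Z := by rw [hα]; exact Submodule.starProjection_apply_mem _ _
    have hin : ∀ v ∈ Z, inner ℂ v (bm m β) = inner ℂ v α := by
      intro v hv
      have := Submodule.sub_starProjection_mem_orthogonal (K := Z) (bm m β) v hv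
      rw [inner_sub_right, sub_eq_zero] at this
      exact this
    rw [hin _ (hDZ g hg)]
    have hest0 := closed_estimate hV hc hL (α := fun j x => α j x) (w := fun x => ∑ j, Dd V j (β.1 j) x)
      (fun j => Lp.memLp _) (IsTest.sum Finset.univ fun j _ => IsTest.Dd hV (β.2 j) j).memLp
      ((hZiff α).1 hαZ) (by
        intro ψ hψ
        have h1 := hin _ (hDZ ψ hψ)
        rw [hbb, hbb] at h1
        refine h1.symm.trans ?_
        have h2 : ∀ j, ∫ x, bm m β j x * conj ((D ψ hψ).1 j x) = ∫ x, Dd V j (β.1 j) x * conj (ψ x) := by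
          intro j
          rw [Dd_adj hV (β.2 j) hψ]
          refine integral_congr_ae ?_
          filter_upwards [hco β j] with x hx
          rw [hx]
        simp only [h2, Finset.sum_mul]
        rw [integral_finsetSum]
        intro j _
        exact ((IsTest.Dd hV (β.2 j) j).mul_smooth hψ.star.smooth).integrable)
    have e1 : ‖α‖ ^ 2 = ∑ j, ∫ x, ‖α j x‖ ^ 2 := by
      rw [PiLp.norm_sq_eq_of_L2]
      exact Finset.sum_congr rfl fun j _ => norm_sq_Lp _
    have e2 : ‖dm hV β‖ ^ 2 = ∫ x, ‖∑ j, Dd V j (β.1 j) x‖ ^ 2 :=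
      norm_sq_toLp (IsTest.sum Finset.univ fun j _ => IsTest.Dd hV (β.2 j) j).memLp
    rw [← e1, ← e2] at hest0
    have hsq : √c * ‖α‖ ≤ ‖dm hV β‖ := by
      refine le_of_sq_le_sq ?_ (norm_nonneg _)
      rw [mul_pow, Real.sq_sqrt hc.le]; exact hest0
    have hsc : 0 < √c := Real.sqrt_pos.2 hc
    have h3 : ‖α‖ ≤ ‖dm hV β‖ / √c := by rw [le_div_iff₀ hsc]; linarith
    calc ‖inner ℂ γ α‖ ≤ ‖γ‖ * ‖α‖ := norm_inner_le_norm _ _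
      _ ≤ ‖γ‖ * (‖dm hV β‖ / √c) := by gcongr
      _ = _ := by ring
  obtain ⟨U, hU1, hU2⟩ := riesz_solve (dm hV) ((innerSL ℂ γ).toLinearMap ∘ₗ bm m) (‖γ‖ / √c) (by positivity)
    (fun β => hest β)
  refine ⟨U, Lp.memLp U, fun j ψ hψ => ?_, ?_⟩
  · have h := hU2 (s j ψ hψ)
    have h' : inner ℂ U (dm hV (s j ψ hψ)) = inner ℂ γ (bm m (s j ψ hψ)) := h
    rw [← inner_conj_symm, ← inner_conj_symm γ, hbs j ψ hψ] at h'
    have h2 := (starRingEnd ℂ).injective h'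
    have h3 : inner ℂ (dm hV (s j ψ hψ)) U = ∫ x, U x * conj (∑ i, Dd V i ((s j ψ hψ).1 i) x) :=
      inner_toLp_left (IsTest.sum Finset.univ fun i _ => IsTest.Dd hV ((s j ψ hψ).2 i) i).memLp U
    have h4 : ∀ x, ∑ i, Dd V i ((s j ψ hψ).1 i) x = Dd V j ψ x := by
      intro x
      rw [Finset.sum_eq_single j]
      · simp [s]
      · intro i _ hi
        simp [s, hi, Dd, dz_zero']
      · simp
    rw [h3] at h2
    simp only [h4] at h2
    rw [h2]
    refine integral_congr_ae ?_
    filter_upwards [hco (D g hg) j] with x hx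
    rw [hx]
  · rw [← norm_sq_Lp, ← hbn g hg]
    have := pow_le_pow_left₀ (norm_nonneg _) hU1 2
    rw [div_pow, Real.sq_sqrt hc.le, le_div_iff₀ hc] at this
    linarith
end hilbert
end

section
section D1
variable {m : ℕ}

/-- second derivative -/
def D2 (f : EC m → ℝ) (x h k : EC m) : ℝ := fderiv ℝ (fderiv ℝ f) x h k

lemma fderiv_smooth {f : EC m → ℝ} (hf : ContDiff ℝ ∞ f) : ContDiff ℝ ∞ (fderiv ℝ f) :=
  hf.fderiv_right (m := ∞) (by simp)

lemma D2_symm {f : EC m → ℝ} (hf : ContDiff ℝ ∞ f) (x h k : EC m) : D2 f x h k = D2 f x k h := by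
  have hs : IsSymmSndFDerivAt ℝ f x :=
    (hf.contDiffAt).isSymmSndFDerivAt (by simp only [minSmoothness_of_isRCLikeNormedField]; exact WithTop.coe_le_coe.2 (le_top : (2:ℕ∞) ≤ ⊤))
  exact hs h k

lemma taylor2 {f : EC m → ℝ} (hf : ContDiff ℝ ∞ f) (x : EC m) {ε : ℝ} (hε : 0 < ε) :
    ∃ δ > 0, ∀ h : EC m, ‖h‖ < δ → |f (x + h) - f x - fderiv ℝ f x h - (1/2) * D2 f x h h| ≤ ε * ‖h‖ ^ 2 := by
  have hd : HasFDerivAt (fderiv ℝ f) (fderiv ℝ (fderiv ℝ f) x) x :=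
    ((fderiv_smooth hf).differentiable (by simp) x).hasFDerivAt
  have ho := hd.isLittleO
  rw [Asymptotics.isLittleO_iff] at ho
  have h1 := ho hε
  rw [Metric.eventually_nhds_iff] at h1
  obtain ⟨δ, hδ, h1⟩ := h1
  refine ⟨δ, hδ, fun h hh => ?_⟩
  set L := fderiv ℝ (fderiv ℝ f) x with hL
  let G : EC m → ℝ := fun k => f (x + k) - fderiv ℝ f x k - (1/2) * L k k
  have hG : ∀ k, HasFDerivAt G (fderiv ℝ f (x + k) - fderiv ℝ f x - L k) k := by
    intro k
    have a1 : HasFDerivAt (fun k => f (x + k)) (fderiv ℝ f (x + k)) k := by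
      have := (hf.differentiable (by simp) (x + k)).hasFDerivAt.comp k ((hasFDerivAt_id k).const_add x)
      exact this
    have a2 : HasFDerivAt (fun k => fderiv ℝ f x k) (fderiv ℝ f x) k := (fderiv ℝ f x).hasFDerivAt
    have a3 := (L.hasFDerivAt (x := k)).clm_apply (hasFDerivAt_id k)
    have a4 := (a1.sub a2).sub (a3.const_mul (1/2 : ℝ))
    refine a4.congr_fderiv ?_
    ext v
    have : L v k = L k v := D2_symm hf x v k
    simp [this]; ring
  have key := (convex_closedBall (0 : EC m) ‖h‖).norm_image_sub_le_of_norm_hasFDerivWithin_le (f := G) (C := ε * ‖h‖)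
    (x := 0) (y := h) (f' := fun k => fderiv ℝ f (x + k) - fderiv ℝ f x - L k)
    (fun k _ => (hG k).hasFDerivWithinAt) (fun k hk => by
      have hk' : ‖k‖ ≤ ‖h‖ := by simpa using hk
      have := h1 (y := x + k) (by simpa [dist_eq_norm] using hk'.trans_lt hh)
      simp only [add_sub_cancel_left] at this
      exact this.trans (by gcongr)) (by simp) (by simp)
  have e : G h - G 0 = f (x + h) - f x - fderiv ℝ f x h - (1/2) * D2 f x h h := by
    simp only [G, D2, hL]; simp; ring
  rw [e, Real.norm_eq_abs, sub_zero] at key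
  linarith [key, sq (‖h‖)]

lemma exists_mollifier (m : ℕ) {s : ℝ} (hs : 0 < s) : ∃ ρ : EC m → ℝ, IsTest (Vc ρ) ∧ ContDiff ℝ ∞ ρ ∧
    HasCompactSupport ρ ∧ (∀ x, 0 ≤ ρ x) ∧ ∫ x, ρ x = 1 ∧ (∀ x, ρ x ≠ 0 → ‖x‖ ≤ s) ∧
    (∀ (θ : ℝ) x, ρ (Complex.exp (θ * I) • x) = ρ x) ∧ ∀ x, ρ (-x) = ρ x := by
  let r : EC m → ℝ := fun x => Real.smoothTransition (1 - ‖x‖ ^ 2 / s ^ 2)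
  have hr : ContDiff ℝ ∞ r :=
    Real.smoothTransition.contDiff.comp (contDiff_const.sub ((contDiff_norm_sq ℝ).div_const _))
  have hsup : ∀ x, r x ≠ 0 → ‖x‖ ≤ s := by
    intro x hx
    by_contra hc
    push Not at hc
    apply hx
    apply Real.smoothTransition.zero_of_nonpos
    rw [sub_nonpos, le_div_iff₀ (by positivity), one_mul]
    gcongr
  have hcs : HasCompactSupport r := by
    refine HasCompactSupport.of_support_subset_isCompact (isCompact_closedBall (0 : EC m) s) fun x hx => ?_
    simpa using hsup x hx
  have hnn : ∀ x, 0 ≤ r x := fun x => Real.smoothTransition.nonneg _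
  have hpos : 0 < ∫ x, r x := by
    rw [integral_pos_iff_support_of_nonneg hnn (hr.continuous.integrable_of_hasCompactSupport hcs)]
    refine (hr.continuous.isOpen_support).measure_pos _ ⟨0, ?_⟩
    simp [r]
  refine ⟨fun x => (∫ x, r x)⁻¹ * r x, ?_, contDiff_const.mul hr, hcs.mul_left, ?_, ?_, ?_, ?_, ?_⟩
  · exact ⟨Complex.ofRealCLM.contDiff.comp (contDiff_const.mul hr),
      (HasCompactSupport.mul_left (f := fun _ => (∫ x, r x)⁻¹) hcs).comp_left (g := fun r : ℝ => (r : ℂ)) (by simp)⟩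
  · exact fun x => mul_nonneg (inv_nonneg.2 hpos.le) (hnn x)
  · rw [integral_const_mul, inv_mul_cancel₀ hpos.ne']
  · exact fun x hx => hsup x (right_ne_zero_of_mul hx)
  · intro θ x
    simp [r, norm_smul, Complex.norm_exp_ofReal_mul_I]
  · intro x
    simp [r]

/-- invariance of the integral under rotation -/
lemma integral_rot {E : Type*} [NormedAddCommGroup E] [NormedSpace ℝ E] (f : EC m → E) (θ : ℝ) :
    ∫ y, f (Complex.exp (θ * I) • y) = ∫ y, f y := by
  let e : EC m ≃ₗᵢ[ℝ] EC m :=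
    { toFun := fun y => Complex.exp (θ * I) • y
      invFun := fun y => Complex.exp (-(θ * I)) • y
      map_add' := fun x y => smul_add _ _ _
      map_smul' := fun c x => smul_comm _ _ _
      left_inv := fun y => by
        simp only [smul_smul, ← Complex.exp_add]; simp
      right_inv := fun y => by
        simp only [smul_smul, ← Complex.exp_add]; simp
      norm_map' := fun y => by
        change ‖Complex.exp (θ * I) • y‖ = ‖y‖
        rw [norm_smul, Complex.norm_exp_ofReal_mul_I, one_mul] }
  exact e.measurePreserving.integral_comp e.toHomeomorph.measurableEmbedding f

lemma levi_id {f : EC m → ℂ} (hf : ContDiff ℝ ∞ f) (t : Fin m → ℂ) (x : EC m) :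
    ∑ j, ∑ k, dz j (dzb k f) x * t j * conj (t k) =
      (1/4) * (dv (WithLp.toLp 2 t) (dv (WithLp.toLp 2 t) f) x +
        dv (I • WithLp.toLp 2 t) (dv (I • WithLp.toLp 2 t) f) x) := by
  set h : EC m := WithLp.toLp 2 t with hh
  have eh : h = ∑ j, ((t j).re • ee j + (t j).im • (I • ee j : EC m)) := by
    ext i
    simp only [hh, ee, WithLp.ofLp_sum, Finset.sum_apply, PiLp.add_apply, PiLp.smul_apply, PiLp.single_apply]
    rw [Finset.sum_eq_single i]
    · simp
    · intro j _ hj; simp [hj.symm]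
    · simp
  have ehI : I • h = ∑ j, ((-(t j).im) • ee j + (t j).re • (I • ee j : EC m)) := by
    rw [eh, Finset.smul_sum]
    refine Finset.sum_congr rfl fun j _ => ?_
    rw [smul_add, smul_comm I, smul_comm I (t j).im, smul_smul I I, Complex.I_mul_I]
    simp [add_comm]
  have d1 : ∀ (g : EC m → ℂ) y, ∑ j, dz j g y * t j = (1/2) * (dv h g y - I * dv (I • h) g y) := by
    intro g y
    rw [ehI, eh]
    simp only [dv, map_sum, map_add, map_smul, dz]
    rw [Finset.mul_sum, ← Finset.sum_sub_distrib, Finset.mul_sum]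
    refine Finset.sum_congr rfl fun j _ => ?_
    simp only [Complex.real_smul]
    conv_lhs => rw [← Complex.re_add_im (t j)]
    push_cast
    linear_combination (-(1/2) * ↑(t j).im * (fderiv ℝ g y) (I • ee j)) * Complex.I_mul_I
  have d2 : ∀ (g : EC m → ℂ) y, ∑ k, dzb k g y * conj (t k) = (1/2) * (dv h g y + I * dv (I • h) g y) := by
    intro g y
    rw [ehI, eh]
    simp only [dv, map_sum, map_add, map_smul, dzb]
    rw [Finset.mul_sum, ← Finset.sum_add_distrib, Finset.mul_sum]
    refine Finset.sum_congr rfl fun j _ => ?_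
    simp only [Complex.real_smul]
    conv_lhs => rw [← Complex.re_add_im (t j)]
    simp only [map_add, map_mul, Complex.conj_ofReal, Complex.conj_I]
    push_cast
    linear_combination (-(1/2) * ↑(t j).im * (fderiv ℝ g y) (I • ee j)) * Complex.I_mul_I
  have e2 : ∀ k, dzb k f = fun y => (dv (ee k) f y + I * dv (I • ee k) f y) / 2 := by
    intro k; ext y; simp only [dzb]
  have cm : ∀ (u : EC m) k, dv u (dzb k f) x = dzb k (dv u f) x := by
    intro u k
    rw [e2, dv_lin (smooth_dv hf _) (smooth_dv hf _), dv_comm hf u, dv_comm hf u]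
    rfl
  rw [Finset.sum_comm]
  calc ∑ k, ∑ j, dz j (dzb k f) x * t j * conj (t k)
      = ∑ k, ((1/2) * (dzb k (dv h f) x * conj (t k)) - (I/2) * (dzb k (dv (I • h) f) x * conj (t k))) := by
        refine Finset.sum_congr rfl fun k _ => ?_
        rw [← Finset.sum_mul, d1, cm, cm]; ring
    _ = _ := by
        rw [Finset.sum_sub_distrib, ← Finset.mul_sum, ← Finset.mul_sum, d2, d2, dv_comm hf (I • h) h]
        linear_combination (-(1/4) * dv (I • h) (dv (I • h) f) x) * Complex.I_mul_I

lemma dv_Vc {f : EC m → ℝ} (hf : ContDiff ℝ ∞ f) (h x : EC m) : dv h (Vc f) x = (fderiv ℝ f x h : ℂ) := by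
  unfold dv
  have := (Complex.ofRealCLM.hasFDerivAt (x := f x)).comp x (hf.differentiable (by simp) x).hasFDerivAt
  have h2 : fderiv ℝ (Vc f) x = Complex.ofRealCLM.comp (fderiv ℝ f x) := this.fderiv
  rw [h2]; rfl

lemma dv_dv_Vc {f : EC m → ℝ} (hf : ContDiff ℝ ∞ f) (h k x : EC m) :
    dv h (dv k (Vc f)) x = (D2 f x h k : ℂ) := by
  have e : dv k (Vc f) = Vc (fun y => fderiv ℝ f y k) := by ext y; exact dv_Vc hf k y
  have hs : ContDiff ℝ ∞ (fun y => fderiv ℝ f y k) := (fderiv_smooth hf).clm_apply contDiff_const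
  rw [e, dv_Vc hs]
  congr 1
  have := ((fderiv_smooth hf).differentiable (by simp) x).hasFDerivAt.clm_apply (hasFDerivAt_const k x)
  rw [this.fderiv]; simp [D2]

lemma levi_real {f : EC m → ℝ} (hf : ContDiff ℝ ∞ f) (t : Fin m → ℂ) (x : EC m) :
    (∑ j, ∑ k, dz j (dzb k (Vc f)) x * t j * conj (t k)).re =
      (1/4) * (D2 f x (WithLp.toLp 2 t) (WithLp.toLp 2 t) +
        D2 f x (I • WithLp.toLp 2 t) (I • WithLp.toLp 2 t)) := by
  rw [levi_id (smooth_Vc hf), dv_dv_Vc hf, dv_dv_Vc hf, ← Complex.ofReal_add]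
  norm_num [Complex.mul_re]

end D1
end

section
section D2
variable {m : ℕ}

lemma circled_mean {E : Type*} [NormedAddCommGroup E] [NormedSpace ℝ E] [CompleteSpace E] {f : EC m → E}
    {ρ : EC m → ℝ} {s M : ℝ} (hf : StronglyMeasurable f) (hρ : Continuous ρ) (hρc : HasCompactSupport ρ)
    (hρ0 : ∀ x, 0 ≤ ρ x)
    (hρs : ∀ x, ρ x ≠ 0 → ‖x‖ ≤ s) (hρr : ∀ (θ : ℝ) x, ρ (Complex.exp (θ * I) • x) = ρ x)
    (a : EC m) (hM : ∀ y, ‖y‖ ≤ s → ‖f (a + y)‖ ≤ M) :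
    (∫ y, ρ y • f (a + y) =
      ∫ y, ρ y • ((2 * Real.pi)⁻¹ • ∫ θ in (0:ℝ)..(2 * Real.pi), f (a + Complex.exp (θ * I) • y))) ∧
    Integrable (fun y => ρ y • ((2 * Real.pi)⁻¹ • ∫ θ in (0:ℝ)..(2 * Real.pi), f (a + Complex.exp (θ * I) • y))) := by
  have hpi := Real.pi_pos
  have h1 : ∀ θ : ℝ, ∫ y, ρ y • f (a + y) = ∫ y, ρ y • f (a + Complex.exp (θ * I) • y) := by
    intro θ
    rw [← integral_rot (fun y => ρ y • f (a + y)) θ]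
    simp only [hρr]
  have hint : Integrable (fun p : ℝ × EC m => ρ p.2 • f (a + Complex.exp (p.1 * I) • p.2))
      ((volume.restrict (Ioc 0 (2 * Real.pi))).prod volume) := by
    have hd : Integrable (fun p : ℝ × EC m => (1:ℝ) * (ρ p.2 * M))
      ((volume.restrict (Ioc 0 (2 * Real.pi))).prod volume) := by
      refine Integrable.mul_prod (f := fun _ : ℝ => (1:ℝ)) (g := fun y => ρ y * M) (integrable_const _) ?_
      exact (hρ.integrable_of_hasCompactSupport hρc).mul_const M
    refine hd.mono' ?_ (Eventually.of_forall fun p => ?_)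
    · refine AEStronglyMeasurable.smul (by fun_prop) ?_
      have : Continuous (fun p : ℝ × EC m => a + Complex.exp (p.1 * I) • p.2) := by fun_prop
      exact (hf.comp_measurable this.measurable).aestronglyMeasurable
    · rw [norm_smul, Real.norm_of_nonneg (hρ0 _), one_mul]
      by_cases h0 : ρ p.2 = 0
      · simp [h0]
      · gcongr
        · exact hρ0 _
        · apply hM
          rw [norm_smul, Complex.norm_exp_ofReal_mul_I, one_mul]
          exact hρs _ h0
  have h2 : ∫ θ in (0:ℝ)..(2 * Real.pi), (∫ y, ρ y • f (a + Complex.exp (θ * I) • y))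
      = (2 * Real.pi) • ∫ y, ρ y • f (a + y) := by
    rw [intervalIntegral.integral_congr (g := fun _ => ∫ y, ρ y • f (a + y)) (fun θ _ => (h1 θ).symm)]
    simp
  have h3 : ∫ y, ρ y • f (a + y) = (2 * Real.pi)⁻¹ • ∫ θ in (0:ℝ)..(2 * Real.pi), (∫ y, ρ y • f (a + Complex.exp (θ * I) • y)) := by
    rw [h2, smul_smul, inv_mul_cancel₀ (by positivity), one_smul]
  have h4 : ∀ y, (2 * Real.pi)⁻¹ • ∫ θ in Ioc (0:ℝ) (2 * Real.pi), ρ y • f (a + Complex.exp (θ * I) • y) =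
      ρ y • ((2 * Real.pi)⁻¹ • ∫ θ in (0:ℝ)..(2 * Real.pi), f (a + Complex.exp (θ * I) • y)) := by
    intro y
    rw [intervalIntegral.integral_of_le (by positivity), integral_smul, smul_comm]
  constructor
  · rw [h3, intervalIntegral.integral_of_le (by positivity), integral_integral_swap hint, ← integral_smul]
    congr 1; ext y
    exact h4 y
  · exact (hint.integral_prod_right.smul (2 * Real.pi)⁻¹).congr (Eventually.of_forall h4)

/-- locally bounded measurable with the sub-mean value property -/
structure SubM (f : EC m → ℝ) : Prop where
  meas : Measurable f
  bdd : ∀ R : ℝ, ∃ M, ∀ x, ‖x‖ ≤ R → |f x| ≤ M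
  sub : ∀ x b, 2 * Real.pi * f x ≤ ∫ θ in (0:ℝ)..(2 * Real.pi), f (x + Complex.exp (θ * I) • b)

lemma SubM.circ_int {f : EC m → ℝ} (hf : SubM f) (x b : EC m) :
    IntervalIntegrable (fun θ : ℝ => f (x + Complex.exp (θ * I) • b)) volume 0 (2 * Real.pi) := by
  obtain ⟨M, hM⟩ := hf.bdd (‖x‖ + ‖b‖)
  have : IntervalIntegrable (fun _ : ℝ => M) volume 0 (2 * Real.pi) := by simp
  refine this.mono_fun' ?_ (Eventually.of_forall fun θ => ?_)
  · have : Continuous (fun θ : ℝ => x + Complex.exp (θ * I) • b) := by fun_prop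
    exact (hf.meas.comp this.measurable).aestronglyMeasurable
  · apply hM
    refine (norm_add_le _ _).trans ?_
    rw [norm_smul, Complex.norm_exp_ofReal_mul_I, one_mul]

lemma SubM.locInt {f : EC m → ℝ} (hf : SubM f) : LocallyIntegrable f := by
  rw [locallyIntegrable_iff]
  intro K hK
  obtain ⟨R, hR⟩ := hK.isBounded.exists_norm_le
  obtain ⟨M, hM⟩ := hf.bdd R
  refine IntegrableOn.of_bound hK.measure_lt_top hf.meas.aestronglyMeasurable M ?_
  exact (ae_restrict_mem hK.measurableSet).mono fun x hx => hM x (hR x hx)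

/-- mollified function -/
def mol (f ρ : EC m → ℝ) (x : EC m) : ℝ := ∫ y, ρ y * f (x + y)

section
variable {f ρ : EC m → ℝ} {s : ℝ} (hf : SubM f) (hρ : ContDiff ℝ ∞ ρ) (hρc : HasCompactSupport ρ)
    (hρ0 : ∀ x, 0 ≤ ρ x) (hρ1 : ∫ x, ρ x = 1)
    (hρs : ∀ x, ρ x ≠ 0 → ‖x‖ ≤ s) (hρr : ∀ (θ : ℝ) x, ρ (Complex.exp (θ * I) • x) = ρ x)
    (hρn : ∀ x, ρ (-x) = ρ x)
include hf hρ hρc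

lemma mol_integrable (x : EC m) : Integrable (fun y => ρ y * f (x + y)) := by
  obtain ⟨R, hR⟩ := hρc.isCompact.isBounded.exists_norm_le
  obtain ⟨M, hM⟩ := hf.bdd (‖x‖ + R)
  have hd : Integrable (fun y => |ρ y| * M) := ((hρ.continuous.integrable_of_hasCompactSupport hρc).abs).mul_const M
  refine hd.mono' ?_ (Eventually.of_forall fun y => ?_)
  · exact (hρ.continuous.measurable.mul (hf.meas.comp (measurable_const_add x))).aestronglyMeasurable
  · rw [norm_mul, Real.norm_eq_abs, Real.norm_eq_abs]
    by_cases h0 : ρ y = 0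
    · simp [h0]
    · gcongr
      apply hM
      refine (norm_add_le _ _).trans ?_
      gcongr
      exact hR y (subset_tsupport _ h0)

include hρn in
lemma mol_smooth : ContDiff ℝ ∞ (mol f ρ) := by
  have h := hρc.contDiff_convolution_right (f := f) (n := ⊤) (ContinuousLinearMap.mul ℝ ℝ) hf.locInt hρ (μ := volume)
  convert h using 1
  ext x
  rw [MeasureTheory.convolution_def, mol]
  rw [← integral_add_left_eq_self (fun t => (ContinuousLinearMap.mul ℝ ℝ) (f t) (ρ (x - t))) x]
  congr 1; ext y
  simp only [ContinuousLinearMap.mul_apply']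
  rw [mul_comm, sub_add_cancel_left, hρn]

include hρ0 hρ1 hρs

omit hρs in
lemma mol_le {x : EC m} {c : ℝ} (h : ∀ y, ρ y ≠ 0 → f (x + y) ≤ c) : mol f ρ x ≤ c := by
  calc mol f ρ x ≤ ∫ y, ρ y * c := by
        refine integral_mono (mol_integrable hf hρ hρc x)
          ((hρ.continuous.integrable_of_hasCompactSupport hρc).mul_const c) fun y => ?_
        by_cases h0 : ρ y = 0
        · simp [h0]
        · exact mul_le_mul_of_nonneg_left (h y h0) (hρ0 y)
    _ = c := by rw [integral_mul_const, hρ1, one_mul]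

include hρr in
lemma le_mol (x : EC m) : f x ≤ mol f ρ x := by
  obtain ⟨M, hM⟩ := hf.bdd (‖x‖ + s)
  obtain ⟨h, hi⟩ := circled_mean (s := s) (M := M) hf.meas.stronglyMeasurable hρ.continuous hρc hρ0 hρs hρr x (fun y hy => by
    rw [Real.norm_eq_abs]; exact hM _ ((norm_add_le _ _).trans (by gcongr)))
  simp only [smul_eq_mul] at h hi
  have hpi := Real.pi_pos
  rw [mol, h]
  calc f x = ∫ y, ρ y * f x := by rw [integral_mul_const, hρ1, one_mul]
    _ ≤ _ := by
      refine integral_mono ((hρ.continuous.integrable_of_hasCompactSupport hρc).mul_const _) hi fun y => ?_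
      refine mul_le_mul_of_nonneg_left ?_ (hρ0 y)
      rw [le_inv_mul_iff₀ (by positivity)]
      exact hf.sub x y

omit hρ1 in
lemma mol_sub (x b : EC m) :
    2 * Real.pi * mol f ρ x ≤ ∫ θ in (0:ℝ)..(2 * Real.pi), mol f ρ (x + Complex.exp (θ * I) • b) := by
  have hpi := Real.pi_pos
  have hint : Integrable (fun p : ℝ × EC m => ρ p.2 * f (x + Complex.exp (p.1 * I) • b + p.2))
      ((volume.restrict (Ioc 0 (2 * Real.pi))).prod volume) := by
    obtain ⟨M, hM⟩ := hf.bdd (‖x‖ + ‖b‖ + s)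
    have hd : Integrable (fun p : ℝ × EC m => (1:ℝ) * (ρ p.2 * M))
      ((volume.restrict (Ioc 0 (2 * Real.pi))).prod volume) := by
      refine Integrable.mul_prod (f := fun _ : ℝ => (1:ℝ)) (g := fun y => ρ y * M) (integrable_const _) ?_
      exact (hρ.continuous.integrable_of_hasCompactSupport hρc).mul_const M
    refine hd.mono' ?_ (Eventually.of_forall fun p => ?_)
    · refine Measurable.aestronglyMeasurable ?_
      have : Continuous (fun p : ℝ × EC m => x + Complex.exp (p.1 * I) • b + p.2) := by fun_prop
      exact (hρ.continuous.measurable.comp measurable_snd).mul (hf.meas.comp this.measurable)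
    · rw [norm_mul, Real.norm_of_nonneg (hρ0 _), one_mul]
      by_cases h0 : ρ p.2 = 0
      · simp [h0]
      · gcongr
        · exact hρ0 _
        · apply hM
          refine (norm_add₃_le).trans ?_
          rw [norm_smul, Complex.norm_exp_ofReal_mul_I, one_mul]
          gcongr
          exact hρs _ h0
  have hint2 : Integrable (fun y => ∫ θ in Ioc (0:ℝ) (2 * Real.pi), ρ y * f (x + Complex.exp (θ * I) • b + y)) :=
    hint.integral_prod_right
  simp only [mol]
  rw [intervalIntegral.integral_of_le (by positivity), integral_integral_swap hint, ← integral_const_mul]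
  refine integral_mono ((mol_integrable hf hρ hρc x).const_mul _) hint2 fun y => ?_
  have := mul_le_mul_of_nonneg_left (hf.sub (x + y) b) (hρ0 y)
  rw [intervalIntegral.integral_of_le (by positivity), ← integral_const_mul] at this
  calc 2 * Real.pi * (ρ y * f (x + y)) = ρ y * (2 * Real.pi * f (x + y)) := by ring
    _ ≤ _ := this
    _ = _ := by
      simp only [add_right_comm]

end

lemma submean_levi {v : EC m → ℝ} (hv : ContDiff ℝ ∞ v)
    (hs : ∀ x b, 2 * Real.pi * v x ≤ ∫ θ in (0:ℝ)..(2 * Real.pi), v (x + Complex.exp (θ * I) • b)) (x h : EC m) :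
    0 ≤ D2 v x h h + D2 v x (I • h) (I • h) := by
  have hpi := Real.pi_pos
  by_contra hc
  push Not at hc
  by_cases hh0 : h = 0
  · simp [hh0, D2] at hc
  have hn : 0 < ‖h‖ := norm_pos_iff.2 hh0
  set Q := D2 v x h h + D2 v x (I • h) (I • h) with hQ
  -- error level
  obtain ⟨δ, hδ, ht⟩ := taylor2 hv x (ε := -Q / (8 * ‖h‖^2)) (by apply div_pos (by linarith) (by positivity))
  set t : ℝ := δ / (2 * ‖h‖) with htd
  have ht0 : 0 < t := by positivity
  have key : ∀ θ : ℝ, v (x + Complex.exp (θ * I) • (t • h)) ≤ v x +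
      (t * (fderiv ℝ v x h) * Real.cos θ + t * (fderiv ℝ v x (I • h)) * Real.sin θ) +
      (1/2) * t^2 * (D2 v x h h * Real.cos θ ^ 2 + 2 * D2 v x h (I • h) * (Real.sin θ * Real.cos θ) +
        D2 v x (I • h) (I • h) * Real.sin θ ^ 2) - Q * t^2 / 8 := by
    intro θ
    have e : Complex.exp (θ * I) • (t • h) = (t * Real.cos θ) • h + (t * Real.sin θ) • (I • h) := by
      rw [Complex.exp_mul_I, ← Complex.ofReal_cos, ← Complex.ofReal_sin, add_smul, mul_smul, smul_comm _ t,
        smul_comm _ t, mul_smul, mul_smul]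
      simp only [Complex.coe_smul]
      rw [smul_comm t (Real.sin θ)]
    have hnorm : ‖Complex.exp (θ * I) • (t • h)‖ = t * ‖h‖ := by
      rw [norm_smul, Complex.norm_exp_ofReal_mul_I, one_mul, norm_smul, Real.norm_of_nonneg ht0.le]
    have h1 := ht (Complex.exp (θ * I) • (t • h)) (by rw [hnorm, htd]; field_simp; linarith)
    rw [hnorm] at h1
    have h2 := (abs_le.1 h1).2
    have e3 : -Q / (8 * ‖h‖ ^ 2) * (t * ‖h‖) ^ 2 = - Q * t^2 / 8 := by field_simp
    rw [e3] at h2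
    have e4 : fderiv ℝ v x (Complex.exp (θ * I) • (t • h)) =
      t * (fderiv ℝ v x h) * Real.cos θ + t * (fderiv ℝ v x (I • h)) * Real.sin θ := by
      rw [e, map_add, map_smul, map_smul, smul_eq_mul, smul_eq_mul]; ring
    have e5 : D2 v x (Complex.exp (θ * I) • (t • h)) (Complex.exp (θ * I) • (t • h)) =
       t^2 * (D2 v x h h * Real.cos θ ^ 2 + 2 * D2 v x h (I • h) * (Real.sin θ * Real.cos θ) +
        D2 v x (I • h) (I • h) * Real.sin θ ^ 2) := by
      have sy := D2_symm hv x (I • h) h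
      rw [e]
      simp only [D2, map_add, map_smul, _root_.add_apply, smul_apply, smul_eq_mul] at sy ⊢
      rw [sy]; ring
    rw [e4, e5] at h2
    linarith
  have c1 : Continuous fun θ : ℝ => v (x + Complex.exp (θ * I) • (t • h)) :=
    hv.continuous.comp (by fun_prop)
  have hm := hs x (t • h)
  have hle := intervalIntegral.integral_mono_on (a := 0) (b := 2 * Real.pi) (μ := volume) (by positivity) (c1.intervalIntegrable _ _)
    (g := fun θ => v x +
      (t * (fderiv ℝ v x h) * Real.cos θ + t * (fderiv ℝ v x (I • h)) * Real.sin θ) +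
      (1/2) * t^2 * (D2 v x h h * Real.cos θ ^ 2 + 2 * D2 v x h (I • h) * (Real.sin θ * Real.cos θ) +
        D2 v x (I • h) (I • h) * Real.sin θ ^ 2) - Q * t^2 / 8)
    (Continuous.intervalIntegrable (by fun_prop) _ _) (fun θ _ => key θ)
  have hv : (∫ θ in (0:ℝ)..(2 * Real.pi), (v x +
      (t * (fderiv ℝ v x h) * Real.cos θ + t * (fderiv ℝ v x (I • h)) * Real.sin θ) +
      (1/2) * t^2 * (D2 v x h h * Real.cos θ ^ 2 + 2 * D2 v x h (I • h) * (Real.sin θ * Real.cos θ) +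
        D2 v x (I • h) (I • h) * Real.sin θ ^ 2) - Q * t^2 / 8)) =
      2 * Real.pi * v x + (1/2) * t^2 * (Q * Real.pi) - 2 * Real.pi * (Q * t^2 / 8) := by
    have ii : ∀ f : ℝ → ℝ, Continuous f → IntervalIntegrable f volume 0 (2 * Real.pi) := fun f hf => hf.intervalIntegrable _ _
    rw [intervalIntegral.integral_sub (ii _ (by fun_prop)) (ii _ (by fun_prop)),
      intervalIntegral.integral_add (ii _ (by fun_prop)) (ii _ (by fun_prop)),
      intervalIntegral.integral_add (ii _ (by fun_prop)) (ii _ (by fun_prop)),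
      intervalIntegral.integral_add (ii _ (by fun_prop)) (ii _ (by fun_prop)),
      intervalIntegral.integral_const_mul, intervalIntegral.integral_const_mul, intervalIntegral.integral_const_mul,
      intervalIntegral.integral_add (ii _ (by fun_prop)) (ii _ (by fun_prop)),
      intervalIntegral.integral_add (ii _ (by fun_prop)) (ii _ (by fun_prop)),
      intervalIntegral.integral_const_mul, intervalIntegral.integral_const_mul, intervalIntegral.integral_const_mul,
      integral_cos, integral_sin, integral_cos_sq, integral_sin_sq, integral_sin_mul_cos₁]
    simp [hQ]
    ring
  rw [hv] at hle
  have : Q * t^2 * Real.pi < 0 := by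
    have := mul_pos (mul_pos (neg_pos.2 hc) (pow_pos ht0 2)) hpi
    linarith
  linarith

end D2
end

section
section D3
variable {m : ℕ}

/-- real truncation -/
def tr (u : EC m → EReal) (N : ℝ) (x : EC m) : ℝ := (max (u x) (N : EReal)).toReal

lemma tr_coe {u : EC m → EReal} (hu : IsPSH u) (N : ℝ) (x : EC m) : ((tr u N x : ℝ) : EReal) = max (u x) N := by
  rw [tr, EReal.coe_toReal]
  · have := hu.2.2.1 x
    simp [max_eq_iff, this]
  · exact ne_bot_of_le_ne_bot (EReal.coe_ne_bot N) (le_max_right _ _)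

lemma N_le_tr {u : EC m → EReal} (hu : IsPSH u) (N : ℝ) (x : EC m) : N ≤ tr u N x := by
  rw [← EReal.coe_le_coe_iff, tr_coe hu]; exact le_max_right _ _

lemma ub {u : EC m → EReal} (hu : IsPSH u) (R : ℝ) : ∃ A : ℝ, ∀ x, ‖x‖ ≤ R → u x ≤ A := by
  by_cases hR : 0 ≤ R
  · have hc : IsCompact (closedBall (0 : EC m) R) := isCompact_closedBall _ _
    obtain ⟨z, hz, hmax⟩ := UpperSemicontinuousOn.exists_isMaxOn (f := u) (s := closedBall (0 : EC m) R) ⟨0, by simpa⟩ hc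
      (hu.1.upperSemicontinuousOn _)
    refine ⟨(u z).toReal, fun x hx => ?_⟩
    exact (hmax (a := x) (by simpa using hx)).trans (EReal.le_coe_toReal (hu.2.2.1 z))
  · exact ⟨0, fun x hx => absurd ((norm_nonneg x).trans hx) hR⟩

lemma tr_meas {u : EC m → EReal} (hu : IsPSH u) (N : ℝ) : Measurable (tr u N) := by
  exact (hu.1.measurable.max measurable_const).ereal_toReal

lemma e2e_coe (x : ℝ) : erealToENNReal (x : EReal) = ENNReal.ofReal x := by
  simp [erealToENNReal]

lemma e2e_mono {x y : EReal} (h : x ≤ y) : erealToENNReal x ≤ erealToENNReal y := by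
  unfold erealToENNReal
  split_ifs with h1 h2
  · simp
  · subst h1; exact absurd (top_le_iff.1 h) h2
  · simp
  · by_cases hx : x = ⊥
    · simp [hx]
    · exact ENNReal.ofReal_le_ofReal (EReal.toReal_le_toReal h hx (by assumption))

lemma e2e_max {x : EReal} {N : ℝ} (hN : N ≤ 0) : erealToENNReal (max x N) = erealToENNReal x := by
  rcases le_total x N with h | h
  · rw [max_eq_right h, e2e_coe, ENNReal.ofReal_of_nonpos hN]
    have := e2e_mono h
    rw [e2e_coe, ENNReal.ofReal_of_nonpos hN] at this
    exact (le_antisymm this bot_le).symm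
  · rw [max_eq_left h]

lemma ereal_int_le {u : EC m → EReal} (hu : IsPSH u) {N : ℝ} (hN : N ≤ 0) (g : ℝ → EC m) (μ : Measure ℝ)
    (hi : Integrable (fun θ => tr u N (g θ)) μ) :
    erealIntegral μ (fun θ => u (g θ)) ≤ ((∫ θ, tr u N (g θ) ∂μ : ℝ) : EReal) := by
  unfold erealIntegral
  rw [integral_eq_lintegral_pos_part_sub_lintegral_neg_part hi, EReal.coe_sub]
  have f1 : ∫⁻ θ, ENNReal.ofReal (tr u N (g θ)) ∂μ ≠ ⊤ := hi.lintegral_lt_top.ne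
  have f2 : ∫⁻ θ, ENNReal.ofReal (-tr u N (g θ)) ∂μ ≠ ⊤ := hi.neg.lintegral_lt_top.ne
  have e1 : ∀ θ, erealToENNReal (u (g θ)) = ENNReal.ofReal (tr u N (g θ)) := by
    intro θ
    rw [← e2e_coe, tr_coe hu, e2e_max hN]
  have e2 : ∀ θ, ENNReal.ofReal (-tr u N (g θ)) ≤ erealToENNReal (-(u (g θ))) := by
    intro θ
    rw [← e2e_coe, EReal.coe_neg, tr_coe hu]
    exact e2e_mono (EReal.neg_le_neg_iff.2 (le_max_left _ _))
  simp only [e1]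
  rw [EReal.coe_ennreal_toReal f1, EReal.coe_ennreal_toReal f2]
  refine EReal.sub_le_sub ?_ ?_
  · exact le_rfl
  · exact_mod_cast lintegral_mono e2

lemma tr_bdd {u : EC m → EReal} (hu : IsPSH u) (N : ℝ) (R : ℝ) : ∃ M, ∀ x, ‖x‖ ≤ R → |tr u N x| ≤ M := by
  obtain ⟨A, hA⟩ := ub hu R
  refine ⟨|A| + |N|, fun x hx => ?_⟩
  have h1 := N_le_tr hu N x
  have h2 : tr u N x ≤ max A N := by
    rw [← EReal.coe_le_coe_iff, tr_coe hu, EReal.coe_strictMono.monotone.map_max]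
    exact max_le_max (hA x hx) le_rfl
  rw [abs_le]
  constructor
  · linarith [neg_abs_le N, abs_nonneg A]
  · refine h2.trans (max_le ?_ ?_)
    · linarith [le_abs_self A, abs_nonneg N]
    · linarith [le_abs_self N, abs_nonneg A]

lemma tr_int {u : EC m → EReal} (hu : IsPSH u) (N : ℝ) (x b : EC m) :
    IntervalIntegrable (fun θ : ℝ => tr u N (x + Complex.exp (θ * I) • b)) volume 0 (2 * Real.pi) := by
  obtain ⟨M, hM⟩ := tr_bdd hu N (‖x‖ + ‖b‖)
  have : IntervalIntegrable (fun _ : ℝ => M) volume 0 (2 * Real.pi) := by simp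
  refine this.mono_fun' ?_ (Eventually.of_forall fun θ => ?_)
  · have : Continuous (fun θ : ℝ => x + Complex.exp (θ * I) • b) := by fun_prop
    exact ((tr_meas hu N).comp this.measurable).aestronglyMeasurable
  · apply hM
    refine (norm_add_le _ _).trans ?_
    rw [norm_smul, Complex.norm_exp_ofReal_mul_I, one_mul]

lemma tr_sub {u : EC m → EReal} (hu : IsPSH u) {N : ℝ} (hN : N ≤ 0) : SubM (tr u N) := by
  refine ⟨tr_meas hu N, tr_bdd hu N, fun x b => ?_⟩
  have hpi := Real.pi_pos
  have hint := tr_int hu N x b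
  have h1 : N ≤ (2 * Real.pi)⁻¹ * ∫ θ in (0:ℝ)..(2 * Real.pi), tr u N (x + Complex.exp (θ * I) • b) := by
    rw [le_inv_mul_iff₀ (by positivity)]
    have := intervalIntegral.integral_mono_on (a := 0) (b := 2 * Real.pi) (by positivity)
      (f := fun _ => N) (by simp) hint (fun θ _ => N_le_tr hu N _)
    simpa using this
  have h2 : u x ≤ (((2 * Real.pi)⁻¹ * ∫ θ in (0:ℝ)..(2 * Real.pi), tr u N (x + Complex.exp (θ * I) • b) : ℝ) : EReal) := by
    refine (hu.2.2.2 x b 1 one_pos).trans ?_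
    unfold circleLineMean
    rw [EReal.coe_mul]
    refine mul_le_mul_of_nonneg_left ?_ (by exact_mod_cast (by positivity))
    rw [intervalIntegral.integral_of_le (by positivity)]
    simp only [Complex.ofReal_one, one_mul]
    refine ereal_int_le hu hN (fun θ : ℝ => x + Complex.exp (θ * I) • b) _ ?_
    exact (intervalIntegrable_iff_integrableOn_Ioc_of_le (by positivity)).1 hint
  rw [← le_inv_mul_iff₀ (by positivity), ← EReal.coe_le_coe_iff, tr_coe hu]
  exact max_le h2 (by exact_mod_cast h1)

lemma SubM.affine {f : EC m → ℝ} (hf : SubM f) {ε : ℝ} (hε : 0 ≤ ε) (A : ℝ) : SubM (fun x => ε * (f x - A)) := by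
  refine ⟨(hf.meas.sub_const A).const_mul ε, fun R => ?_, fun x b => ?_⟩
  · obtain ⟨M, hM⟩ := hf.bdd R
    refine ⟨ε * (M + |A|), fun x hx => ?_⟩
    rw [abs_mul, abs_of_nonneg hε]
    gcongr
    refine (abs_sub _ _).trans ?_
    gcongr; exact hM x hx
  · rw [intervalIntegral.integral_const_mul, intervalIntegral.integral_sub (hf.circ_int x b) (by simp)]
    have := mul_le_mul_of_nonneg_left (hf.sub x b) hε
    simp
    linarith

theorem exists_psh_smooth {u : EC m → EReal} (hu : IsPSH u) {a : EC m} (ha : u a ≠ ⊥) {K : Set (EC m)}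
    (hK : IsCompact K) (hKu : ∀ x ∈ K, u x = ⊥) {L R δ : ℝ} (hL : 0 < L) (hR : 0 < R) (hδ : 0 < δ)
    (haR : ‖a‖ ≤ R) :
    ∃ v : EC m → ℝ, ContDiff ℝ ∞ v ∧ (∀ x h, 0 ≤ D2 v x h h + D2 v x (I • h) (I • h)) ∧
      (∀ x, ‖x‖ ≤ R → v x ≤ 0) ∧ (∃ s > 0, ∀ x ∈ K, ∀ y, ‖y - x‖ ≤ s → v y ≤ -L) ∧ -δ ≤ v a := by
  obtain ⟨A, hA⟩ := ub hu (R + 1)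
  have hat := hu.2.2.1 a
  obtain ⟨α, hα⟩ : ∃ α : ℝ, u a = α := ⟨(u a).toReal, (EReal.coe_toReal hat ha).symm⟩
  have hαA : α ≤ A := by
    have := hA a (by linarith)
    rw [hα] at this; exact_mod_cast this
  set ε := δ / (A - α + 1) with hε
  have hε0 : 0 < ε := div_pos hδ (by linarith)
  set N := min 0 (A - L / ε) with hN
  have hN0 : N ≤ 0 := min_le_left _ _
  have hNA : N ≤ A := (min_le_right _ _).trans (by have := div_pos hL hε0; linarith)
  have hNL : ε * (N - A) ≤ -L := by
    have h1 : N - A ≤ -(L / ε) := by have := min_le_right 0 (A - L/ε); linarith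
    calc ε * (N - A) ≤ ε * (-(L / ε)) := by gcongr
      _ = -L := by field_simp
  have hv0 := (tr_sub hu hN0).affine hε0.le A
  have hopen : IsOpen {x | u x < (N : EReal)} := hu.1.isOpen_preimage N
  obtain ⟨s0, hs0, hth⟩ := hK.exists_thickening_subset_open hopen (fun x hx => by
    show u x < N
    rw [hKu x hx]; exact EReal.bot_lt_coe N)
  set s := min (s0 / 3) 1 with hs
  have hsp : 0 < s := lt_min (by linarith) one_pos
  obtain ⟨ρ, -, hρ, hρc, hρ0, hρ1, hρs, hρr, hρn⟩ := exists_mollifier m hsp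
  refine ⟨mol (fun x => ε * (tr u N x - A)) ρ, mol_smooth hv0 hρ hρc hρn,
    submean_levi (mol_smooth hv0 hρ hρc hρn) (mol_sub hv0 hρ hρc hρ0 hρs), ?_, ⟨s, hsp, ?_⟩, ?_⟩
  · intro x hx
    refine mol_le hv0 hρ hρc hρ0 hρ1 fun y hy => ?_
    have hy' := hρs y hy
    have h1 : tr u N (x + y) ≤ A := by
      rw [← EReal.coe_le_coe_iff, tr_coe hu]
      refine max_le (hA _ ?_) (by exact_mod_cast hNA)
      refine (norm_add_le _ _).trans (add_le_add hx (hy'.trans (min_le_right _ _)))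
    exact mul_nonpos_of_nonneg_of_nonpos hε0.le (by linarith)
  · intro x hx y hyx
    refine mol_le hv0 hρ hρc hρ0 hρ1 fun z hz => ?_
    have hz' := hρs z hz
    have hmem : y + z ∈ {x | u x < (N : EReal)} := by
      apply hth
      rw [Metric.mem_thickening_iff]
      refine ⟨x, hx, ?_⟩
      rw [dist_eq_norm]
      calc ‖y + z - x‖ = ‖(y - x) + z‖ := by congr 1; abel
        _ ≤ s + s := (norm_add_le _ _).trans (add_le_add hyx hz')
        _ < s0 := by have := min_le_left (s0/3) 1; linarith
    have h1 : tr u N (y + z) = N := by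
      have := tr_coe hu N (y + z)
      rw [max_eq_right (le_of_lt hmem)] at this
      exact_mod_cast this
    simp only [h1]; exact hNL
  · refine le_trans ?_ (le_mol hv0 hρ hρc hρ0 hρ1 hρs hρr a)
    have h1 : α ≤ tr u N a := by
      rw [← EReal.coe_le_coe_iff, tr_coe hu, ← hα]; exact le_max_left _ _
    have h2 : ε * (A - α + 1) = δ := by rw [hε]; exact div_mul_cancel₀ _ (by linarith : (0:ℝ) < A - α + 1).ne'
    nlinarith [mul_le_mul_of_nonneg_left h1 hε0.le]
end D3
end

section
section E1
variable {m : ℕ}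

structure Hol (f : EC m → ℂ) : Prop where
  smooth : ContDiff ℝ ∞ f
  dzb : ∀ j x, dzb j f x = 0

lemma Hol.fderiv_I {f : EC m → ℂ} (hf : Hol f) (x h : EC m) : fderiv ℝ f x (I • h) = I * fderiv ℝ f x h := by
  have hb : ∀ j, fderiv ℝ f x (I • ee j) = I * fderiv ℝ f x (ee j) := by
    intro j
    have := hf.dzb j x
    simp only [_root_.dzb, dv] at this
    linear_combination (-2 * I) * this + (fderiv ℝ f x (I • ee j)) * Complex.I_mul_I
  have eh : h = ∑ j, ((h j).re • ee j + (h j).im • (I • ee j : EC m)) := by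
    ext i
    simp only [ee, WithLp.ofLp_sum, Finset.sum_apply, PiLp.add_apply, PiLp.smul_apply, PiLp.single_apply]
    rw [Finset.sum_eq_single i]
    · simp
    · intro j _ hj; simp [hj.symm]
    · simp
  have ehI : I • h = ∑ j, ((-(h j).im) • ee j + (h j).re • (I • ee j : EC m)) := by
    conv_lhs => rw [eh]
    rw [Finset.smul_sum]
    refine Finset.sum_congr rfl fun j _ => ?_
    rw [smul_add, smul_comm I, smul_comm I (h j).im, smul_smul I I, Complex.I_mul_I]
    simp [add_comm]
  rw [ehI]
  conv_rhs => rw [eh]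
  simp only [map_sum, map_add, map_smul, hb, Complex.real_smul]
  rw [Finset.mul_sum]
  refine Finset.sum_congr rfl fun j _ => ?_
  push_cast
  linear_combination (-(h j).im * fderiv ℝ f x (ee j)) * Complex.I_mul_I

lemma Hol.diff {f : EC m → ℂ} (hf : Hol f) : Differentiable ℂ f := by
  intro x
  have hd := (smooth_diff hf.smooth x).hasFDerivAt
  let g : EC m →L[ℂ] ℂ :=
    { toFun := fun h => fderiv ℝ f x h
      map_add' := map_add _
      map_smul' := fun c h => by
        rw [← Complex.re_add_im c]
        simp only [add_smul, mul_smul, map_add, Complex.coe_smul, map_smul, hf.fderiv_I, RingHom.id_apply,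
          Complex.real_smul, smul_eq_mul]
        ring
      cont := (fderiv ℝ f x).continuous }
  exact ((hasFDerivAt_of_restrictScalars ℝ (f' := g) hd (by ext h; rfl)).differentiableAt)

lemma Hol.of_fderiv {f : EC m → ℂ} (hs : ContDiff ℝ ∞ f) (h : ∀ x h, fderiv ℝ f x (I • h) = I * fderiv ℝ f x h) : Hol f :=
  ⟨hs, fun j x => by
    simp only [_root_.dzb, dv, h]
    linear_combination (1/2 * fderiv ℝ f x (ee j)) * Complex.I_mul_I⟩

lemma dv_exp {f : EC m → ℂ} (hf : ContDiff ℝ ∞ f) (h x : EC m) :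
    dv h (fun y => Complex.exp (f y)) x = Complex.exp (f x) * dv h f x := by
  unfold dv
  rw [(smooth_diff hf x).hasFDerivAt.cexp.fderiv]; simp

lemma dzb_exp {f : EC m → ℂ} (hf : ContDiff ℝ ∞ f) (j : Fin m) (x : EC m) :
    dzb j (fun y => Complex.exp (f y)) x = Complex.exp (f x) * dzb j f x := by
  simp only [dzb, dv_exp hf]; ring

lemma Hol.exp_mul {f : EC m → ℂ} (hf : Hol f) (c : ℂ) : Hol (fun x => Complex.exp (c * f x)) := by
  refine ⟨(contDiff_const.mul hf.smooth).cexp, fun j x => ?_⟩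
  rw [dzb_exp (contDiff_const.mul hf.smooth)]
  have : _root_.dzb j (fun y => c * f y) x = c * _root_.dzb j f x := by
    simp only [_root_.dzb, dv_cmul hf.smooth]; ring
  rw [this, hf.dzb]; simp

lemma hol_mean {f : EC m → ℂ} (hf : Hol f) (a b : EC m) :
    (2 * Real.pi)⁻¹ • ∫ θ in (0:ℝ)..(2 * Real.pi), f (a + Complex.exp (θ * I) • b) = f a := by
  have hd : Differentiable ℂ (fun ζ : ℂ => f (a + ζ • b)) := hf.diff.comp (by fun_prop)
  have := DiffContOnCl.circleAverage (f := fun ζ : ℂ => f (a + ζ • b)) (c := 0) (R := 1) hd.diffContOnCl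
  simpa [Real.circleAverage, circleMap] using this

theorem exists_q {w : EC m → ℝ} (hw : ContDiff ℝ ∞ w) {c : ℝ} (hc : 0 < c)
    (hL : ∀ x h, c * ‖h‖ ^ 2 ≤ (1/4) * (D2 w x h h + D2 w x (I • h) (I • h))) (a : EC m) :
    ∃ q : EC m → ℂ, Hol q ∧ q a = w a ∧ ∃ δ > 0, ∀ z, ‖z - a‖ < δ → (q z).re ≤ w z - (c/2) * ‖z - a‖ ^ 2 := by
  let J : EC m →L[ℝ] EC m := (I • ContinuousLinearMap.id ℂ (EC m)).restrictScalars ℝ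
  have hJ : ∀ h, J h = I • h := fun h => rfl
  let l : EC m →L[ℝ] ℝ := fderiv ℝ w a
  let B : EC m →L[ℝ] EC m →L[ℝ] ℝ := fderiv ℝ (fderiv ℝ w) a
  have hB : ∀ h k, B h k = B k h := D2_symm hw a
  let q : EC m → ℂ := fun z => (w a : ℂ) + ((l (z - a) : ℝ) - I * (l (J (z - a)) : ℝ)) +
    (1/4) * ((B (z - a) (z - a) : ℝ) - (B (J (z - a)) (J (z - a)) : ℝ) - 2 * I * (B (z - a) (J (z - a)) : ℝ))
  have co : ∀ {g : EC m → ℝ}, ContDiff ℝ ∞ g → ContDiff ℝ ∞ (fun x => (g x : ℂ)) := fun hg => Complex.ofRealCLM.contDiff.comp hg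
  have hs : ContDiff ℝ ∞ (fun z : EC m => z - a) := contDiff_id.sub contDiff_const
  have hJs : ContDiff ℝ ∞ (fun z : EC m => J (z - a)) := J.contDiff.comp hs
  have hq : ContDiff ℝ ∞ q := by
    refine (contDiff_const.add ((co (l.contDiff.comp hs)).sub (contDiff_const.mul (co (l.contDiff.comp hJs))))).add
      (contDiff_const.mul (((co ?_).sub (co ?_)).sub (contDiff_const.mul (co ?_))))
    · exact (B.contDiff.comp hs).clm_apply hs
    · exact (B.contDiff.comp hJs).clm_apply hJs
    · exact (B.contDiff.comp hs).clm_apply hJs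
  have hfd : ∀ z k, fderiv ℝ q z k = ((l k : ℝ) - I * (l (J k) : ℝ)) + (1/2) * ((B (z - a) k : ℝ) -
      (B (J (z - a)) (J k) : ℝ) - I * ((B (z - a) (J k) : ℝ) + (B (J (z - a)) k : ℝ))) := by
    intro z k
    have s0 : HasFDerivAt (fun z : EC m => z - a) (ContinuousLinearMap.id ℝ (EC m)) z := (hasFDerivAt_id z).sub_const a
    have s1 : HasFDerivAt (fun z : EC m => J (z - a)) J z := J.hasFDerivAt.comp z s0
    have cc : ∀ {g : EC m → ℝ} {g' : EC m →L[ℝ] ℝ}, HasFDerivAt g g' z →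
      HasFDerivAt (fun x => (g x : ℂ)) (Complex.ofRealCLM.comp g') z := fun hg => Complex.ofRealCLM.hasFDerivAt.comp z hg
    have t1 := cc (l.hasFDerivAt.comp z s0)
    have t2 := cc (l.hasFDerivAt.comp z s1)
    have t3 := cc ((B.hasFDerivAt.comp z s0).clm_apply s0)
    have t4 := cc ((B.hasFDerivAt.comp z s1).clm_apply s1)
    have t5 := cc ((B.hasFDerivAt.comp z s0).clm_apply s1)
    have tot := ((t1.sub (t2.const_mul I)).const_add (w a : ℂ)).add (((t3.sub t4).sub (t5.const_mul (2 * I))).const_mul (1/4 : ℂ))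
    have tot' : HasFDerivAt q _ z := tot
    rw [tot'.fderiv]
    have b1 := hB k (z - a)
    have b2 := hB (J k) (J (z - a))
    have b3 := hB k (J (z - a))
    simp [-map_sub] 
    rw [b1, b2, b3]
    ring
  refine ⟨q, Hol.of_fderiv hq fun z k => ?_, by simp [q], ?_⟩
  · rw [hfd, hfd]
    have hJJ : J (I • k) = - k := by rw [hJ, smul_smul, Complex.I_mul_I, neg_one_smul]
    rw [hJJ, ← hJ k]
    simp only [map_neg]
    push_cast
    linear_combination ((l (J k) : ℂ) +(1/2) * ((B (z - a) (J k) : ℝ) + (B (J (z - a)) k : ℝ))) * Complex.I_mul_I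
  · obtain ⟨δ, hδ, ht⟩ := taylor2 hw a (ε := c/2) (by positivity)
    refine ⟨δ, hδ, fun z hz => ?_⟩
    have h1 := (abs_le.1 (ht (z - a) hz)).1
    rw [add_sub_cancel] at h1
    have h2 := hL a (z - a)
    have h3 : (q z).re = w a + l (z - a) + (1/4) * (B (z - a) (z - a) - B (J (z - a)) (J (z - a))) := by
      simp [q, -map_sub]
    rw [h3]
    simp only [D2, ← hJ] at h1 h2
    simp only [l, B]
    linarith

end E1
end

section
section E2
variable {m : ℕ}

/-- weak holomorphy of the corrected function -/
lemma weak_hol {V : EC m → ℝ} (hV : ContDiff ℝ ∞ V) {χ p : EC m → ℂ} (hχ : IsTest χ) (hp : Hol p)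
    {U : EC m → ℂ} (hU : MemLp U 2)
    (hs : ∀ j ψ, IsTest ψ → ∫ x, U x * conj (Dd V j ψ x) = ∫ x, (dzb j χ x * (p x * Complex.exp (-(V x : ℂ)))) * conj (ψ x))
    {τ : EC m → ℂ} (hτ : IsTest τ) (j : Fin m) :
    ∫ x, (χ x * p x - Complex.exp (V x) * U x) * dzb j τ x = 0 := by
  have hVc := smooth_Vc hV
  have hE : ContDiff ℝ ∞ (fun x => Complex.exp (Vc V x)) := hVc.cexp
  have hψ : IsTest (fun x => Complex.exp (Vc V x) * τ x) := hτ.smooth_mul hE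
  have h1 := hs j _ hψ.star
  have hDd : ∀ x, conj (Dd V j (fun x => conj (Complex.exp (Vc V x) * τ x)) x) = - (Complex.exp (V x) * dzb j τ x) := by
    intro x
    simp only [Dd]
    rw [dz_conj hψ.smooth, map_add, map_neg, conj_conj, map_mul, conj_conj, conj_dz_Vc hV, dzb_mul hE hτ.smooth, dzb_exp hVc]
    simp only [Vc]; ring
  simp only [hDd, conj_conj] at h1
  have hχp : IsTest (fun x => χ x * p x) := hχ.mul_smooth hp.smooth
  have h2 := ibp_dzb hχp hτ.smooth j
  have h3 : ∀ x, dzb j (fun x => χ x * p x) x = dzb j χ x * p x := by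
    intro x; rw [dzb_mul hχ.smooth hp.smooth, hp.dzb]; simp
  simp only [h3] at h2
  have i1 : Integrable (fun x => χ x * p x * dzb j τ x) := (hχp.mul_smooth (smooth_dzb hτ.smooth j)).integrable
  have i2 : Integrable (fun x => U x * (Complex.exp (V x) * dzb j τ x)) := by
    have := ((hτ.dzb j).smooth_mul hE).memLp
    exact hU.integrable_mul this
  have e1 : ∀ x, (χ x * p x - Complex.exp (V x) * U x) * dzb j τ x = χ x * p x * dzb j τ x - U x * (Complex.exp (V x) * dzb j τ x) := by
    intro x; ring
  simp only [e1]
  rw [integral_sub i1 i2]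
  simp only [mul_neg, integral_neg] at h1
  have e2 : ∫ x, dzb j χ x * (p x * Complex.exp (-(V x : ℂ))) * (Complex.exp (Vc V x) * τ x) = ∫ x, dzb j χ x * p x * τ x := by
    congr 1; ext x
    have : Complex.exp (-(V x : ℂ)) * Complex.exp (Vc V x) = 1 := by
      rw [← Complex.exp_add]; simp [Vc]
    linear_combination (dzb j χ x * p x * τ x) * this
  rw [e2, h2] at h1
  have h1' := neg_inj.1 h1
  rw [h1', sub_self]

lemma locInt_of_memLp {U : EC m → ℂ} (hU : MemLp U 2) : LocallyIntegrable U :=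
  hU.locallyIntegrable (by norm_num)

lemma U_bound {U : EC m → ℂ} (hU : MemLp U 2) {ρ : EC m → ℝ} (hρ : IsTest (Vc ρ)) (hρ0 : ∀ x, 0 ≤ ρ x) (x : EC m)
    {g : EC m → ℂ} {M t : ℝ} (hM0 : 0 ≤ M) (ht : 0 < t)
    (hM : ∀ y, ρ (x - y) ≠ 0 → ‖g y‖ ≤ M) :
    ‖∫ y, g y * U y * ρ (x - y)‖ ≤ M * ((t * (∫ y, ‖U y‖ ^ 2) + t⁻¹ * ∫ y, ρ y ^ 2) / 2) := by
  have hρ2 : Integrable (fun y => ρ y ^ 2) := by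
    have := hρ.memLp.integrable_norm_pow (by norm_num : (2:ℕ) ≠ 0)
    simpa [Vc] using this
  have hρ3 : Integrable (fun y => ρ (x - y) ^ 2) := hρ2.comp_sub_left x
  have hU2 : Integrable (fun y => ‖U y‖ ^ 2) := hU.integrable_norm_pow (by norm_num : (2:ℕ) ≠ 0)
  calc _ ≤ ∫ y, M * ((t * ‖U y‖ ^ 2 + t⁻¹ * ρ (x - y) ^ 2) / 2) := by
        refine norm_integral_le_of_norm_le ((((hU2.const_mul t).add (hρ3.const_mul t⁻¹)).div_const 2).const_mul M) (Eventually.of_forall fun y => ?_)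
        by_cases h0 : ρ (x - y) = 0
        · simp only [h0, Complex.ofReal_zero, mul_zero, norm_zero]; positivity
        · rw [norm_mul, norm_mul, mul_assoc]
          gcongr
          · exact hM y h0
          · simp only [Complex.norm_real, Real.norm_eq_abs, abs_of_nonneg (hρ0 _)]
            rw [inv_mul_eq_div, add_div' _ _ _ ht.ne', div_div, le_div_iff₀ (by positivity)]
            nlinarith [sq_nonneg (t * ‖U y‖ - ρ (x - y))]
    _ = _ := by
        rw [integral_const_mul, integral_div, integral_add (hU2.const_mul t) (hρ3.const_mul t⁻¹), integral_const_mul,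
          integral_const_mul, integral_sub_left_eq_self (fun y => ρ y ^ 2) volume x]

end E2
end

section
section E3
variable {m : ℕ}

lemma dzb_congr {f g : EC m → ℂ} {x : EC m} (h : f =ᶠ[nhds x] g) (j : Fin m) : dzb j f x = dzb j g x := by
  simp only [dzb, dv, h.fderiv_eq]

lemma exists_cutoff_at (a : EC m) {r : ℝ} (hr : 0 < r) : ∃ C ≥ 0, ∃ χ : EC m → ℝ, IsTest (Vc χ) ∧ (∀ x, 0 ≤ χ x) ∧
    (∀ x, χ x ≤ 1) ∧ (∀ x, ‖x - a‖ ≤ r → χ x = 1) ∧ (∀ x, χ x ≠ 0 → ‖x - a‖ ≤ 2 * r) ∧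
    ∀ j x, ‖dzb j (Vc χ) x‖ ≤ C ∧ (dzb j (Vc χ) x ≠ 0 → r ≤ ‖x - a‖ ∧ ‖x - a‖ ≤ 2 * r) := by
  obtain ⟨C, hC, h⟩ := exists_cutoff m
  obtain ⟨χ, h1, h2, h3, h4, h5, h6, h7⟩ := h r hr
  have e : Vc (fun y => χ (a - y)) = fun y => Vc χ (a - y) := rfl
  have hone : ∀ x, ‖x - a‖ ≤ r → χ (a - x) = 1 := fun x hx => h4 _ (by rwa [norm_sub_rev])
  have hsup : ∀ x, χ (a - x) ≠ 0 → ‖x - a‖ ≤ 2 * r := fun x hx => by rw [norm_sub_rev]; exact h5 _ hx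
  refine ⟨C / r, by positivity, fun y => χ (a - y), ?_, fun x => h2 _, fun x => h3 _, hone, hsup, fun j x => ⟨?_, fun hne => ⟨?_, ?_⟩⟩⟩
  · rw [e]; exact h1.transl a
  · rw [e, dzb_transl h1.smooth, norm_neg]; exact h7 _ _
  · by_contra hc
    push Not at hc
    apply hne
    have : Vc (fun y => χ (a - y)) =ᶠ[nhds x] fun _ => 1 := by
      have ho : IsOpen {y : EC m | ‖y - a‖ < r} := isOpen_lt (by fun_prop) continuous_const
      filter_upwards [ho.mem_nhds hc] with y hy
      simp [Vc, hone y (le_of_lt hy)]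
    rw [dzb_congr this]; simp [dzb, dv]
  · by_contra hc
    push Not at hc
    apply hne
    have : Vc (fun y => χ (a - y)) =ᶠ[nhds x] fun _ => 0 := by
      have ho : IsOpen {y : EC m | 2 * r < ‖y - a‖} := isOpen_lt continuous_const (by fun_prop)
      filter_upwards [ho.mem_nhds hc] with y hy
      have : χ (a - y) = 0 := by
        by_contra h0; exact absurd (hsup y h0) (not_le.2 hy)
      simp [Vc, this]
    rw [dzb_congr this]; simp [dzb, dv]

lemma D2_smul {w : EC m → ℝ} (hw : ContDiff ℝ ∞ w) (k : ℝ) (x h h' : EC m) :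
    D2 (fun x => k * w x) x h h' = k * D2 w x h h' := by
  have e : fderiv ℝ (fun x => k * w x) = fun x => k • fderiv ℝ w x := by
    ext x : 1
    exact fderiv_const_mul (hw.differentiable (by simp) x) k
  simp only [D2]
  rw [e, fderiv_fun_const_smul ((fderiv_smooth hw).differentiable (by simp) x)]
  simp

lemma solve_at {w : EC m → ℝ} (hw : ContDiff ℝ ∞ w) {c : ℝ} (hc : 0 < c)
    (hL : ∀ x h, c * ‖h‖ ^ 2 ≤ (1/4) * (D2 w x h h + D2 w x (I • h) (I • h))) {a : EC m} {q : EC m → ℂ} (hq : Hol q)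
    {r C : ℝ} (hr : 0 < r)
    (hqw : ∀ z, ‖z - a‖ ≤ 2 * r → (q z).re ≤ w z - (c/2) * ‖z - a‖ ^ 2)
    {χ : EC m → ℝ} (hχ : IsTest (Vc χ))
    (hd : ∀ j x, ‖dzb j (Vc χ) x‖ ≤ C ∧ (dzb j (Vc χ) x ≠ 0 → r ≤ ‖x - a‖ ∧ ‖x - a‖ ≤ 2 * r))
    {k : ℕ} (hk : 1 ≤ k) :
    ∃ U : EC m → ℂ, MemLp U 2 ∧ (∀ j ψ, IsTest ψ → ∫ x, U x * conj (Dd (fun x => k * w x) j ψ x) =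
      ∫ x, (dzb j (Vc χ) x * (Complex.exp (k * q x) * Complex.exp (-((k * w x : ℝ) : ℂ)))) * conj (ψ x)) ∧
      ∫ x, ‖U x‖ ^ 2 ≤ (m * (C ^ 2 * volume.real (closedBall a (2 * r)))) / c * Real.exp (-(2 * (k * (c/2 * r^2)))) := by
  have hk0 : (0:ℝ) < k := by exact_mod_cast hk
  set V : EC m → ℝ := fun x => k * w x with hVd
  have hV : ContDiff ℝ ∞ V := contDiff_const.mul hw
  have hp := hq.exp_mul k
  have hVc := smooth_Vc hV
  have hEn : ContDiff ℝ ∞ (fun x => Complex.exp (-(Vc V x))) := hVc.neg.cexp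
  have hpE : ContDiff ℝ ∞ (fun x => Complex.exp (k * q x) * Complex.exp (-(Vc V x))) := hp.smooth.mul hEn
  have hg : IsTest (fun x => Vc χ x * (Complex.exp (k * q x) * Complex.exp (-(Vc V x)))) := hχ.mul_smooth hpE
  have hDb : ∀ j x, Db V j (fun x => Vc χ x * (Complex.exp (k * q x) * Complex.exp (-(Vc V x)))) x =
      dzb j (Vc χ) x * (Complex.exp (k * q x) * Complex.exp (-((V x : ℝ) : ℂ))) := by
    intro j x
    simp only [Db]
    rw [dzb_mul hχ.smooth hpE, dzb_mul hp.smooth hEn, hp.dzb, dzb_exp hVc.neg, dzb_neg]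
    simp only [Vc]; ring
  obtain ⟨U, hU, hU1, hU2⟩ := solve (c := k * c) hV (by positivity) (fun x t => by
    rw [levi_real hV, hVd, D2_smul hw, D2_smul hw]
    have := mul_le_mul_of_nonneg_left (hL x (WithLp.toLp 2 t)) hk0.le
    rw [EuclideanSpace.norm_sq_eq] at this
    simp only at this
    linarith) hg
  simp only [hDb] at hU1 hU2
  refine ⟨U, hU, hU1, ?_⟩
  have hb : ∀ j, ∫ x, ‖dzb j (Vc χ) x * (Complex.exp (k * q x) * Complex.exp (-((V x : ℝ) : ℂ)))‖ ^ 2 ≤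
      (C ^ 2 * volume.real (closedBall a (2 * r))) * Real.exp (-(2 * (k * (c/2 * r^2)))) := by
    intro j
    calc _ ≤ ∫ x, (closedBall a (2 * r)).indicator (fun _ => C ^ 2 * Real.exp (-(2 * (k * (c/2 * r^2))))) x := by
          refine integral_mono_of_nonneg (Eventually.of_forall fun x => by positivity) ?_ (Eventually.of_forall fun x => ?_)
          · rw [integrable_indicator_iff measurableSet_closedBall]
            exact integrableOn_const (isCompact_closedBall _ _).measure_lt_top.ne
          · simp only
            obtain ⟨h1, h2⟩ := hd j x
            by_cases h0 : dzb j (Vc χ) x = 0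
            · rw [h0]; simp only [zero_mul, norm_zero]
              refine (by norm_num : (0:ℝ)^2 ≤ 0).trans (indicator_nonneg (fun _ _ => by positivity) _)
            · obtain ⟨h3, h4⟩ := h2 h0
              rw [indicator_of_mem (by simpa [dist_eq_norm] using h4)]
              have h5 : ‖Complex.exp (k * q x) * Complex.exp (-((V x : ℝ) : ℂ))‖ ≤ Real.exp (-(k * (c/2 * r^2))) := by
                rw [← Complex.exp_add, Complex.norm_exp]
                apply Real.exp_le_exp.2
                have h6 := hqw x h4
                have h7 : r ^ 2 ≤ ‖x - a‖ ^ 2 := by gcongr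
                have h8 : (k * q x + -((V x : ℝ) : ℂ)).re = k * ((q x).re - w x) := by
                  simp [hVd]; ring
                rw [h8]
                nlinarith [mul_le_mul_of_nonneg_left h7 (by positivity : 0 ≤ c/2)]
              calc ‖dzb j (Vc χ) x * (Complex.exp (k * q x) * Complex.exp (-((V x : ℝ) : ℂ)))‖ ^ 2
                  ≤ (C * Real.exp (-(k * (c/2 * r^2)))) ^ 2 := by
                    rw [norm_mul]
                    gcongr
                    exact (norm_nonneg _).trans h1
                _ = _ := by rw [mul_pow, ← Real.exp_nat_mul]; congr 2; push_cast; ring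
      _ = _ := by
          rw [integral_indicator measurableSet_closedBall, setIntegral_const, smul_eq_mul]; ring
  have hsum := hU2.trans (Finset.sum_le_sum fun j _ => hb j)
  rw [Finset.sum_const, Finset.card_univ, Fintype.card_fin, nsmul_eq_mul] at hsum
  have hUn : 0 ≤ ∫ x, ‖U x‖ ^ 2 := integral_nonneg fun _ => by positivity
  rw [div_mul_eq_mul_div, le_div_iff₀ hc]
  have hk1 : (1:ℝ) ≤ k := by exact_mod_cast hk
  calc (∫ x, ‖U x‖ ^ 2) * c ≤ k * c * ∫ x, ‖U x‖ ^ 2 := by nlinarith [mul_nonneg hUn hc.le]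
    _ ≤ _ := hsum
    _ = _ := by ring

end E3
end

section
section E4
variable {m : ℕ}

theorem exists_holo {w : EC m → ℝ} (hw : ContDiff ℝ ∞ w) {c : ℝ} (hc : 0 < c)
    (hL : ∀ x h, c * ‖h‖ ^ 2 ≤ (1/4) * (D2 w x h h + D2 w x (I • h) (I • h))) (a : EC m) :
    ∃ s0 > 0, ∀ s, 0 < s → s ≤ s0 → ∃ C > 0, ∃ κ > 0, ∀ k : ℕ, 1 ≤ k → ∃ F : EC m → ℂ, Hol F ∧
      (∀ x N, (∀ y, ‖y - x‖ ≤ s → w y ≤ N) → ‖F x‖ ≤ C * Real.exp (k * N)) ∧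
      Real.exp (k * w a) * (1 - C * Real.exp (-(k * κ))) ≤ ‖F a‖ := by
  obtain ⟨q, hq, hqa, δ, hδ, hqw⟩ := exists_q hw hc hL a
  set r := δ / 4 with hr
  have hr0 : 0 < r := by positivity
  have hqw' : ∀ z, ‖z - a‖ ≤ 2 * r → (q z).re ≤ w z - (c/2) * ‖z - a‖ ^ 2 :=
    fun z hz => hqw z (by rw [hr] at hz; linarith)
  obtain ⟨C1, hC1, χ, hχ, hχ0, hχ1, hχone, hχsup, hd⟩ := exists_cutoff_at a hr0
  set κ := c / 2 * r ^ 2 with hκ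
  have hκ0 : 0 < κ := by positivity
  obtain ⟨s1, hs1, hws⟩ := Metric.continuousAt_iff.1 (hw.continuous.continuousAt (x := a)) (κ / 2) (by positivity)
  refine ⟨min r (s1 / 2), by positivity, fun s hs hsle => ?_⟩
  have hsr : s ≤ r := hsle.trans (min_le_left _ _)
  have hsw : ∀ y, ‖y - a‖ ≤ s → w y ≤ w a + κ / 2 := by
    intro y hy
    have h1 : dist y a < s1 := by
      rw [dist_eq_norm]
      have := hsle.trans (min_le_right _ _)
      linarith
    have := hws h1
    rw [Real.dist_eq] at this
    linarith [(abs_lt.1 this).2]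
  obtain ⟨ρ, hρT, hρ, hρc, hρ0, hρ1, hρs, hρr, hρn⟩ := exists_mollifier m hs
  set P := ∫ y, ρ y ^ 2 with hP
  have hP0 : 0 ≤ P := integral_nonneg fun _ => by positivity
  set A0 := (m * (C1 ^ 2 * volume.real (closedBall a (2 * r)))) / c with hA0
  have hA00 : 0 ≤ A0 := by positivity
  set C2 := (A0 + P) / 2 with hC2
  have hC20 : 0 ≤ C2 := by positivity
  refine ⟨1 + C2, by positivity, κ / 2, by positivity, fun k hk => ?_⟩
  obtain ⟨U, hU, hU1, hU2⟩ := solve_at hw hc hL hq hr0 hqw' hχ hd hk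
  set V : EC m → ℝ := fun x => k * w x with hVd
  have hV : ContDiff ℝ ∞ V := contDiff_const.mul hw
  have hp := hq.exp_mul k
  set p : EC m → ℂ := fun x => Complex.exp (k * q x) with hpd
  have hχp : IsTest (fun x => Vc χ x * p x) := hχ.mul_smooth hp.smooth
  have hEc : Continuous (fun x => Complex.exp (V x)) := (smooth_Vc hV).cexp.continuous
  have hl2 : LocallyIntegrable (fun x => Complex.exp (V x) * U x) := by
    have h := (locInt_of_memLp hU)
    rw [locallyIntegrable_iff] at h ⊢
    exact fun K hK => (h K hK).continuousOn_mul hEc.continuousOn hK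
  have hf : LocallyIntegrable (fun x => Vc χ x * p x - Complex.exp (V x) * U x) :=
    hχp.integrable.locallyIntegrable.sub hl2
  have hU3 : ∀ x (N : ℝ), (∀ y, ‖y - x‖ ≤ s → w y ≤ N) →
      ‖∫ y, Complex.exp (V y) * U y * ρ (x - y)‖ ≤ Real.exp (k * N) * (C2 * Real.exp (-(k * κ))) := by
    intro x N hN
    have h1 := U_bound hU hρT hρ0 x (g := fun y => Complex.exp (V y)) (M := Real.exp (k * N)) (t := Real.exp (k * κ))
      (by positivity) (by positivity) (fun y hy => by
        rw [Complex.norm_exp, Complex.ofReal_re]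
        apply Real.exp_le_exp.2
        rw [hVd]
        have := hN y (by rw [norm_sub_rev]; exact hρs _ hy)
        simp only
        gcongr)
    refine h1.trans ?_
    gcongr
    have h2 : Real.exp (k * κ) * ∫ y, ‖U y‖ ^ 2 ≤ A0 * Real.exp (-(k * κ)) := by
      calc _ ≤ Real.exp (k * κ) * (A0 * Real.exp (-(2 * (k * κ)))) := by gcongr
        _ = A0 * (Real.exp (k * κ) * Real.exp (-(2 * (k * κ)))) := by ring
        _ = _ := by rw [← Real.exp_add]; congr 2; ring
    rw [← Real.exp_neg, ← hP]
    rw [hC2]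
    linarith
  have hcv : ∀ x, cv (fun x => Vc χ x * p x - Complex.exp (V x) * U x) (Vc ρ) x =
      (∫ y, Vc χ y * p y * ρ (x - y)) - ∫ y, Complex.exp (V y) * U y * ρ (x - y) := by
    intro x
    have i1 : Integrable (fun y => Vc χ y * p y * Vc ρ (x - y)) :=
      cv_integrable hχp.integrable.locallyIntegrable hρT x
    have i2 : Integrable (fun y => Complex.exp (V y) * U y * Vc ρ (x - y)) := cv_integrable hl2 hρT x
    rw [cv]
    simp only [sub_mul]
    rw [integral_sub i1 i2]; rfl
  have hshift : ∀ x, ∫ y, ρ (x - y) = 1 := by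
    intro x
    rw [integral_sub_left_eq_self ρ volume x, hρ1]
  have hρi : Integrable ρ := hρ.continuous.integrable_of_hasCompactSupport hρc
  refine ⟨cv (fun x => Vc χ x * p x - Complex.exp (V x) * U x) (Vc ρ), ⟨cv_smooth hf hρT, fun j x => ?_⟩, ?_, ?_⟩
  · rw [dzb_cv hf hρT, cv]
    have h1 := weak_hol hV hχ hp hU hU1 (hρT.transl x) j
    simp only [dzb_transl hρT.smooth, mul_neg, integral_neg, neg_eq_zero] at h1
    exact h1
  · intro x N hN
    have hN' := hU3 x N hN
    rw [hcv]
    have h1 : ‖∫ y, Vc χ y * p y * ρ (x - y)‖ ≤ Real.exp (k * N) := by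
      calc _ ≤ ∫ y, Real.exp (k * N) * ρ (x - y) := by
            refine norm_integral_le_of_norm_le ((hρi.comp_sub_left x).const_mul _) (Eventually.of_forall fun y => ?_)
            rw [norm_mul, Complex.norm_real, Real.norm_of_nonneg (hρ0 _)]
            by_cases h0 : ρ (x - y) = 0
            · simp [h0]
            gcongr
            · exact hρ0 _
            rw [norm_mul, Vc, Complex.norm_real, Real.norm_of_nonneg (hχ0 _)]
            by_cases h2 : χ y = 0
            · rw [h2, zero_mul]; positivity
            have h3 := hqw' y (hχsup y h2)
            have h4 := hN y (by rw [norm_sub_rev]; exact hρs _ h0)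
            have h5 : ‖p y‖ ≤ Real.exp (k * N) := by
              rw [hpd, Complex.norm_exp]
              apply Real.exp_le_exp.2
              have : (k * q y : ℂ).re = k * (q y).re := by simp
              rw [this]
              gcongr
              have : 0 ≤ c / 2 * ‖y - a‖ ^ 2 := by positivity
              linarith
            calc χ y * ‖p y‖ ≤ 1 * Real.exp (k * N) := by gcongr; exact hχ1 y
              _ = _ := one_mul _
        _ = _ := by rw [integral_const_mul, hshift, mul_one]
    refine (norm_sub_le _ _).trans ?_
    have h2 : Real.exp (-(k * κ)) ≤ 1 := Real.exp_le_one_iff.2 (by rw [neg_nonpos]; positivity)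
    have h3 : Real.exp (k * N) * (C2 * Real.exp (-(k * κ))) ≤ Real.exp (k * N) * (C2 * 1) := by gcongr
    linarith
  · rw [hcv]
    have hN' := hU3 a _ hsw
    have h1 : ∫ y, Vc χ y * p y * ρ (a - y) = Complex.exp (k * w a) := by
      have e1 : ∫ y, Vc χ y * p y * ρ (a - y) = ∫ y, ρ y • p (a + y) := by
        rw [← integral_add_left_eq_self _ a]
        congr 1; ext y
        rw [sub_add_cancel_left, hρn]
        by_cases h0 : ρ y = 0
        · simp [h0]
        · have : χ (a + y) = 1 := hχone _ (by rw [add_sub_cancel_left]; exact (hρs y h0).trans hsr)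
          rw [Vc, this, Complex.real_smul]; push_cast; ring
      obtain ⟨M, hM⟩ := ((isCompact_closedBall a s).image hp.smooth.continuous).isBounded.exists_norm_le
      have hcm := (circled_mean (M := M) hp.smooth.continuous.stronglyMeasurable hρ.continuous hρc hρ0 hρs hρr a (fun y hy =>
        hM _ ⟨a + y, by simpa using hy, rfl⟩)).1
      rw [e1, hcm]
      simp only [hol_mean hp]
      rw [integral_smul_const, hρ1, one_smul]
      simp only [hpd, hqa]
    rw [h1]
    have h2 := norm_sub_norm_le (Complex.exp (k * w a)) (∫ y, Complex.exp (V y) * U y * ρ (a - y))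
    refine le_trans ?_ h2
    have h3 : ‖Complex.exp (k * w a)‖ = Real.exp (k * w a) := by
      rw [Complex.norm_exp]; simp
    rw [h3]
    have h4 : Real.exp (k * (w a + κ / 2)) * (C2 * Real.exp (-(k * κ))) = Real.exp (k * w a) * (C2 * Real.exp (-(k * (κ/2)))) := by
      rw [show Real.exp (k * (w a + κ / 2)) * (C2 * Real.exp (-(k * κ))) = C2 * (Real.exp (k * (w a + κ / 2)) * Real.exp (-(k * κ))) by ring,
        show Real.exp (k * w a) * (C2 * Real.exp (-(k * (κ/2)))) = C2 * (Real.exp (k * w a) * Real.exp (-(k * (κ/2)))) by ring,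
        ← Real.exp_add, ← Real.exp_add]
      congr 2; ring
    rw [h4] at hN'
    have h5 : 0 < Real.exp (k * w a) * Real.exp (-(k * (κ/2))) := by positivity
    linarith

end E4
end

section
section F1
variable {m : ℕ}

lemma Hol.dz {F : EC m → ℂ} (hF : Hol F) (j : Fin m) : Hol (dz j F) := by
  refine ⟨smooth_dz hF.smooth j, fun k x => ?_⟩
  rw [dzb_dz hF.smooth]
  have : _root_.dzb k F = fun _ => 0 := by ext y; exact hF.dzb k y
  rw [this]; simp [_root_.dz, dv]

lemma Hol.deriv_line {F : EC m → ℂ} (hF : Hol F) (z : EC m) :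
    deriv (fun t : ℂ => F (t • z)) = fun t => ∑ j, z j * _root_.dz j F (t • z) := by
  ext t
  have h1 : HasDerivAt (fun t : ℂ => t • z) z t := by simpa using (hasDerivAt_id t).smul_const z
  have h2 := (hF.diff (t • z)).hasFDerivAt.comp_hasDerivAt t h1
  have h3 : deriv (fun t : ℂ => F (t • z)) t = fderiv ℂ F (t • z) z := h2.deriv
  rw [h3]
  have h4 : ∀ j, _root_.dz j F (t • z) = fderiv ℂ F (t • z) (ee j) := by
    intro j
    simp only [_root_.dz, dv]
    rw [hF.fderiv_I, (hF.diff (t • z)).fderiv_restrictScalars ℝ]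
    simp only [ContinuousLinearMap.coe_restrictScalars']
    linear_combination (-(1/2) * fderiv ℂ F (t • z) (ee j)) * Complex.I_mul_I
  have h5 : z = ∑ j, z j • ee j := by
    ext i
    simp only [ee, WithLp.ofLp_sum, Finset.sum_apply, PiLp.smul_apply, PiLp.single_apply]
    simp
  conv_lhs => rw [h5]
  simp only [map_sum, map_smul, h4, smul_eq_mul]
  rw [← h5]

lemma Hol.line_diff {F : EC m → ℂ} (hF : Hol F) (z : EC m) : Differentiable ℂ (fun t : ℂ => F (t • z)) :=
  hF.diff.comp (by fun_prop)

lemma hol_poly (d : ℕ) : ∀ {F : EC m → ℂ}, Hol F → ∃ p : MvPolynomial (Fin m) ℂ, p.IsHomogeneous d ∧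
    ∀ z : EC m, iteratedDeriv d (fun t : ℂ => F (t • z)) 0 = MvPolynomial.eval (fun i => z i) p := by
  induction d with
  | zero =>
    intro F hF
    exact ⟨MvPolynomial.C (F 0), MvPolynomial.isHomogeneous_C _ _, fun z => by simp⟩
  | succ d ih =>
    intro F hF
    choose p hp1 hp2 using fun j => ih (hF.dz j)
    refine ⟨∑ j, MvPolynomial.X j * p j, ?_, fun z => ?_⟩
    · refine MvPolynomial.IsHomogeneous.sum _ _ _ fun j _ => ?_
      rw [add_comm]
      exact (MvPolynomial.isHomogeneous_X _ j).mul (hp1 j)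
    · rw [iteratedDeriv_succ', hF.deriv_line]
      have hc : ∀ j, ContDiffAt ℂ d (fun t : ℂ => _root_.dz j F (t • z)) 0 := fun j =>
        ((hF.dz j).line_diff z).contDiff.contDiffAt
      rw [iteratedDeriv_fun_sum (fun j _ => contDiffAt_const.mul (hc j))]
      simp only [map_sum, map_mul, MvPolynomial.eval_X]
      refine Finset.sum_congr rfl fun j _ => ?_
      rw [iteratedDeriv_const_mul (z j) (hc j), hp2]

lemma hol_taylor {F : EC m → ℂ} (hF : Hol F) : ∃ p : ℕ → MvPolynomial (Fin m) ℂ, (∀ d, (p d).IsHomogeneous d) ∧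
    ∀ z : EC m, HasSum (fun d => MvPolynomial.eval (fun i => z i) (p d)) (F z) ∧
      ∀ T B : ℝ, 0 < T → (∀ t : ℂ, ‖t‖ = T → ‖F (t • z)‖ ≤ B) →
        ∀ d, ‖MvPolynomial.eval (fun i => z i) (p d)‖ ≤ B / T ^ d := by
  choose p hp1 hp2 using fun d => hol_poly d hF
  refine ⟨fun d => MvPolynomial.C ((d.factorial : ℂ)⁻¹) * p d, fun d => ?_, fun z => ⟨?_, fun T B hT hB d => ?_⟩⟩
  · have := (MvPolynomial.isHomogeneous_C (Fin m) ((d.factorial : ℂ)⁻¹)).mul (hp1 d)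
    rwa [zero_add] at this
  · have := Complex.hasSum_taylorSeries_of_entire (hF.line_diff z) 0 1
    simpa [hp2] using this
  · have := Complex.norm_iteratedDeriv_le_of_forall_mem_sphere_norm_le d hT (hF.line_diff z).diffContOnCl (c := 0) (C := B)
      (fun t ht => hB t (by simpa using ht))
    rw [hp2] at this
    simp only [map_mul, MvPolynomial.eval_C, norm_mul, norm_inv, Complex.norm_natCast]
    have hf : (0:ℝ) < d.factorial := by exact_mod_cast d.factorial_pos
    rw [inv_mul_le_iff₀ hf]
    rwa [← mul_div_assoc]

end F1
end

section
section
variable {m : ℕ}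

lemma D2_add_sq {v : EC m → ℝ} (hv : ContDiff ℝ ∞ v) (η : ℝ) (a x h : EC m) :
    D2 (fun y => v y + η * ‖y - a‖ ^ 2) x h h = D2 v x h h + 2 * η * ‖h‖ ^ 2 := by
  have e : fderiv ℝ (fun y => v y + η * ‖y - a‖ ^ 2) =
      fun x => fderiv ℝ v x + η • ((2:ℕ) • innerSL ℝ (x - a)) := by
    ext1 x
    have h1 : HasFDerivAt v (fderiv ℝ v x) x := (hv.differentiable (by simp) x).hasFDerivAt
    have h2 : HasFDerivAt (fun y : EC m => ‖y - a‖ ^ 2) ((2:ℕ) • innerSL ℝ (x - a)) x := by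
      have := (hasStrictFDerivAt_norm_sq (x - a)).hasFDerivAt.comp x ((hasFDerivAt_id x).sub_const a)
      rw [ContinuousLinearMap.comp_id] at this; exact this
    exact (h1.add (h2.const_mul η)).fderiv
  unfold D2
  rw [e]
  have h1 : HasFDerivAt (fderiv ℝ v) (fderiv ℝ (fderiv ℝ v) x) x :=
    ((fderiv_smooth hv).differentiable (by simp) x).hasFDerivAt
  have h2 : HasFDerivAt (fun y : EC m => innerSL ℝ (y - a)) (innerSL ℝ : EC m →L[ℝ] _) x := by
    have := (innerSL ℝ (E := EC m)).hasFDerivAt.comp x ((hasFDerivAt_id x).sub_const a)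
    rw [ContinuousLinearMap.comp_id] at this; exact this
  have h3 := h1.add (((h2.const_smul (2:ℕ))).const_smul η)
  have h4 := h3.fderiv
  erw [h4]
  simp only [_root_.add_apply, _root_.smul_apply]
  have : innerSL ℝ h h = ‖h‖ ^ 2 := by
    simp
  rw [this]; simp; ring

lemma kp_fun {u : EC m → EReal} (hu : IsPSH u) {a : EC m} (ha : u a ≠ ⊥) {K : Set (EC m)} (hK : IsCompact K)
    (hKu : ∀ x ∈ K, u x = ⊥) {Λ R' δ : ℝ} (hΛ : 0 < Λ) (hR' : 0 < R') (hδ : 0 < δ) (haR : ‖a‖ ≤ R') :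
    ∃ C > 0, ∃ k0 : ℕ, ∀ k ≥ k0, ∃ F : EC m → ℂ, Hol F ∧
      (∀ x, ‖x‖ ≤ R' → ‖F x‖ ≤ C * Real.exp (k * δ)) ∧
      (∀ x ∈ K, ‖F x‖ ≤ C * Real.exp (k * (δ - Λ))) ∧
      Real.exp (-(k * δ)) / 2 ≤ ‖F a‖ := by
  obtain ⟨r1, hr1⟩ := hK.isBounded.exists_norm_le
  set R : ℝ := R' + 1 + |r1| with hR
  have hr1' := abs_nonneg r1
  have hr1'' := le_abs_self r1
  have hRpos : 0 < R := by positivity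
  obtain ⟨v, hv, hvL, hv0, ⟨s1, hs1, hvK⟩, hva⟩ :=
    exists_psh_smooth hu ha hK hKu hΛ hRpos hδ (by linarith : ‖a‖ ≤ R)
  set η : ℝ := δ / (R + ‖a‖ + 1) ^ 2 with hη
  have hηpos : 0 < η := by positivity
  set w : EC m → ℝ := fun y => v y + η * ‖y - a‖ ^ 2 with hw
  have hws : ContDiff ℝ ∞ w := by
    refine hv.add (contDiff_const.mul ?_)
    exact (contDiff_id.sub contDiff_const).norm_sq ℝ
  have hq : ∀ y, ‖y‖ ≤ R → η * ‖y - a‖ ^ 2 ≤ δ := by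
    intro y hy
    have h1 : ‖y - a‖ ≤ R + ‖a‖ + 1 := (norm_sub_le _ _).trans (by linarith)
    have h2 : ‖y - a‖ ^ 2 ≤ (R + ‖a‖ + 1) ^ 2 := by gcongr
    calc η * ‖y - a‖ ^ 2 ≤ η * (R + ‖a‖ + 1) ^ 2 := by gcongr
      _ = δ := by rw [hη]; field_simp
  have hwL : ∀ x h, η * ‖h‖ ^ 2 ≤ (1 / 4) * (D2 w x h h + D2 w x (I • h) (I • h)) := by
    intro x h
    rw [hw, D2_add_sq hv, D2_add_sq hv]
    have := hvL x h
    have e : ‖I • h‖ = ‖h‖ := by rw [norm_smul]; simp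
    rw [e]; nlinarith
  obtain ⟨s0, hs0, H⟩ := exists_holo hws hηpos hwL a
  set s := min s0 (min s1 1) with hs
  have hspos : 0 < s := by positivity
  obtain ⟨C, hC, κ, hκ, H⟩ := H s hspos (min_le_left _ _)
  have hlim : Tendsto (fun k : ℕ => C * Real.exp (-(k * κ))) atTop (nhds (C * 0)) := by
    refine Tendsto.const_mul C (Real.tendsto_exp_neg_atTop_nhds_zero.comp ?_)
    exact tendsto_natCast_atTop_atTop.atTop_mul_const hκ
  rw [mul_zero] at hlim
  obtain ⟨k0, hk0⟩ := eventually_atTop.1 (hlim.eventually (Iic_mem_nhds (by norm_num : (0:ℝ) < 1/2)))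
  refine ⟨C, hC, max k0 1, fun k hk => ?_⟩
  obtain ⟨F, hF, hFb, hFa⟩ := H k ((le_max_right _ _).trans hk)
  have hss1 : s ≤ s1 := (min_le_right _ _).trans (min_le_left _ _)
  have hs1' : s ≤ 1 := (min_le_right _ _).trans (min_le_right _ _)
  refine ⟨F, hF, fun x hx => hFb x δ fun y hy => ?_, fun x hx => hFb x (δ - Λ) fun y hy => ?_, ?_⟩
  · have hy' : ‖y‖ ≤ R := by
      have := norm_le_norm_add_norm_sub' y x
      linarith
    have := hv0 y hy'
    have := hq y hy'
    simp only [hw]; linarith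
  · have hy' : ‖y‖ ≤ R := by
      have := norm_le_norm_add_norm_sub' y x
      have := hr1 x hx
      linarith
    have := hvK x hx y (hy.trans hss1)
    have := hq y hy'
    simp only [hw]; linarith
  · have h1 : C * Real.exp (-(k * κ)) ≤ 1/2 := hk0 k ((le_max_left _ _).trans hk)
    have h2 : -δ ≤ w a := by simp [hw]; linarith
    have h3 : Real.exp (-(k * δ)) ≤ Real.exp (k * w a) := by
      apply Real.exp_le_exp.2; nlinarith [(Nat.cast_nonneg k : (0:ℝ) ≤ k)]
    have h4 := Real.exp_pos (k * w a)
    nlinarith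
end
end

section
section
variable {m : ℕ}

theorem kp {u : EC m → EReal} (hu : IsPSH u) {a : EC m} (ha : u a ≠ ⊥) {K : Set (EC m)} (hK : IsCompact K)
    (hKu : ∀ x ∈ K, u x = ⊥) {A : ℝ} (hA : 1 ≤ A) :
    ∃ k0 : ℕ, ∀ k ≥ k0, ∃ p : ℕ → MvPolynomial (Fin m) ℂ, (∀ d, (p d).IsHomogeneous d) ∧
      (∀ z : EC m, ‖z‖ ≤ 1 → ∑ d ∈ Finset.range (k+1), ‖MvPolynomial.eval (fun i => z i) (p d)‖ ≤ Real.exp k) ∧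
      (∀ z ∈ K, ‖∑ d ∈ Finset.range (k+1), MvPolynomial.eval (fun i => z i) (p d)‖ ≤ (A ^ k)⁻¹) ∧
      ∑ d ∈ Finset.range (k+1), MvPolynomial.eval (fun i => a i) (p d) = 1 := by
  obtain ⟨r1, hr1⟩ := hK.isBounded.exists_norm_le
  have hr1' := abs_nonneg r1
  have hr1'' := le_abs_self r1
  have hna := norm_nonneg a
  set r0 : ℝ := 1 + ‖a‖ + |r1| with hr0
  have hr0p : 0 < r0 := by positivity
  set Λ : ℝ := Real.log A + 2 with hΛ
  have hΛ2 : 2 ≤ Λ := by have := Real.log_nonneg hA; linarith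
  have hexpΛ : Real.exp Λ = A * Real.exp 2 := by
    rw [hΛ, Real.exp_add, Real.exp_log (by linarith)]
  have hT1 : 2 ≤ Real.exp Λ := by
    have := Real.add_one_le_exp Λ; linarith
  obtain ⟨C, hC, k1, H⟩ := kp_fun hu ha hK hKu (by linarith : 0 < Λ) (by positivity : 0 < r0 * Real.exp Λ)
    (by norm_num : (0:ℝ) < 1/4) (by nlinarith)
  obtain ⟨k2, hk2⟩ := exists_nat_ge (8 * C * 2)
  refine ⟨max k1 k2, fun k hk => ?_⟩
  obtain ⟨F, hF, hF1, hFK, hFa⟩ := H k ((le_max_left _ _).trans hk)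
  obtain ⟨q, hq, hqF⟩ := hol_taylor hF
  set X : ℝ := Real.exp (k / 4) with hX
  have hX1 : 1 ≤ X := Real.one_le_exp (by positivity)
  have hXp : 0 < X := by linarith
  have hCX : 8 * C ≤ X ^ 2 := by
    have h1 : X ^ 2 = Real.exp (k/2) := by rw [hX, ← Real.exp_nat_mul]; congr 1; push_cast; ring
    have h2 := Real.add_one_le_exp ((k:ℝ)/2)
    have h3 : (k2:ℝ) ≤ k := by exact_mod_cast (le_max_right _ _).trans hk
    rw [h1]; linarith
  set ρ : ℝ := (Real.exp Λ)⁻¹ with hρ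
  have hρ0 : 0 < ρ := by positivity
  have hρ2 : ρ ≤ 1/2 := by
    rw [hρ, one_div]; exact inv_anti₀ (by norm_num) hT1
  have hAk : 0 < (A ^ k)⁻¹ := by positivity
  have hAk1 : (A ^ k)⁻¹ ≤ 1 := inv_le_one_of_one_le₀ (one_le_pow₀ hA)
  have hρk : ρ ^ k * X ^ 8 = (A ^ k)⁻¹ := by
    have h1 : X ^ 8 = Real.exp 2 ^ k := by
      rw [hX, ← Real.exp_nat_mul, ← Real.exp_nat_mul]; congr 1; push_cast; ring
    rw [h1, hρ, hexpΛ, inv_pow, mul_pow]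
    field_simp
  have e1 : Real.exp (k * (1/4)) = X := by rw [hX]; congr 1; ring
  have e2 : Real.exp (-(k * (1/4))) = X⁻¹ := by rw [← e1, Real.exp_neg]
  have e3 : Real.exp (k * (1/4 - Λ)) = X * ρ ^ k := by
    rw [mul_sub, sub_eq_add_neg, Real.exp_add, e1, Real.exp_neg, Real.exp_nat_mul, hρ, inv_pow]
  rw [e1] at hF1
  rw [e2] at hFa
  rw [e3] at hFK
  have hterm : ∀ z : EC m, ‖z‖ ≤ r0 → ∀ d, ‖MvPolynomial.eval (fun i => z i) (q d)‖ ≤ (C * X) * ρ ^ d := by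
    intro z hz d
    have := (hqF z).2 (Real.exp Λ) (C * X) (by positivity) (fun t ht => hF1 _ (by
      rw [norm_smul, ht, mul_comm]; gcongr)) d
    rwa [hρ, inv_pow, ← div_eq_mul_inv]
  have htail : ∀ z : EC m, ‖z‖ ≤ r0 →
      ‖∑ d ∈ Finset.range (k+1), MvPolynomial.eval (fun i => z i) (q d) - F z‖ ≤ C * X * ρ ^ k := by
    intro z hz
    refine (norm_sub_le_of_geometric_bound_of_hasSum (by linarith) (hterm z hz) (hqF z).1 (k+1)).trans ?_
    rw [div_le_iff₀ (by linarith), pow_succ]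
    have : 0 < C * X * ρ ^ k := by positivity
    nlinarith
  set c : ℂ := ∑ d ∈ Finset.range (k+1), MvPolynomial.eval (fun i => a i) (q d) with hc
  have hρk' : C * X * ρ ^ k ≤ X⁻¹ / 8 := by
    have h1 : 8 * (C * X * ρ ^ k) * X ≤ 1 := by
      calc 8 * (C * X * ρ ^ k) * X = (8 * C) * (X ^ 2 * ρ ^ k) := by ring
        _ ≤ X ^ 2 * (X ^ 2 * ρ ^ k) := by gcongr
        _ = X ^ 4 * ρ ^ k := by ring
        _ ≤ X ^ 8 * ρ ^ k := by gcongr <;> first | exact hX1 | norm_num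
        _ ≤ 1 := by rw [mul_comm, hρk]; exact hAk1
    rw [← one_div, div_div, le_div_iff₀ (by positivity)]
    linarith
  have hcl : X⁻¹ / 4 ≤ ‖c‖ := by
    have h1 := htail a (by linarith)
    rw [← hc] at h1
    have h2 := norm_sub_norm_le (F a) c
    rw [norm_sub_rev] at h2
    have : 0 < X⁻¹ := by positivity
    linarith
  have hcp : 0 < ‖c‖ := lt_of_lt_of_le (by positivity) hcl
  have hc0 : c ≠ 0 := norm_pos_iff.1 hcp
  have hci : ‖c⁻¹‖ ≤ 4 * X := by
    rw [norm_inv]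
    calc ‖c‖⁻¹ ≤ (X⁻¹ / 4)⁻¹ := inv_anti₀ (by positivity) hcl
      _ = 4 * X := by field_simp
  refine ⟨fun d => MvPolynomial.C c⁻¹ * q d, fun d => by
    simpa using (MvPolynomial.isHomogeneous_C (Fin m) c⁻¹).mul (hq d), ?_, ?_, ?_⟩
  · intro z hz
    simp only [map_mul, MvPolynomial.eval_C, norm_mul, ← Finset.mul_sum]
    have h1 : ∑ d ∈ Finset.range (k+1), ‖MvPolynomial.eval (fun i => z i) (q d)‖ ≤ C * X * 2 := by
      calc _ ≤ ∑ d ∈ Finset.range (k+1), (C * X) * ρ ^ d :=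
            Finset.sum_le_sum fun d _ => hterm z (by linarith) d
        _ = C * X * ∑ d ∈ Finset.range (k+1), ρ ^ d := by rw [Finset.mul_sum]
        _ ≤ C * X * ∑ d ∈ Finset.range (k+1), (1/2 : ℝ) ^ d := by gcongr
        _ ≤ C * X * 2 := by gcongr; exact sum_geometric_two_le _
    have e4 : Real.exp k = X ^ 4 := by
      rw [hX, ← Real.exp_nat_mul]; congr 1; push_cast; ring
    calc _ ≤ (4 * X) * (C * X * 2) := by gcongr
      _ = 8 * C * X ^ 2 := by ring
      _ ≤ X ^ 2 * X ^ 2 := by gcongr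
      _ = Real.exp k := by rw [e4]; ring
  · intro z hz
    simp only [map_mul, MvPolynomial.eval_C, ← Finset.mul_sum, norm_mul]
    have h1 : ‖∑ d ∈ Finset.range (k+1), MvPolynomial.eval (fun i => z i) (q d)‖ ≤ 2 * (C * X * ρ ^ k) := by
      have h2 := htail z (by have := hr1 z hz; linarith)
      have h3 := hFK z hz
      have h4 := norm_le_norm_add_norm_sub' (∑ d ∈ Finset.range (k+1), MvPolynomial.eval (fun i => z i) (q d)) (F z)
      linarith
    calc _ ≤ (4 * X) * (2 * (C * X * ρ ^ k)) := by gcongr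
      _ = 8 * C * (X ^ 2 * ρ ^ k) := by ring
      _ ≤ X ^ 2 * (X ^ 2 * ρ ^ k) := by gcongr
      _ = X ^ 4 * ρ ^ k := by ring
      _ ≤ X ^ 8 * ρ ^ k := by gcongr <;> first | exact hX1 | norm_num
      _ = _ := by rw [mul_comm, hρk]
  · simp only [map_mul, MvPolynomial.eval_C, ← Finset.mul_sum]
    rw [← hc]; exact inv_mul_cancel₀ hc0
end
end

section
section
variable {m : ℕ}

lemma psh_circle_null {u : EC m → EReal} (hu : IsPSH u) {a : EC m} (ha : u a ≠ ⊥) (h : EC m) :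
    (volume.restrict (Set.Ioc (0:ℝ) (2 * Real.pi))) {θ : ℝ | u (a + Complex.exp (θ * I) • h) = ⊥} = 0 := by
  have hm := hu.1.measurable
  set E := {θ : ℝ | u (a + Complex.exp (θ * I) • h) = ⊥} with hE
  have hEm : MeasurableSet E := by
    have hc : Continuous fun θ : ℝ => a + Complex.exp (θ * I) • h := by fun_prop
    exact (hm.comp hc.measurable) (measurableSet_singleton ⊥)
  by_contra hne
  have h1 := hu.2.2.2 a h 1 one_pos
  apply ha
  rw [← le_bot_iff]
  refine h1.trans ?_
  rw [circleLineMean, erealIntegral]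
  have : ∫⁻ θ : ℝ, erealToENNReal (-(u (a + (((1:ℝ):ℂ) * Complex.exp (θ * I)) • h))) ∂(volume.restrict (Set.Ioc (0:ℝ) (2 * Real.pi))) = ⊤ := by
    rw [eq_top_iff]
    calc (⊤ : ℝ≥0∞) = ∫⁻ θ, E.indicator (fun _ => ⊤) θ ∂(volume.restrict (Set.Ioc (0:ℝ) (2 * Real.pi))) := by
          rw [lintegral_indicator_const hEm, ENNReal.top_mul hne]
      _ ≤ _ := by
          apply lintegral_mono
          intro θ
          by_cases hθ : θ ∈ E
          · have : u (a + Complex.exp (θ * I) • h) = ⊥ := hθ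
            simp [this, erealToENNReal]
          · simp [hθ]
  rw [this]
  have : ∀ x : EReal, x - ((⊤:ℝ≥0∞) : EReal) = ⊥ := by intro x; simp
  rw [this, EReal.coe_mul_bot_of_pos (by positivity)]

lemma psh_null {u : EC m → EReal} (hu : IsPSH u) : volume {x : EC m | u x = ⊥} = 0 := by
  obtain ⟨a, ha⟩ := hu.2.1
  have hm := hu.1.measurable
  set Z : Set (EC m) := {y | u (a + y) = ⊥} with hZ
  have e : {x : EC m | u x = ⊥} = (fun x => -a + x) ⁻¹' Z := by
    ext x; simp [hZ]
  rw [e, measure_preimage_add]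
  have hZm : MeasurableSet Z := (hm.comp (measurable_const_add a)) (measurableSet_singleton ⊥)
  set ν := (volume.restrict (Set.Ioc (0:ℝ) (2 * Real.pi)))
  set S : Set (EC m × ℝ) := {q | Complex.exp (q.2 * I) • q.1 ∈ Z} with hS
  have hSm : MeasurableSet S := by
    have hc : Continuous fun q : EC m × ℝ => Complex.exp (q.2 * I) • q.1 := by fun_prop
    exact hc.measurable hZm
  have h1 : ((volume : Measure (EC m)).prod ν) S = 0 := by
    rw [Measure.measure_prod_null hSm]
    refine Eventually.of_forall fun y => ?_
    exact psh_circle_null hu ha y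
  rw [Measure.prod_apply_symm hSm] at h1
  have h2 : ∀ θ : ℝ, volume ((fun x : EC m => (x, θ)) ⁻¹' S) = volume Z := by
    intro θ
    have : (fun x : EC m => (x, θ)) ⁻¹' S = (fun y => Complex.exp (θ * I) • y) ⁻¹' Z := rfl
    rw [this]
    let L : EC m ≃ₗᵢ[ℝ] EC m :=
      { LinearEquiv.ofBijective (((Complex.exp (θ * I)) • (LinearMap.id : EC m →ₗ[ℂ] EC m)).restrictScalars ℝ) (by
          constructor
          · intro x y hxy
            exact smul_right_injective _ (Complex.exp_ne_zero _) hxy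
          · intro y
            exact ⟨(Complex.exp (θ * I))⁻¹ • y, by
              simp [smul_smul, Complex.exp_ne_zero]⟩) with
        norm_map' := by
          intro x
          simp [norm_smul, Complex.norm_exp_ofReal_mul_I] }
    have := L.measurePreserving.measure_preimage hZm.nullMeasurableSet
    exact this
  simp_rw [h2] at h1
  rw [lintegral_const] at h1
  rcases mul_eq_zero.1 h1 with h | h
  · exact h
  · exfalso
    simp [ν] at h
    linarith [Real.pi_pos]
end
end

section
section
variable {m : ℕ}

/-- affine chart -/
def chart (i : Fin (m+1)) (x : Fin (m+1) → ℂ) : EC m :=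
  WithLp.toLp 2 (fun j : Fin m => x (i.succAbove j) / x i)

lemma chart_ae {u : EC m → EReal} (hu : IsPSH u) (i : Fin (m+1)) :
    ∀ᵐ x : EC (m+1), x i ≠ 0 ∧ u (chart i (fun k => x k)) ≠ ⊥ := by
  have hm := hu.1.measurable
  have h0 : ∀ᵐ y : EC m, y ∈ {y | u y = ⊥}ᶜ := by
    rw [ae_iff]; simpa using psh_null hu
  have hZm : MeasurableSet ({y | u y = ⊥}ᶜ : Set (EC m)) := (hm (measurableSet_singleton ⊥)).compl
  set s : Set (ℂ × EC m) := {q | q.1 ≠ 0 ∧ q.1⁻¹ • q.2 ∈ {y | u y = ⊥}ᶜ} with hs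
  have hsm : MeasurableSet s := by
    apply MeasurableSet.inter
    · exact (measurable_fst (measurableSet_singleton (0:ℂ))).compl
    · have : Measurable fun q : ℂ × EC m => q.1⁻¹ • q.2 := by fun_prop
      exact this hZm
  have h1 : ∀ᵐ q ∂((volume : Measure ℂ).prod (volume : Measure (EC m))), q ∈ s := by
    rw [Measure.ae_prod_mem_iff_ae_ae_mem hsm]
    have hz : ∀ᵐ t : ℂ, t ≠ 0 := by rw [ae_iff]; simp
    filter_upwards [hz] with t ht
    let L : EC m →ₗ[ℂ] EC m := t⁻¹ • LinearMap.id
    have hL : Function.Surjective L := fun y => ⟨t • y, by simp [L, smul_smul, ht]⟩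
    filter_upwards [(ae_comp_linearMap_mem_iff L volume volume hL hZm).2 h0] with y hy
    exact ⟨ht, hy⟩
  let L : EC (m+1) →ₗ[ℂ] (ℂ × EC m) :=
    { toFun := fun x => (x i, WithLp.toLp 2 (fun j => x (i.succAbove j)))
      map_add' := fun x y => by ext <;> simp
      map_smul' := fun c x => by ext <;> simp }
  have hL : Function.Surjective L := fun q =>
    ⟨WithLp.toLp 2 (i.insertNth q.1 (fun j => q.2 j)), by ext <;> simp [L]⟩
  filter_upwards [(ae_comp_linearMap_mem_iff L volume (volume.prod volume) hL hsm).2 h1] with x hx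
  refine ⟨hx.1, ?_⟩
  have := hx.2
  have e : chart i (fun k => x k) = (L x).1⁻¹ • (L x).2 := by
    ext j; simp [chart, L, div_eq_inv_mul]
  rw [e]; exact this

lemma exists_good {u : EC m → EReal} (hu : IsPSH u) :
    ∃ x : Fin (m+1) → ℂ, ∀ i, x i ≠ 0 ∧ u (chart i x) ≠ ⊥ := by
  have h : ∀ᵐ x : EC (m+1), ∀ i, x i ≠ 0 ∧ u (chart i (fun k => x k)) ≠ ⊥ :=
    ae_all_iff.2 fun i => chart_ae hu i
  obtain ⟨x, hx⟩ := h.exists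
  exact ⟨fun k => x k, hx⟩
end
end

section
section
variable {m : ℕ}

lemma homog_eval {σ : Type*} {p : MvPolynomial σ ℂ} {d : ℕ} (hp : p.IsHomogeneous d) (c : ℂ) (x : σ → ℂ) :
    MvPolynomial.eval (fun i => c * x i) p = c ^ d * MvPolynomial.eval x p := by
  rw [MvPolynomial.eval_eq, MvPolynomial.eval_eq, Finset.mul_sum]
  refine Finset.sum_congr rfl fun I hI => ?_
  have h1 := hp (MvPolynomial.mem_support_iff.1 hI)
  simp only [mul_pow, Finset.prod_mul_distrib, Finset.prod_pow_eq_pow_sum]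
  rw [Finsupp.weight_apply, Finsupp.sum] at h1
  simp at h1
  rw [h1]; ring

lemma exists_homogenize (i : Fin (m+1)) (k : ℕ) {p : ℕ → MvPolynomial (Fin m) ℂ} (hp : ∀ d, (p d).IsHomogeneous d) :
    ∃ Q : MvPolynomial (Fin (m+1)) ℂ, Q.IsHomogeneous k ∧ ∀ x : Fin (m+1) → ℂ,
      MvPolynomial.eval x Q = ∑ d ∈ Finset.range (k+1), x i ^ (k - d) * MvPolynomial.eval (fun j => x (i.succAbove j)) (p d) := by
  refine ⟨∑ d ∈ Finset.range (k+1), MvPolynomial.X i ^ (k-d) * MvPolynomial.rename i.succAbove (p d), ?_, ?_⟩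
  · apply MvPolynomial.IsHomogeneous.sum
    intro d hd
    have h1 := ((MvPolynomial.isHomogeneous_X ℂ i).pow (k - d)).mul ((hp d).rename_isHomogeneous (f := i.succAbove))
    have : 1 * (k - d) + d = k := by have := Finset.mem_range.1 hd; omega
    rwa [this] at h1
  · intro x
    simp [MvPolynomial.eval_rename, Function.comp_def]

lemma chart_poly {u : EC m → EReal} (hu : IsPSH u) {x : Fin (m+1) → ℂ} {i : Fin (m+1)}
    (hx : x i ≠ 0 ∧ u (chart i x) ≠ ⊥) {K : Set (EC m)} (hK : IsCompact K)
    (hKu : ∀ x ∈ K, u x = ⊥) {A : ℝ} (hA : 1 ≤ A) :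
    ∀ᶠ k : ℕ in atTop, ∃ Q : MvPolynomial (Fin (m+1)) ℂ, Q.IsHomogeneous k ∧
      (∀ v : EC (m+1), ‖v‖ ≤ 1 → ‖MvPolynomial.eval (fun j => v j) Q‖ ≤ Real.exp k) ∧
      (∀ v : EC (m+1), ‖v‖ ≤ 1 → v i ≠ 0 → chart i (fun j => v j) ∈ K → ‖MvPolynomial.eval (fun j => v j) Q‖ ≤ (A ^ k)⁻¹) ∧
      ‖MvPolynomial.eval x Q‖ = ‖x i‖ ^ k := by
  obtain ⟨k0, H⟩ := kp hu hx.2 hK hKu hA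
  refine eventually_atTop.2 ⟨k0, fun k hk => ?_⟩
  obtain ⟨p, hp, hp1, hpK, hpa⟩ := H k hk
  obtain ⟨Q, hQ, hQe⟩ := exists_homogenize i k hp
  have key : ∀ y : Fin (m+1) → ℂ, y i ≠ 0 → MvPolynomial.eval y Q =
      y i ^ k * ∑ d ∈ Finset.range (k+1), MvPolynomial.eval (fun j => (chart i y) j) (p d) := by
    intro y hy
    rw [hQe, Finset.mul_sum]
    refine Finset.sum_congr rfl fun d hd => ?_
    have e : (fun j => y (i.succAbove j)) = fun j => y i * (chart i y) j := by
      ext j; simp only [chart]; field_simp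
    rw [e, homog_eval (hp d), ← mul_assoc, ← pow_add]
    congr 2
    have := Finset.mem_range.1 hd; omega
  have hvi : ∀ v : EC (m+1), ‖v‖ ≤ 1 → ‖v i‖ ≤ 1 := fun v hv => (PiLp.norm_apply_le v i).trans hv
  refine ⟨Q, hQ, fun v hv => ?_, fun v hv hvi0 hvK => ?_, ?_⟩
  · rw [hQe]
    refine (norm_sum_le _ _).trans (le_trans ?_ (hp1 (WithLp.toLp 2 (fun j => v (i.succAbove j))) ?_))
    · refine Finset.sum_le_sum fun d _ => ?_
      rw [norm_mul, norm_pow]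
      exact mul_le_of_le_one_left (norm_nonneg _) (pow_le_one₀ (norm_nonneg _) (hvi v hv))
    · refine le_trans ?_ hv
      rw [EuclideanSpace.norm_eq, EuclideanSpace.norm_eq]
      apply Real.sqrt_le_sqrt
      rw [Fin.sum_univ_succAbove _ i]
      simp only
      have := sq_nonneg ‖v i‖
      linarith
  · rw [key _ hvi0, norm_mul, norm_pow]
    exact (mul_le_of_le_one_left (norm_nonneg _) (pow_le_one₀ (norm_nonneg _) (hvi v hv))).trans (hpK _ hvK)
  · rw [key _ hx.1, hpa, mul_one, norm_pow]

lemma prod_poly {u : EC m → EReal} (hu : IsPSH u) {x : Fin (m+1) → ℂ}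
    (hx : ∀ i, x i ≠ 0 ∧ u (chart i x) ≠ ⊥) {K : Set (EC m)} (hK : IsCompact K)
    (hKu : ∀ x ∈ K, u x = ⊥) {B : ℝ} (hB : 0 < B) :
    ∀ᶠ k : ℕ in atTop, ∃ Q : MvPolynomial (Fin (m+1)) ℂ, Q.IsHomogeneous ((m+1)*k) ∧
      (∀ v : EC (m+1), ‖v‖ ≤ 1 → ∀ i, v i ≠ 0 → chart i (fun j => v j) ∈ K →
        ‖MvPolynomial.eval (fun j => v j) Q‖ ≤ 1) ∧
      B ^ ((m+1)*k) ≤ ‖MvPolynomial.eval x Q‖ := by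
  set κ : ℝ := ∏ i, ‖x i‖ with hκ
  have hκ0 : 0 < κ := Finset.prod_pos fun i _ => norm_pos_iff.2 (hx i).1
  set l : ℝ := κ⁻¹ * B ^ (m+1) + 1 with hl
  have hl1 : 1 ≤ l := by have : 0 < κ⁻¹ * B ^ (m+1) := by positivity
                         linarith
  set A : ℝ := Real.exp m * l with hA
  have hA1 : 1 ≤ A := one_le_mul_of_one_le_of_one_le (Real.one_le_exp (by positivity)) hl1
  filter_upwards [eventually_all.2 fun i => chart_poly hu (hx i) hK hKu hA1] with k H
  choose Q hQh hQ1 hQK hQx using H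
  refine ⟨MvPolynomial.C ((l ^ k : ℝ) : ℂ) * ∏ i, Q i, ?_, ?_, ?_⟩
  · have h1 := (MvPolynomial.isHomogeneous_C (Fin (m+1)) ((l ^ k : ℝ) : ℂ)).mul
      (MvPolynomial.IsHomogeneous.prod Finset.univ Q (fun _ => k) fun i _ => hQh i)
    simpa using h1
  · intro v hv i hvi hvK
    have hlk : ‖((l ^ k : ℝ) : ℂ)‖ = l ^ k := by
      rw [Complex.norm_real, Real.norm_eq_abs, abs_of_nonneg (by positivity)]
    rw [map_mul, MvPolynomial.eval_C, map_prod, norm_mul, hlk, norm_prod, Fin.prod_univ_succAbove _ i]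
    have h1 : ∏ j : Fin m, ‖MvPolynomial.eval (fun j => v j) (Q (i.succAbove j))‖ ≤ ∏ j : Fin m, Real.exp k :=
      Finset.prod_le_prod (fun _ _ => norm_nonneg _) fun j _ => hQ1 _ v hv
    have h2 := hQK i v hv hvi hvK
    calc _ ≤ l ^ k * ((A ^ k)⁻¹ * ∏ j : Fin m, Real.exp k) := by
          gcongr
      _ = 1 := by
        rw [Finset.prod_const, Finset.card_univ, Fintype.card_fin, ← Real.exp_nat_mul, hA, mul_pow, ← Real.exp_nat_mul,
          mul_comm (m:ℝ) k]
        field_simp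
  · have hlk : ‖((l ^ k : ℝ) : ℂ)‖ = l ^ k := by
      rw [Complex.norm_real, Real.norm_eq_abs, abs_of_nonneg (by positivity)]
    rw [map_mul, MvPolynomial.eval_C, map_prod, norm_mul, hlk, norm_prod]
    simp only [hQx]
    rw [Finset.prod_pow, ← hκ, ← mul_pow, pow_mul]
    gcongr
    rw [hl, add_mul, mul_comm κ⁻¹, mul_assoc, inv_mul_cancel₀ hκ0.ne']
    linarith
end
end

section
section
variable {m : ℕ}

lemma exists_series {n : ℕ} {P : ℕ → MvPolynomial (Fin n) ℂ} (hP : ∀ d, (P d).IsHomogeneous d) :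
    ∃ S : MvPowerSeries (Fin n) ℂ, ∀ v d, lineCoeff S v d = MvPolynomial.eval (fun i => v i) (P d) := by
  let S : MvPowerSeries (Fin n) ℂ := fun I => MvPolynomial.coeff I (P (∑ i, I i))
  have hS : ∀ I, MvPowerSeries.coeff I S = MvPolynomial.coeff I (P (∑ i, I i)) := fun I => rfl
  refine ⟨S, fun v d => ?_⟩
  rw [lineCoeff, MvPolynomial.eval_eq']
  symm
  have hdeg : ∀ I ∈ (P d).support, ∑ i, I i = d := by
    intro I hI
    have h1 := hP d (MvPolynomial.mem_support_iff.1 hI)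
    rw [Finsupp.weight_apply, Finsupp.sum_fintype _ _ (by simp)] at h1
    simpa using h1
  refine Finset.sum_of_injOn (fun I : Fin n →₀ ℕ => (I : Fin n → ℕ)) ?_ ?_ ?_ ?_
  · intro I _ J _ h; exact DFunLike.coe_injective h
  · intro I hI
    simp only [Finset.mem_coe, Finset.Nat.mem_antidiagonalTuple]
    exact hdeg I hI
  · intro I hI hI'
    rw [Finset.Nat.mem_antidiagonalTuple] at hI
    rw [hS]
    simp only [Finsupp.equivFunOnFinite_symm_apply_apply]
    rw [hI]
    have : MvPolynomial.coeff (Finsupp.equivFunOnFinite.symm I) (P d) = 0 := by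
      by_contra h
      exact hI' ⟨Finsupp.equivFunOnFinite.symm I, MvPolynomial.mem_support_iff.2 h, by simp⟩
    rw [this, zero_mul]
  · intro I hI
    rw [hS]
    simp only [Finsupp.equivFunOnFinite_symm_coe]
    rw [hdeg I hI]

lemma main_aux
    (F : Set (EuclideanSpace ℂ (Fin (m + 1))))
    (hFsub : F ⊆ Metric.sphere (0 : EuclideanSpace ℂ (Fin (m + 1))) 1)
    (hFσ : ∃ c : ℕ → Set (EuclideanSpace ℂ (Fin m)),
      (∀ k, IsClosed (c k)) ∧ dirSet F = ⋃ k, c k)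
    (hpp : Pluripolar (dirSet F)) :
    ∃ S : MvPowerSeries (Fin (m + 1)) ℂ,
      (∀ v ∈ F, HasPosRadius (lineCoeff S v)) ∧ ¬ ConvUnifNearZero S := by
  obtain ⟨c, hc, hcF⟩ := hFσ
  obtain ⟨u, hu, huF⟩ := hpp
  obtain ⟨x, hx⟩ := exists_good hu
  let K : ℕ → Set (EC m) := fun j => (⋃ i ∈ Finset.range (j+1), c i) ∩ closedBall 0 j
  have hK : ∀ j, IsCompact (K j) := fun j =>
    (isCompact_closedBall (0 : EC m) (j:ℝ)).inter_left
      ((Finset.range (j+1)).finite_toSet.isClosed_biUnion fun i _ => hc i)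
  have hKu : ∀ j, ∀ y ∈ K j, u y = ⊥ := by
    intro j y hy
    apply huF
    rw [hcF]
    obtain ⟨i, _, hi⟩ := mem_iUnion₂.1 hy.1
    exact mem_iUnion.2 ⟨i, hi⟩
  obtain ⟨φ, hφ, H⟩ := extraction_forall_of_eventually fun j : ℕ =>
    prod_poly hu hx (hK j) (hKu j) (by positivity : (0:ℝ) < j + 1)
  choose Q hQh hQ1 hQx using H
  set D : ℕ → ℕ := fun j => (m+1) * φ j with hD
  have hDm : StrictMono D := fun a b h => Nat.mul_lt_mul_of_pos_left (hφ h) (Nat.succ_pos m)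
  classical
  let P : ℕ → MvPolynomial (Fin (m+1)) ℂ := fun d => if h : ∃ j, D j = d then Q h.choose else 0
  have hPD : ∀ j, P (D j) = Q j := by
    intro j
    have h : ∃ j', D j' = D j := ⟨j, rfl⟩
    simp only [P, dif_pos h]
    rw [hDm.injective h.choose_spec]
  have hP0 : ∀ d, (¬ ∃ j, D j = d) → P d = 0 := fun d h => by simp only [P, dif_neg h]
  have hPh : ∀ d, (P d).IsHomogeneous d := by
    intro d
    by_cases h : ∃ j, D j = d
    · obtain ⟨j, rfl⟩ := h
      rw [hPD]; exact hQh j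
    · rw [hP0 d h]; exact MvPolynomial.isHomogeneous_zero _ _ _
  obtain ⟨S, hS⟩ := exists_series hPh
  refine ⟨S, fun v hv => ?_, ?_⟩
  · have hv1 : ‖v‖ = 1 := by simpa using hFsub hv
    obtain ⟨i, hi⟩ : ∃ i, v i ≠ 0 := by
      by_contra h
      push Not at h
      have : v = 0 := by ext i; simpa using h i
      simp [this] at hv1
    have hmem : chart i (fun k => v k) ∈ dirSet F :=
      mem_iUnion.2 ⟨i, v, hv, hi, fun j => rfl⟩
    rw [hcF] at hmem
    obtain ⟨i0, hi0⟩ := mem_iUnion.1 hmem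
    obtain ⟨n0, hn0⟩ := exists_nat_ge ‖chart i (fun k => v k)‖
    have hj : ∀ j ≥ max i0 n0, chart i (fun k => v k) ∈ K j := by
      intro j hj
      refine ⟨mem_iUnion₂.2 ⟨i0, Finset.mem_range.2 (by have := le_max_left i0 n0; omega), hi0⟩, ?_⟩
      rw [mem_closedBall_zero_iff]
      exact hn0.trans (by exact_mod_cast (le_max_right i0 n0).trans hj)
    refine ⟨1/2, by norm_num, ?_⟩
    refine Summable.of_norm_bounded_eventually_nat (g := fun k => (1/2:ℝ)^k) summable_geometric_two ?_
    filter_upwards [eventually_ge_atTop (D (max i0 n0))] with d hd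
    rw [Real.norm_eq_abs, abs_of_nonneg (by positivity)]
    apply mul_le_of_le_one_left (by positivity)
    rw [hS]
    by_cases h : ∃ j, D j = d
    · obtain ⟨j, rfl⟩ := h
      rw [hPD]
      exact hQ1 j v hv1.le i hi (hj j (hDm.le_iff_le.1 hd))
    · rw [hP0 d h]; simp
  · rintro ⟨r, hr, g, hg⟩
    set X : EC (m+1) := WithLp.toLp 2 x with hX
    obtain ⟨t, ht, htr⟩ : ∃ t : ℝ, 0 < t ∧ t * ‖X‖ < r := by
      refine ⟨r / (‖X‖ + 1), by positivity, ?_⟩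
      rw [div_mul_eq_mul_div, div_lt_iff₀ (by positivity)]
      nlinarith [norm_nonneg X]
    set z : EC (m+1) := (t:ℂ) • X with hz
    have hzr : z ∈ ball (0 : EC (m+1)) r := by
      rw [mem_ball_zero_iff, hz, norm_smul, Complex.norm_real, Real.norm_eq_abs, abs_of_pos ht]
      exact htr
    have h1 := hg.tendsto_at hzr
    have h2 : Tendsto (fun N => partialSum S (N+1) z - partialSum S N z) atTop (nhds 0) := by
      have := (h1.comp (tendsto_add_atTop_nat 1)).sub h1
      simpa using this
    have h3 : ∀ N, partialSum S (N+1) z - partialSum S N z = lineCoeff S z N := by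
      intro N
      simp only [partialSum, Finset.sum_range_succ, lineCoeff]
      ring
    simp_rw [h3, hS] at h2
    have h4 := (h2.comp hDm.tendsto_atTop).norm
    rw [norm_zero] at h4
    obtain ⟨N, hN⟩ := exists_nat_ge (1/t)
    have h5 := (h4.eventually (Iio_mem_nhds (zero_lt_one))).and (eventually_ge_atTop N)
    obtain ⟨j, hj, hjN⟩ := h5.exists
    have hj' : ‖MvPolynomial.eval (fun i => z i) (P (D j))‖ < 1 := hj
    have ez : (fun i => z i) = fun i => (t:ℂ) * x i := by ext i; simp [hz, hX]
    rw [ez, homog_eval (hPh _), hPD, norm_mul, norm_pow, Complex.norm_real, Real.norm_eq_abs, abs_of_pos ht] at hj'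
    have h6 := hQx j
    have h7 : 1 ≤ t * (j + 1 : ℝ) := by
      have : (N:ℝ) ≤ j := by exact_mod_cast hjN
      rw [div_le_iff₀ ht] at hN
      nlinarith
    have h8 : 1 ≤ t ^ D j * (j + 1 : ℝ) ^ D j := by rw [← mul_pow]; exact one_le_pow₀ h7
    have h9 : t ^ D j * (j + 1 : ℝ) ^ D j ≤ t ^ D j * ‖MvPolynomial.eval x (Q j)‖ := by gcongr
    linarith
end
end

end

/-- **Levenberg–Molzon.** If the direction set `F'` is a pluripolar `F_σ` set, then the
suspension `S₀(F)` is not normal: some formal power series converges along each leaf yet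
does not converge uniformly on any neighborhood of the origin. -/
theorem not_normal_of_pluripolar_Fsigma {m : ℕ} (hm : 1 ≤ m)
    (F : Set (EuclideanSpace ℂ (Fin (m + 1)))) (hFne : F.Nonempty)
    (hFsub : F ⊆ Metric.sphere (0 : EuclideanSpace ℂ (Fin (m + 1))) 1)
    (hFσ : ∃ c : ℕ → Set (EuclideanSpace ℂ (Fin m)),
      (∀ k, IsClosed (c k)) ∧ dirSet F = ⋃ k, c k)
    (hpp : Pluripolar (dirSet F)) :
    ∃ S : MvPowerSeries (Fin (m + 1)) ℂ,
      (∀ v ∈ F, HasPosRadius (lineCoeff S v)) ∧ ¬ ConvUnifNearZero S :=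
  main_aux F hFsub hFσ hpp

end
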